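/- Assume S = S(a,b,c) is a finitely generated module over its center Z := Z(S), and let n be a positive integer such that S has a simple left module of k-dimension n and every simple left S-module has k-dimension at most n. Let m be a maximal ideal of Z. Then the quotient algebra S/(mS) is isomorphic as a k-algebra to the matrix algebra M_n(k) if and only if dim(m/m²) = 3 as a vector space over the residue field Z/m ≅ k. (That is, the Azumaya locus of S equals the smooth locus of maxSpec Z.) -/

import Mathlib

noncomputable section

/-- The defining relations of the 3-dimensional Sklyanin algebra `S(a,b,c)`:
`a·yz + b·zy + c·x²`, `a·zx + b·xz + c·y²`, `a·xy + b·yx + c·z²` are set to zero.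
The generators `x, y, z` are the images of `FreeAlgebra.ι k 0, 1, 2`. -/
inductive SklyaninRel (k : Type*) [CommRing k] (a b c : k) :
    FreeAlgebra k (Fin 3) → FreeAlgebra k (Fin 3) → Prop
  | r1 : SklyaninRel k a b c
      (a • (FreeAlgebra.ι k 1 * FreeAlgebra.ι k 2) + b • (FreeAlgebra.ι k 2 * FreeAlgebra.ι k 1)
        + c • (FreeAlgebra.ι k 0 * FreeAlgebra.ι k 0)) 0
  | r2 : SklyaninRel k a b c
      (a • (FreeAlgebra.ι k 2 * FreeAlgebra.ι k 0) + b • (FreeAlgebra.ι k 0 * FreeAlgebra.ι k 2)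
        + c • (FreeAlgebra.ι k 1 * FreeAlgebra.ι k 1)) 0
  | r3 : SklyaninRel k a b c
      (a • (FreeAlgebra.ι k 0 * FreeAlgebra.ι k 1) + b • (FreeAlgebra.ι k 1 * FreeAlgebra.ι k 0)
        + c • (FreeAlgebra.ι k 2 * FreeAlgebra.ι k 2)) 0

/-- The 3-dimensional Sklyanin algebra `S(a,b,c)`: the quotient of the free algebra
`k⟨x,y,z⟩` by the two-sided ideal generated by the three Sklyanin relations. -/
def Sklyanin (k : Type*) [CommRing k] (a b c : k) : Type _ := RingQuot (SklyaninRel k a b c)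

instance (k : Type*) [CommRing k] (a b c : k) : Ring (Sklyanin k a b c) :=
  inferInstanceAs (Ring (RingQuot (SklyaninRel k a b c)))

instance (k : Type*) [CommRing k] (a b c : k) : Algebra k (Sklyanin k a b c) :=
  inferInstanceAs (Algebra k (RingQuot (SklyaninRel k a b c)))

namespace Sklyanin

variable (k : Type*) [CommRing k] (a b c : k)

/-- The generator `x` of `S(a,b,c)`. -/
def X : Sklyanin k a b c := RingQuot.mkAlgHom k (SklyaninRel k a b c) (FreeAlgebra.ι k 0)
/-- The generator `y` of `S(a,b,c)`. -/
def Y : Sklyanin k a b c := RingQuot.mkAlgHom k (SklyaninRel k a b c) (FreeAlgebra.ι k 1)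
/-- The generator `z` of `S(a,b,c)`. -/
def Z : Sklyanin k a b c := RingQuot.mkAlgHom k (SklyaninRel k a b c) (FreeAlgebra.ι k 2)

/-- The canonical central element
`g = c(c³−b³)y³ + b(c³−a³)yxz + a(b³−c³)xyz + c(a³−c³)x³` of `S(a,b,c)`. -/
def g : Sklyanin k a b c :=
  (c * (c ^ 3 - b ^ 3)) • (Y k a b c * Y k a b c * Y k a b c)
    + (b * (c ^ 3 - a ^ 3)) • (Y k a b c * X k a b c * Z k a b c)
    + (a * (b ^ 3 - c ^ 3)) • (X k a b c * Y k a b c * Z k a b c)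
    + (c * (a ^ 3 - c ^ 3)) • (X k a b c * X k a b c * X k a b c)

end Sklyanin


/-- The two-sided ideal `mS` of `S(a,b,c)` generated by a set `m` of central elements,
and the corresponding central quotient `S/(mS)`. -/
def Sklyanin.centralQuot (k : Type*) [CommRing k] (a b c : k)
    (m : Ideal ↥(Subalgebra.center k (Sklyanin k a b c))) : Type _ :=
  (TwoSidedIdeal.span
    ((fun z : ↥(Subalgebra.center k (Sklyanin k a b c)) => (z : Sklyanin k a b c)) ''
      (m : Set ↥(Subalgebra.center k (Sklyanin k a b c))))).ringCon.Quotient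

noncomputable instance (k : Type*) [CommRing k] (a b c : k)
    (m : Ideal ↥(Subalgebra.center k (Sklyanin k a b c))) :
    Ring (Sklyanin.centralQuot k a b c m) :=
  inferInstanceAs (Ring (RingCon.Quotient _))

noncomputable instance (k : Type*) [CommRing k] (a b c : k)
    (m : Ideal ↥(Subalgebra.center k (Sklyanin k a b c))) :
    Algebra k (Sklyanin.centralQuot k a b c m) :=
  inferInstanceAs (Algebra k (RingCon.Quotient _))

namespace SklAz

open Module

lemma forall_fin_three {P : Fin 3 → Prop} (h0 : P 0) (h1 : P 1) (h2 : P 2) : ∀ l, P l := by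
  intro l; fin_cases l <;> assumption

lemma fin3_add : ((0 : Fin 3) + 1 = 1) ∧ ((0 : Fin 3) + 2 = 2) ∧ ((1 : Fin 3) + 1 = 2) ∧
    ((1 : Fin 3) + 2 = 0) ∧ ((2 : Fin 3) + 1 = 0) ∧ ((2 : Fin 3) + 2 = 1) := by decide

section Basic

variable {k : Type*} [CommRing k] {a b c : k}

/-- The three generators of the Sklyanin algebra. -/
def gen (l : Fin 3) : Sklyanin k a b c :=
  RingQuot.mkAlgHom k (SklyaninRel k a b c) (FreeAlgebra.ι k l)

/-- A family of three elements satisfying the Sklyanin relations. -/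
def IsSkl (a b c : k) {B : Type*} [Ring B] [Algebra k B] (y : Fin 3 → B) : Prop :=
  ∀ l, c • (y l * y l) + a • (y (l + 1) * y (l + 2)) + b • (y (l + 2) * y (l + 1)) = 0

lemma isSkl_gen : IsSkl a b c (gen : Fin 3 → Sklyanin k a b c) := by
  obtain ⟨e1, e2, e3, e4, e5, e6⟩ := fin3_add
  have h1 := RingQuot.mkAlgHom_rel k (SklyaninRel.r1 (k := k) (a := a) (b := b) (c := c))
  have h2 := RingQuot.mkAlgHom_rel k (SklyaninRel.r2 (k := k) (a := a) (b := b) (c := c))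
  have h3 := RingQuot.mkAlgHom_rel k (SklyaninRel.r3 (k := k) (a := a) (b := b) (c := c))
  simp only [map_add, map_smul, map_mul, map_zero] at h1 h2 h3
  refine forall_fin_three ?_ ?_ ?_
  · rw [e1, e2]; refine Eq.trans ?_ h1; exact add_comm_three _ _ _
  · rw [e3, e4]; refine Eq.trans ?_ h2; exact add_comm_three _ _ _
  · rw [e5, e6]; refine Eq.trans ?_ h3; exact add_comm_three _ _ _
where
  add_comm_three {B : Type _} [AddCommGroup B] (u v w : B) : u + v + w = v + w + u := by abel

variable {B : Type*} [Ring B] [Algebra k B]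

/-- The universal property of the Sklyanin algebra. -/
def lift (y : Fin 3 → B) (hy : IsSkl a b c y) : Sklyanin k a b c →ₐ[k] B :=
  RingQuot.liftAlgHom k ⟨FreeAlgebra.lift k y, by
    obtain ⟨e1, e2, e3, e4, e5, e6⟩ := fin3_add
    have h0 := hy 0
    have h1 := hy 1
    have h2 := hy 2
    rw [e1, e2] at h0
    rw [e3, e4] at h1
    rw [e5, e6] at h2
    rintro _ _ (_ | _ | _) <;>
      simp only [map_add, map_smul, map_mul, map_zero, FreeAlgebra.lift_ι_apply]
    · rw [← h0]; abel
    · rw [← h1]; abel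
    · rw [← h2]; abel⟩

@[simp] lemma lift_gen (y : Fin 3 → B) (hy : IsSkl a b c y) (l : Fin 3) :
    lift y hy (gen l) = y l := by
  have := RingQuot.liftAlgHom_mkAlgHom_apply k (s := SklyaninRel k a b c)
    (FreeAlgebra.lift k y) (by
      intro u v huv
      exact (RingQuot.liftAlgHom k (s := SklyaninRel k a b c)).symm
        (lift y hy) |>.2 huv |> fun h => by
          simpa [lift] using h) (FreeAlgebra.ι k l)
  refine this.trans ?_
  simp

@[ext] lemma hom_ext {f h : Sklyanin k a b c →ₐ[k] B} (w : ∀ l, f (gen l) = h (gen l)) :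
    f = h := by
  refine RingQuot.ringQuot_ext' k f h ?_
  ext l
  exact w l

lemma gen_induction {P : Sklyanin k a b c → Prop} (halg : ∀ r : k, P (algebraMap k _ r))
    (hgen : ∀ l, P (gen l)) (hadd : ∀ s t, P s → P t → P (s + t))
    (hmul : ∀ s t, P s → P t → P (s * t)) (s : Sklyanin k a b c) : P s := by
  obtain ⟨f, rfl⟩ := RingQuot.mkAlgHom_surjective k (SklyaninRel k a b c) s
  induction f using FreeAlgebra.induction with
  | grade0 r => rw [AlgHom.commutes]; exact halg r
  | grade1 l => exact hgen l
  | mul s t hs ht => rw [map_mul]; exact hmul _ _ hs ht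
  | add s t hs ht => rw [map_add]; exact hadd _ _ hs ht

/-- The span of the generators. -/
def V1 (a b c : k) : Submodule k (Sklyanin k a b c) := Submodule.span k (Set.range gen)

lemma gen_mem (l : Fin 3) : gen l ∈ V1 a b c := Submodule.subset_span ⟨l, rfl⟩

/-- The homogeneous component of degree `n`. -/
abbrev V (a b c : k) (n : ℕ) : Submodule k (Sklyanin k a b c) := V1 a b c ^ n

lemma mem_V_one {s : Sklyanin k a b c} : s ∈ V a b c 1 ↔ s ∈ V1 a b c := by
  rw [show V a b c 1 = V1 a b c from pow_one _]

lemma gen_mem_V (l : Fin 3) : gen l ∈ V a b c 1 := mem_V_one.2 (gen_mem l)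

instance : SetLike.GradedMonoid (V a b c) := inferInstance

/-- The decomposition map into homogeneous components. -/
def dec : Sklyanin k a b c →ₐ[k] DirectSum ℕ fun n => V a b c n :=
  lift (fun l => DirectSum.of (fun n => V a b c n) 1 ⟨gen l, gen_mem_V l⟩) (by
    intro l
    have h := isSkl_gen (k := k) (a := a) (b := b) (c := c) l
    simp only [DirectSum.of_mul_of]
    have key : ∀ (r : k) (v : V a b c (1 + 1)),
        r • DirectSum.of (fun n => V a b c n) (1 + 1) v
          = DirectSum.of (fun n => V a b c n) (1 + 1) (r • v) :=
      fun r v => (DirectSum.lof k ℕ (fun n => V a b c n) (1 + 1)).map_smul r v |>.symm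
    erw [key, key, key]
    rw [← map_add, ← map_add]
    convert map_zero (DirectSum.of (fun n => V a b c n) (1 + 1))
    exact Subtype.ext h)

lemma dec_gen (l : Fin 3) : dec (gen l : Sklyanin k a b c)
    = DirectSum.of (fun n => V a b c n) 1 ⟨gen l, gen_mem_V l⟩ := lift_gen _ _ l

lemma dec_of_mem {v : Sklyanin k a b c} (hv : v ∈ V1 a b c) :
    dec v = DirectSum.lof k ℕ (fun n => V a b c n) 1 ⟨v, mem_V_one.2 hv⟩ := by
  unfold V1 at hv
  induction hv using Submodule.span_induction with
  | mem v hv => obtain ⟨l, rfl⟩ := hv; exact dec_gen l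
  | zero => rw [map_zero]; exact (map_zero _).symm
  | add u v hu hv h1 h2 => rw [map_add, h1, h2, ← map_add]; rfl
  | smul r v hv h1 => rw [map_smul, h1, ← map_smul]; rfl

instance : GradedAlgebra (V a b c) :=
  GradedAlgebra.ofAlgHom (V a b c) dec
    (by
      ext l
      simp only [AlgHom.coe_comp, Function.comp_apply, AlgHom.coe_id, id_eq]
      rw [dec_gen, DirectSum.coeAlgHom_of])
    (by
      rintro i ⟨x, hx⟩
      dsimp only
      induction hx using Submodule.pow_induction_on_left' with
      | algebraMap r => rw [AlgHom.commutes, DirectSum.algebraMap_apply]; rfl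
      | add u v i hu hv ihu ihv =>
        rw [map_add, ihu, ihv, ← map_add]; rfl
      | mem_mul m hm i x hx ih =>
        rw [map_mul, ih, dec_of_mem hm]
        refine (DirectSum.of_mul_of _ _).trans ?_
        exact DirectSum.of_eq_of_gradedMonoid_eq (Sigma.subtype_ext (add_comm _ _) rfl))

/-- Projection onto the component of degree `n`. -/
def proj (n : ℕ) : Sklyanin k a b c →ₗ[k] Sklyanin k a b c := GradedAlgebra.proj (V a b c) n

lemma proj_mem (n : ℕ) (s : Sklyanin k a b c) : proj n s ∈ V a b c n :=
  (DirectSum.decompose (V a b c) s n).2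

lemma proj_of_mem {n : ℕ} {s : Sklyanin k a b c} (h : s ∈ V a b c n) : proj n s = s :=
  DirectSum.decompose_of_mem_same _ h

lemma proj_of_mem_ne {n m : ℕ} {s : Sklyanin k a b c} (h : s ∈ V a b c n) (hnm : n ≠ m) :
    proj m s = 0 :=
  DirectSum.decompose_of_mem_ne _ h hnm

lemma eq_zero_of_proj {s : Sklyanin k a b c} (h : ∀ n, proj n s = 0) : s = 0 := by
  refine (DirectSum.decompose (V a b c)).injective ?_
  rw [DirectSum.decompose_zero]
  ext n
  exact h n

lemma exists_proj_bound (s : Sklyanin k a b c) : ∃ N, ∀ n, N ≤ n → proj n s = 0 := by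
  classical
  refine ⟨(DirectSum.decompose (V a b c) s).support.sup id + 1, fun n hn => ?_⟩
  by_contra h
  have hm : n ∈ (DirectSum.decompose (V a b c) s).support := by
    rw [DFinsupp.mem_support_iff]
    intro h0
    exact h (congrArg Subtype.val h0)
  have := Finset.le_sup (f := id) hm
  simp only [id] at this
  omega

lemma proj_mul_gen (s : Sklyanin k a b c) (l : Fin 3) (n : ℕ) :
    proj (n + 1) (s * gen l) = proj n s * gen l :=
  DirectSum.coe_decompose_mul_add_of_right_mem (V a b c) (gen_mem_V l)

lemma proj_gen_mul (s : Sklyanin k a b c) (l : Fin 3) (n : ℕ) :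
    proj (n + 1) (gen l * s) = gen l * proj n s := by
  rw [add_comm]
  exact DirectSum.coe_decompose_mul_add_of_left_mem (V a b c) (gen_mem_V l)

lemma proj_zero_mul_gen (s : Sklyanin k a b c) (l : Fin 3) :
    proj 0 (s * gen l) = 0 :=
  DirectSum.coe_decompose_mul_of_right_mem_of_not_le (V a b c) (gen_mem_V l) (by norm_num)

lemma proj_zero_gen_mul (s : Sklyanin k a b c) (l : Fin 3) :
    proj 0 (gen l * s) = 0 :=
  DirectSum.coe_decompose_mul_of_left_mem_of_not_le (V a b c) (gen_mem_V l) (by norm_num)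

end Basic

end SklAz

namespace SklAz

open Module Matrix

section Geometry

variable {k : Type*} [Field k]

/-- The matrix of the three relations specialised at `p` in the second tensor factor. -/
def N (a b c : k) (p : Fin 3 → k) : Matrix (Fin 3) (Fin 3) k :=
  !![c * p 0, a * p 2, b * p 1; b * p 2, c * p 1, a * p 0; a * p 1, b * p 0, c * p 2]

/-- Nondegeneracy of the parameters of a Sklyanin algebra. -/
structure Nondeg (a b c : k) : Prop where
  ha : a ≠ 0
  hb : b ≠ 0
  hc : c ≠ 0
  hdeg : (3 * a * b * c) ^ 3 ≠ (a ^ 3 + b ^ 3 + c ^ 3) ^ 3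

lemma Nondeg.symm {a b c : k} (h : Nondeg a b c) : Nondeg b a c :=
  ⟨h.hb, h.ha, h.hc, fun e => h.hdeg (by linear_combination e)⟩

lemma N_det (a b c : k) (p : Fin 3 → k) : (N a b c p).det =
    (a ^ 3 + b ^ 3 + c ^ 3) * (p 0 * p 1 * p 2)
      - a * b * c * (p 0 ^ 3 + p 1 ^ 3 + p 2 ^ 3) := by
  simp [N, Matrix.det_fin_three]
  ring

lemma N_vecMul (a b c : k) (p q : Fin 3 → k) : q ᵥ* N a b c p = N a b c q *ᵥ p := by
  ext i
  fin_cases i <;>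
  simp [N, Matrix.vecMul, Matrix.mulVec, dotProduct, Fin.sum_univ_three] <;> ring

lemma N_swap (a b c : k) (p q : Fin 3 → k) : N a b c p *ᵥ q = N b a c q *ᵥ p := by
  ext i
  fin_cases i <;>
  simp [N, Matrix.mulVec, dotProduct, Fin.sum_univ_three] <;> ring

variable {a b c : k}

lemma Nondeg.not_all_cubes (h : Nondeg a b c) : ¬ (a ^ 3 = b ^ 3 ∧ a ^ 3 = c ^ 3) := by
  rintro ⟨h1, h2⟩
  apply h.hdeg
  have : (3 * a * b * c) ^ 3 = 27 * a ^ 3 * b ^ 3 * c ^ 3 := by ring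
  rw [this, ← h1, ← h2]; ring

lemma N_rank_one (h : Nondeg a b c) {p r m : Fin 3 → k}
    (hN : ∀ i j, N a b c p i j = r i * m j) : p = 0 := by
  obtain ⟨ha, hb, hc, -⟩ := id h
  have e00 := hN 0 0
  have e01 := hN 0 1
  have e02 := hN 0 2
  have e10 := hN 1 0
  have e11 := hN 1 1
  have e12 := hN 1 2
  have e20 := hN 2 0
  have e21 := hN 2 1
  have e22 := hN 2 2
  simp [N] at e00 e01 e02 e10 e11 e12 e20 e21 e22
  set x := p 0
  set y := p 1
  set z := p 2
  have A : c * x * (c * y) = a * z * (b * z) := by rw [e00, e11, e01, e10]; ring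
  have B : c * y * (c * z) = a * x * (b * x) := by rw [e11, e22, e12, e21]; ring
  have C : c * z * (c * x) = a * y * (b * y) := by rw [e00, e22, e20, e02]; ring
  have D : c * x * (a * x) = b * y * (b * z) := by rw [e00, e12, e02, e10]; ring
  have E : a * z * (a * x) = b * y * (c * y) := by rw [e01, e12, e02, e11]; ring
  have key : x = 0 ∧ y = 0 ∧ z = 0 := by
    by_cases hx : x = 0
    · simp [hx, ha, hb] at A C
      exact ⟨hx, C, A⟩
    by_cases hy : y = 0
    · simp [hy, ha, hb] at A B
      exact ⟨B, hy, A⟩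
    by_cases hz : z = 0
    · simp [hz, ha, hb] at B C
      exact ⟨B, C, hz⟩
    exfalso
    have hT : x * y * z ≠ 0 := mul_ne_zero (mul_ne_zero hx hy) hz
    have hxy : x ^ 3 = y ^ 3 := by
      have : a * b * (x ^ 3 - y ^ 3) = 0 := by linear_combination (-x) * B + y * C
      simpa [ha, hb, sub_eq_zero] using this
    refine h.not_all_cubes ⟨?_, ?_⟩
    · have : (x * y * z) * (a ^ 3 - b ^ 3) = 0 := by
        linear_combination (y * a) * E - a * b * c * hxy + (x * b) * D
      simpa [hT, sub_eq_zero] using this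
    · have : (x * y * z) * (a ^ 3 - c ^ 3) = 0 := by
        linear_combination (y * a) * E - a * b * c * hxy - (x * c) * B
      simpa [hT, sub_eq_zero] using this
  ext i
  fin_cases i
  exacts [key.1, key.2.1, key.2.2]

lemma N_ker (h : Nondeg a b c) {p q q' : Fin 3 → k} (hp : p ≠ 0) (hq : q ≠ 0)
    (h1 : N a b c p *ᵥ q = 0) (h2 : N a b c p *ᵥ q' = 0) : ∃ t : k, q' = t • q := by
  by_contra hcon
  apply hp
  obtain ⟨i, hi⟩ : ∃ i, (q ⨯₃ q') i ≠ 0 := by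
    by_contra hall
    push Not at hall
    have c0 := hall 0
    have c1 := hall 1
    have c2 := hall 2
    simp [cross_apply] at c0 c1 c2
    obtain ⟨j, hj⟩ := Function.ne_iff.1 hq
    apply hcon
    refine ⟨q' j / q j, ?_⟩
    revert hj
    revert j
    refine forall_fin_three ?_ ?_ ?_ <;> intro hj <;> ext l <;> fin_cases l <;>
      simp at hj ⊢ <;> field_simp <;> (first
        | linear_combination c0 | linear_combination c1 | linear_combination c2
        | linear_combination -c0 | linear_combination -c1 | linear_combination -c2)
  refine N_rank_one h (p := p) (r := fun l => N a b c p l i / (q ⨯₃ q') i) (m := q ⨯₃ q') ?_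
  intro l j
  have e1 := congrFun h1 l
  have e2 := congrFun h2 l
  rw [div_mul_eq_mul_div, eq_div_iff hi]
  clear hcon
  simp only [Matrix.mulVec, dotProduct, Fin.sum_univ_three, Pi.zero_apply] at e1 e2
  generalize N a b c p l = r at *
  have key : ∀ i j, r j * (q ⨯₃ q') i = r i * (q ⨯₃ q') j := by
    refine forall_fin_three ?_ ?_ ?_ <;> refine forall_fin_three ?_ ?_ ?_ <;>
    simp [cross_apply] <;> (first
    | linear_combination (q 0) * e2 - q' 0 * e1
    | linear_combination -(q 0) * e2 + q' 0 * e1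
    | linear_combination (q 1) * e2 - q' 1 * e1
    | linear_combination -(q 1) * e2 + q' 1 * e1
    | linear_combination (q 2) * e2 - q' 2 * e1
    | linear_combination -(q 2) * e2 + q' 2 * e1)
  exact key i j

lemma exists_vecMul_N (h : Nondeg a b c) {p p' w : Fin 3 → k} (hp : p ≠ 0) (hp' : p' ≠ 0)
    (h1 : N a b c p *ᵥ p' = 0) (hw : w ⬝ᵥ p' = 0) : ∃ q, N a b c q *ᵥ p = w := by
  suffices hs : ∃ q, q ᵥ* N a b c p = w by
    obtain ⟨q, hq⟩ := hs; exact ⟨q, by rw [← N_vecMul, hq]⟩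
  have hker : LinearMap.ker (N a b c p).mulVecLin = Submodule.span k {p'} := by
    ext q
    rw [LinearMap.mem_ker, Matrix.mulVecLin_apply, Submodule.mem_span_singleton]
    constructor
    · intro hq
      obtain ⟨t, ht⟩ := N_ker h hp hp' h1 hq
      exact ⟨t, ht.symm⟩
    · rintro ⟨t, rfl⟩
      rw [Matrix.mulVec_smul, h1, smul_zero]
  have hr : (N a b c p).rank = 2 := by
    have := LinearMap.finrank_range_add_finrank_ker (N a b c p).mulVecLin
    rw [hker, finrank_span_singleton hp', finrank_fin_fun] at this
    unfold Matrix.rank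
    omega
  let φ : (Fin 3 → k) →ₗ[k] k := dotProductBilin k k p'
  have hφ : ∀ v, φ v = p' ⬝ᵥ v := fun v => rfl
  have hφ2 : finrank k (LinearMap.ker φ) ≤ 2 := by
    have := LinearMap.finrank_range_add_finrank_ker φ
    have h3 : 0 < finrank k (LinearMap.range φ) := by
      rw [Module.finrank_pos_iff_exists_ne_zero]
      obtain ⟨j, hj⟩ := Function.ne_iff.1 hp'
      refine ⟨⟨φ (Pi.single j 1), ⟨_, rfl⟩⟩, ?_⟩
      intro h0
      apply hj
      have := congrArg Subtype.val h0
      simpa [hφ] using this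
    rw [finrank_fin_fun] at this
    omega
  have hle : LinearMap.range (N a b c p)ᵀ.mulVecLin ≤ LinearMap.ker φ := by
    rintro _ ⟨q, rfl⟩
    rw [LinearMap.mem_ker, hφ, Matrix.mulVecLin_apply, Matrix.mulVec_transpose,
      dotProduct_comm, ← Matrix.dotProduct_mulVec, h1, dotProduct_zero]
  have heq := Submodule.eq_of_le_of_finrank_le hle (by
    refine hφ2.trans (le_of_eq ?_)
    rw [← hr, ← Matrix.rank_transpose]; rfl)
  have hwm : w ∈ LinearMap.ker φ := by rw [LinearMap.mem_ker, hφ, dotProduct_comm, hw]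
  rw [← heq] at hwm
  obtain ⟨q, hq⟩ := hwm
  exact ⟨q, by rw [← hq, Matrix.mulVecLin_apply, Matrix.mulVec_transpose]⟩

lemma exists_cubic_root [IsAlgClosed k] {c3 : k} (h : c3 ≠ 0) (c2 c1 c0 : k) :
    ∃ t : k, c3 * t ^ 3 + c2 * t ^ 2 + c1 * t + c0 = 0 := by
  obtain ⟨t, ht⟩ := IsAlgClosed.exists_root (Cubic.toPoly ⟨c3, c2, c1, c0⟩) (by
    rw [Cubic.degree_of_a_ne_zero h]; norm_num)
  refine ⟨t, ?_⟩
  simpa [Cubic.toPoly, Polynomial.IsRoot] using ht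

lemma exists_zero_on_line [IsAlgClosed k] (a b c : k) {u : Fin 3 → k} (hu : u ≠ 0) :
    ∃ p : Fin 3 → k, p ≠ 0 ∧ u ⬝ᵥ p = 0 ∧ (N a b c p).det = 0 := by
  have gen : ∀ e f : Fin 3 → k, u ⬝ᵥ e = 0 → u ⬝ᵥ f = 0 → f ≠ 0 →
      (∀ t : k, e + t • f ≠ 0) → ∃ p : Fin 3 → k, p ≠ 0 ∧ u ⬝ᵥ p = 0 ∧ (N a b c p).det = 0 := by
    intro e f he hf hf0 hef
    by_cases hfd : (N a b c f).det = 0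
    · exact ⟨f, hf0, hf, hfd⟩
    set A := a ^ 3 + b ^ 3 + c ^ 3
    set B := a * b * c
    obtain ⟨t, ht⟩ := exists_cubic_root hfd
      (A * (e 0 * f 1 * f 2 + f 0 * e 1 * f 2 + f 0 * f 1 * e 2)
        - B * 3 * (e 0 * f 0 ^ 2 + e 1 * f 1 ^ 2 + e 2 * f 2 ^ 2))
      (A * (e 0 * e 1 * f 2 + f 0 * e 1 * e 2 + e 0 * f 1 * e 2)
        - B * 3 * (e 0 ^ 2 * f 0 + e 1 ^ 2 * f 1 + e 2 ^ 2 * f 2)) ((N a b c e).det)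
    refine ⟨e + t • f, hef t, by rw [dotProduct_add, dotProduct_smul, he, hf]; simp, ?_⟩
    rw [← ht, N_det, N_det, N_det]
    simp only [Pi.add_apply, Pi.smul_apply, smul_eq_mul]
    ring
  obtain ⟨j, hj⟩ := Function.ne_iff.1 hu
  revert hj
  revert j
  refine forall_fin_three ?_ ?_ ?_ <;> intro hj
  · refine gen ![u 1, -u 0, 0] ![u 2, 0, -u 0] ?_ ?_ ?_ ?_
    · simp [dotProduct, Fin.sum_univ_three]; ring
    · simp [dotProduct, Fin.sum_univ_three]; ring
    · intro h0; have := congrFun h0 2; simp at this; exact hj this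
    · intro t h0; have := congrFun h0 1; simp at this; exact hj this
  · refine gen ![-u 1, u 0, 0] ![0, u 2, -u 1] ?_ ?_ ?_ ?_
    · simp [dotProduct, Fin.sum_univ_three]; ring
    · simp [dotProduct, Fin.sum_univ_three]; ring
    · intro h0; have := congrFun h0 2; simp at this; exact hj this
    · intro t h0; have := congrFun h0 0; simp at this; exact hj this
  · refine gen ![-u 2, 0, u 0] ![0, -u 2, u 1] ?_ ?_ ?_ ?_
    · simp [dotProduct, Fin.sum_univ_three]; ring
    · simp [dotProduct, Fin.sum_univ_three]; ring
    · intro h0; have := congrFun h0 1; simp at this; exact hj this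
    · intro t h0; have := congrFun h0 0; simp at this; exact hj this

/-- A complementary pair for the annihilator of a point. -/
lemma exists_annihilator_basis {u p : Fin 3 → k} (hu : u ≠ 0) (hp : p ≠ 0) (hup : u ⬝ᵥ p = 0) :
    ∃ v : Fin 3 → k, v ⬝ᵥ p = 0 ∧ ∀ w, w ⬝ᵥ p = 0 → ∃ r s : k, w = r • u + s • v := by
  obtain ⟨j, hj⟩ : ∃ j, (p ⨯₃ ![1, 0, 0]) j ≠ 0 ∨ (p ⨯₃ ![0, 1, 0]) j ≠ 0 ∨
      (p ⨯₃ ![0, 0, 1]) j ≠ 0 := by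
    obtain ⟨j, hj⟩ := Function.ne_iff.1 hp
    revert hj
    revert j
    refine forall_fin_three ?_ ?_ ?_ <;> intro hj
    · exact ⟨1, by simp [cross_apply] at hj ⊢; tauto⟩
    · exact ⟨2, by simp [cross_apply] at hj ⊢; tauto⟩
    · exact ⟨0, by simp [cross_apply] at hj ⊢; tauto⟩
  let φ : (Fin 3 → k) →ₗ[k] k := dotProductBilin k k p
  have hφ : ∀ v, φ v = p ⬝ᵥ v := fun v => rfl
  have hφ2 : finrank k (LinearMap.ker φ) = 2 := by
    have := LinearMap.finrank_range_add_finrank_ker φ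
    have hsurj : LinearMap.range φ = ⊤ := by
      rw [LinearMap.range_eq_top]
      obtain ⟨j, hj⟩ := Function.ne_iff.1 hp
      intro t
      refine ⟨Pi.single j (t / p j), ?_⟩
      rw [hφ, dotProduct_single, mul_div_cancel₀ _ hj]
    rw [hsurj, finrank_top, finrank_self, finrank_fin_fun] at this
    omega
  let u' : LinearMap.ker φ := ⟨u, by rw [LinearMap.mem_ker, hφ, dotProduct_comm, hup]⟩
  have hu' : u' ≠ 0 := fun h0 => hu (congrArg Subtype.val h0)
  have hq : finrank k (LinearMap.ker φ ⧸ Submodule.span k {u'}) = 1 := by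
    have := Submodule.finrank_quotient_add_finrank (Submodule.span k {u'})
    rw [finrank_span_singleton hu', hφ2] at this
    omega
  obtain ⟨v', -, hv'⟩ := finrank_eq_one_iff'.1 hq
  obtain ⟨v, rfl⟩ := Submodule.Quotient.mk_surjective _ v'
  refine ⟨v, by rw [dotProduct_comm]; exact v.2, fun w hw => ?_⟩
  obtain ⟨s, hs⟩ := hv' (Submodule.Quotient.mk ⟨w, by
    rw [LinearMap.mem_ker, hφ, dotProduct_comm, hw]⟩)
  rw [← Submodule.Quotient.mk_smul, Eq.comm, Submodule.Quotient.eq,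
    Submodule.mem_span_singleton] at hs
  obtain ⟨r, hr⟩ := hs
  refine ⟨r, s, ?_⟩
  have := congrArg Subtype.val hr
  simp [u'] at this
  rw [this]; abel

end Geometry

end SklAz

namespace SklAz

open Module Matrix

section Growth

variable {k : Type*} [Field k] {a b c : k}

/-- The linear form in the generators with given coefficients. -/
def lin (a b c : k) : (Fin 3 → k) →ₗ[k] Sklyanin k a b c := Fintype.linearCombination k gen

lemma lin_apply (u : Fin 3 → k) : lin a b c u = ∑ i, u i • gen i :=
  Fintype.linearCombination_apply ..

lemma range_lin : LinearMap.range (lin a b c) = V1 a b c := Fintype.range_linearCombination ..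

lemma lin_mem (u : Fin 3 → k) : lin a b c u ∈ V1 a b c := by
  rw [← range_lin]; exact ⟨u, rfl⟩

lemma lin_single (i : Fin 3) : lin a b c (Pi.single i 1) = gen i := by
  rw [lin_apply]; simp [Pi.single_apply]

/-- The space of linear forms vanishing at `p`. -/
def U (a b c : k) (p : Fin 3 → k) : Submodule k (Sklyanin k a b c) :=
  (LinearMap.ker (dotProductBilin k k p)).map (lin a b c)

lemma mem_U {p : Fin 3 → k} {s : Sklyanin k a b c} :
    s ∈ U a b c p ↔ ∃ w, w ⬝ᵥ p = 0 ∧ lin a b c w = s := by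
  simp only [U, Submodule.mem_map, LinearMap.mem_ker]
  constructor
  · rintro ⟨w, h, rfl⟩; exact ⟨w, by rw [dotProduct_comm]; exact h, rfl⟩
  · rintro ⟨w, h, rfl⟩; exact ⟨w, by rw [dotProduct_comm] at h; exact h, rfl⟩

lemma U_le_V1 (p : Fin 3 → k) : U a b c p ≤ V1 a b c := by
  intro s hs
  obtain ⟨w, -, rfl⟩ := mem_U.1 hs
  exact lin_mem w

/-- The relations of the algebra, in matrix form. -/
lemma rel_N (q : Fin 3 → k) :
    ∑ i, gen i * lin a b c (N a b c q i) = 0 := by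
  have h0 := isSkl_gen (a := a) (b := b) (c := c) 0
  have h1 := isSkl_gen (a := a) (b := b) (c := c) 1
  have h2 := isSkl_gen (a := a) (b := b) (c := c) 2
  obtain ⟨e1, e2, e3, e4, e5, e6⟩ := fin3_add
  rw [e1, e2] at h0
  rw [e3, e4] at h1
  rw [e5, e6] at h2
  have : ∑ i, gen i * lin a b c (N a b c q i) =
      q 0 • (c • (gen 0 * gen 0 : Sklyanin k a b c) + a • (gen 1 * gen 2) + b • (gen 2 * gen 1))
      + q 1 • (c • (gen 1 * gen 1) + a • (gen 2 * gen 0) + b • (gen 0 * gen 2))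
      + q 2 • (c • (gen 2 * gen 2) + a • (gen 0 * gen 1) + b • (gen 1 * gen 0)) := by
    simp only [lin_apply, Fin.sum_univ_three, mul_add, mul_smul_comm, smul_add, smul_smul]
    simp [N]
    simp only [mul_comm a, mul_comm b, mul_comm c]
    abel
  rw [this, h0, h1, h2]
  simp

lemma lin_mul_lin {p p' w y : Fin 3 → k} (h : Nondeg a b c) (hp : p ≠ 0) (hp' : p' ≠ 0)
    (h1 : N a b c p *ᵥ p' = 0) (hw : w ⬝ᵥ p' = 0) :
    lin a b c w * lin a b c y ∈ V1 a b c * U a b c p := by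
  obtain ⟨q, hq⟩ := exists_vecMul_N h hp hp' h1 hw
  have key : lin a b c w * lin a b c y =
      ∑ i, gen i * lin a b c (w i • y - (y ⬝ᵥ p) • N a b c q i) := by
    have := rel_N (a := a) (b := b) (c := c) q
    simp only [map_sub, map_smul, mul_sub, Finset.sum_sub_distrib, mul_smul_comm]
    rw [← Finset.smul_sum, this, smul_zero, sub_zero, lin_apply w, Finset.sum_mul]
    simp only [smul_mul_assoc]
  rw [key]
  refine Submodule.sum_mem _ fun i _ => Submodule.mul_mem_mul (gen_mem i) (mem_U.2 ⟨_, ?_, rfl⟩)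
  rw [sub_dotProduct, smul_dotProduct, smul_dotProduct, ← hq]
  simp [Matrix.mulVec, mul_comm]

lemma V_succ (n : ℕ) : V a b c (n + 1) = V a b c n * V1 a b c := pow_succ _ _

lemma V_zero : V a b c 0 = Submodule.span k {1} := by
  show V1 a b c ^ 0 = _
  rw [pow_zero, Submodule.one_eq_span]

lemma V1_le_U_sup {p y : Fin 3 → k} (hy : y ⬝ᵥ p ≠ 0) :
    V1 a b c ≤ U a b c p ⊔ Submodule.span k {lin a b c y} := by
  rw [← range_lin]
  rintro _ ⟨w, rfl⟩
  rw [Submodule.mem_sup]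
  refine ⟨lin a b c (w - (w ⬝ᵥ p / y ⬝ᵥ p) • y), mem_U.2 ⟨_, ?_, rfl⟩,
    (w ⬝ᵥ p / y ⬝ᵥ p) • lin a b c y,
    Submodule.smul_mem _ _ (Submodule.mem_span_singleton_self _), ?_⟩
  · rw [sub_dotProduct, smul_dotProduct, smul_eq_mul, div_mul_cancel₀ _ hy, sub_self]
  · rw [map_sub, map_smul, sub_add_cancel]

lemma exists_dot_ne {p : Fin 3 → k} (hp : p ≠ 0) : ∃ y : Fin 3 → k, y ⬝ᵥ p ≠ 0 := by
  obtain ⟨j, hj⟩ := Function.ne_iff.1 hp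
  exact ⟨Pi.single j 1, by simpa using hj⟩

lemma exists_next {p : Fin 3 → k} (hp : p ≠ 0) (hE : (N a b c p).det = 0) :
    ∃ p', p' ≠ 0 ∧ N a b c p *ᵥ p' = 0 ∧ (N a b c p').det = 0 := by
  obtain ⟨p', h1, h2⟩ := Matrix.exists_mulVec_eq_zero_iff.2 hE
  refine ⟨p', h1, h2, ?_⟩
  rw [N_det]
  have h3 : ∃ v ≠ 0, N b a c p' *ᵥ v = 0 := by
    exact ⟨p, hp, by rw [← N_swap, h2]⟩
  have := Matrix.exists_mulVec_eq_zero_iff.1 h3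
  rw [N_det] at this
  linear_combination this

lemma point_step (h : Nondeg a b c) {p p' y : Fin 3 → k} (hp : p ≠ 0) (hp' : p' ≠ 0)
    (h1 : N a b c p *ᵥ p' = 0) :
    U a b c p' * Submodule.span k {lin a b c y} ≤ V1 a b c * U a b c p := by
  rw [Submodule.mul_le]
  intro s hs t ht
  obtain ⟨w, hw, rfl⟩ := mem_U.1 hs
  obtain ⟨r, rfl⟩ := Submodule.mem_span_singleton.1 ht
  rw [mul_smul_comm]
  exact Submodule.smul_mem _ _ (lin_mul_lin h hp hp' h1 hw)


/-- The part of degree `n` of the left ideal generated by a space of linear forms. -/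
def leftPart (W : Submodule k (Sklyanin k a b c)) : ℕ → Submodule k (Sklyanin k a b c)
  | 0 => ⊥
  | n + 1 => V a b c n * W

lemma point_module (h : Nondeg a b c) (n : ℕ) : ∀ {p : Fin 3 → k}, p ≠ 0 →
    (N a b c p).det = 0 →
    ∃ s, V a b c n ≤ leftPart (U a b c p) n ⊔ Submodule.span k {s} := by
  induction n with
  | zero => intro p hp hE; exact ⟨1, by rw [V_zero]; exact le_sup_right⟩
  | succ n ih =>
    intro p hp hE
    obtain ⟨p', hp', h1, hE'⟩ := exists_next hp hE
    obtain ⟨s, hs⟩ := ih hp' hE'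
    obtain ⟨y, hy⟩ := exists_dot_ne hp
    refine ⟨s * lin a b c y, ?_⟩
    rw [V_succ]
    calc V a b c n * V1 a b c
        ≤ V a b c n * (U a b c p ⊔ Submodule.span k {lin a b c y}) :=
          mul_le_mul' le_rfl (V1_le_U_sup hy)
      _ = V a b c n * U a b c p ⊔ V a b c n * Submodule.span k {lin a b c y} :=
          Submodule.mul_sup _ _ _
      _ ≤ V a b c n * U a b c p ⊔ (leftPart (U a b c p') n ⊔ Submodule.span k {s})
            * Submodule.span k {lin a b c y} :=
          sup_le_sup le_rfl (mul_le_mul' hs le_rfl)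
      _ = V a b c n * U a b c p ⊔ (leftPart (U a b c p') n * Submodule.span k {lin a b c y}
            ⊔ Submodule.span k {s * lin a b c y}) := by
          rw [Submodule.sup_mul, Submodule.span_mul_span, Set.singleton_mul_singleton]
      _ ≤ _ := by
          rw [← sup_assoc]
          refine sup_le_sup (sup_le le_rfl ?_) le_rfl
          cases n with
          | zero => simp [leftPart]
          | succ n =>
            simp only [leftPart]
            rw [mul_assoc, V_succ n, mul_assoc]
            exact mul_le_mul' le_rfl (point_step h hp hp' h1)

lemma exists_linear_rel (h : Nondeg a b c) [IsAlgClosed k] {u : Fin 3 → k} (hu : u ≠ 0) :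
    ∃ p u' v w : Fin 3 → k, p ≠ 0 ∧ (N a b c p).det = 0 ∧ u' ≠ 0 ∧
      (∀ w, w ⬝ᵥ p = 0 → ∃ r s : k, w = r • u + s • v) ∧
      lin a b c u' * lin a b c v = - (lin a b c w * lin a b c u) := by
  obtain ⟨p, hp, hup, hE⟩ := exists_zero_on_line a b c hu
  obtain ⟨v, hv, hbas⟩ := exists_annihilator_basis hu hp hup
  obtain ⟨q, hq0, hq⟩ := Matrix.exists_vecMul_eq_zero_iff.2 hE
  rw [N_vecMul] at hq
  have : ∀ i, ∃ r s : k, N a b c q i = r • u + s • v := fun i => hbas _ (congrFun hq i)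
  choose r s hrs using this
  refine ⟨p, s, v, r, hp, hE, ?_, hbas, ?_⟩
  · rintro rfl
    refine hq0 (N_rank_one h (r := r) (m := u) fun i j => ?_)
    rw [hrs i]; simp
  · have := rel_N (a := a) (b := b) (c := c) q
    simp only [hrs, map_add, map_smul, mul_add, Finset.sum_add_distrib, mul_smul_comm] at this
    rw [lin_apply r, lin_apply s, Finset.sum_mul, Finset.sum_mul]
    simp only [smul_mul_assoc]
    exact eq_neg_of_add_eq_zero_right this

lemma line_module (h : Nondeg a b c) [IsAlgClosed k] (n : ℕ) : ∀ {u : Fin 3 → k}, u ≠ 0 →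
    ∃ F : Finset (Sklyanin k a b c), F.card ≤ n + 1 ∧
      V a b c n ≤ leftPart (Submodule.span k {lin a b c u}) n ⊔ Submodule.span k F := by
  classical
  induction n with
  | zero => intro u hu; exact ⟨{1}, by simp, by rw [V_zero]; simp⟩
  | succ n ih =>
    intro u hu
    obtain ⟨p, u', v, w, hp, hE, hu', hbas, hrel⟩ := exists_linear_rel h hu
    obtain ⟨F, hF, hVF⟩ := ih hu'
    obtain ⟨t, ht⟩ := point_module h (n + 1) hp hE
    refine ⟨insert t (F.image (· * lin a b c v)), ?_, ?_⟩
    · exact (Finset.card_insert_le _ _).trans (by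
        have := Finset.card_image_le (s := F) (f := (· * lin a b c v)); omega)
    have hU : U a b c p ≤ Submodule.span k {lin a b c u} ⊔ Submodule.span k {lin a b c v} := by
      intro x hx
      obtain ⟨y, hy, rfl⟩ := mem_U.1 hx
      obtain ⟨r, s, rfl⟩ := hbas y hy
      rw [map_add, map_smul, map_smul]
      exact Submodule.add_mem_sup (Submodule.smul_mem _ _ (Submodule.mem_span_singleton_self _))
        (Submodule.smul_mem _ _ (Submodule.mem_span_singleton_self _))
    have hstep : leftPart (Submodule.span k {lin a b c u'}) n * Submodule.span k {lin a b c v}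
        ≤ V a b c n * Submodule.span k {lin a b c u} := by
      cases n with
      | zero => simp [leftPart]
      | succ n =>
        simp only [leftPart]
        rw [mul_assoc, V_succ n, mul_assoc]
        refine mul_le_mul' le_rfl ?_
        rw [Submodule.span_mul_span, Set.singleton_mul_singleton, hrel,
          Submodule.span_singleton_le_iff_mem, ← neg_mul]
        exact Submodule.mul_mem_mul (Submodule.neg_mem _ (lin_mem w))
          (Submodule.mem_span_singleton_self _)
    have hV : V a b c n * Submodule.span k {lin a b c v} ≤
        V a b c n * Submodule.span k {lin a b c u} ⊔
          Submodule.span k (F.image (· * lin a b c v)) := by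
      refine (mul_le_mul' hVF le_rfl).trans ?_
      rw [Submodule.sup_mul]
      refine sup_le_sup hstep ?_
      rw [Submodule.span_mul_span, Set.mul_singleton, Finset.coe_image]
    refine ht.trans ?_
    simp only [leftPart]
    refine sup_le ?_ ?_
    · refine (mul_le_mul' le_rfl hU).trans ?_
      rw [Submodule.mul_sup]
      refine sup_le le_sup_left (hV.trans (sup_le_sup le_rfl ?_))
      exact Submodule.span_mono (by simp)
    · refine le_sup_of_le_right (Submodule.span_mono (by simp))

instance (n : ℕ) : FiniteDimensional k (V a b c n) := by
  rw [FiniteDimensional, Module.Finite.iff_fg]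
  exact Submodule.FG.pow (Submodule.fg_span (Set.finite_range _)) n

lemma finrank_mul_singleton_le (n : ℕ) (u : Sklyanin k a b c) :
    finrank k (V a b c n * Submodule.span k {u} : Submodule k (Sklyanin k a b c))
      ≤ finrank k (V a b c n) := by
  have : V a b c n * Submodule.span k {u} = (V a b c n).map (LinearMap.mulRight k u) := by
    rw [Submodule.mul_eq_map₂, Submodule.map₂_span_singleton_eq_map_flip]
    rfl
  rw [this]
  exact Submodule.finrank_map_le _ _

lemma finrank_V_succ_le (h : Nondeg a b c) [IsAlgClosed k] (n : ℕ) {u : Fin 3 → k}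
    (hu : u ≠ 0) : finrank k (V a b c (n + 1)) ≤
      finrank k (V a b c n * Submodule.span k {lin a b c u} : Submodule k (Sklyanin k a b c))
        + (n + 2) := by
  obtain ⟨F, hF, hVF⟩ := line_module h (n + 1) hu
  have hfg : (V a b c n * Submodule.span k {lin a b c u}).FG :=
    Submodule.FG.mul (Submodule.FG.pow (Submodule.fg_span (Set.finite_range _)) n)
      (Submodule.fg_span (Set.finite_singleton _))
  have : FiniteDimensional k
    (V a b c n * Submodule.span k {lin a b c u} : Submodule k (Sklyanin k a b c)) :=
    Module.Finite.iff_fg.2 hfg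
  simp only [leftPart] at hVF
  have : FiniteDimensional k (Submodule.span k (F : Set (Sklyanin k a b c))) :=
    FiniteDimensional.span_finset k F
  refine (Submodule.finrank_mono hVF).trans ?_
  refine (Submodule.finrank_add_le_finrank_add_finrank _ _).trans ?_
  refine Nat.add_le_add le_rfl ((finrank_span_finset_le_card F).trans hF)

end Growth

end SklAz

namespace SklAz

open Module Matrix

section Koszul

variable {k : Type*} [CommRing k] {M : Type*} [AddCommGroup M] [Module k M]

/-- The first map of the one-sided Koszul complex of a triple of endomorphisms. -/
def kos0 (γ : Fin 3 → End k M) : M →ₗ[k] (Fin 3 → M) := LinearMap.pi γ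

/-- The middle map of the one-sided Koszul complex of a triple of endomorphisms. -/
def kos1 (a b c : k) (γ : Fin 3 → End k M) : (Fin 3 → M) →ₗ[k] (Fin 3 → M) :=
  LinearMap.pi fun l => c • γ l ∘ₗ LinearMap.proj l + a • γ (l + 1) ∘ₗ LinearMap.proj (l + 2)
    + b • γ (l + 2) ∘ₗ LinearMap.proj (l + 1)

/-- The last map of the one-sided Koszul complex of a triple of endomorphisms. -/
def kos2 (γ : Fin 3 → End k M) : (Fin 3 → M) →ₗ[k] M := ∑ l, γ l ∘ₗ LinearMap.proj l

variable (a b c : k) (γ : Fin 3 → End k M)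

lemma kos0_apply (m : M) (l : Fin 3) : kos0 γ m l = γ l m := rfl

lemma kos1_apply (g : Fin 3 → M) (l : Fin 3) : kos1 a b c γ g l =
    c • γ l (g l) + a • γ (l + 1) (g (l + 2)) + b • γ (l + 2) (g (l + 1)) := rfl

lemma kos2_apply (g : Fin 3 → M) : kos2 γ g = ∑ l, γ l (g l) := by simp [kos2]

/-- Exactness of the one-sided Koszul complex away from its last term. -/
structure KosExact : Prop where
  inj : ∀ m, kos0 γ m = 0 → m = 0
  ex1 : ∀ g, kos1 a b c γ g = 0 → ∃ m, kos0 γ m = g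
  ex2 : ∀ g, kos2 γ g = 0 → ∃ h, kos1 a b c γ h = g

end Koszul

section Exact

variable {k : Type*} [Field k] {a b c : k}

/-- Right multiplication by the generators. -/
def rgen (a b c : k) (i : Fin 3) : End k (Sklyanin k a b c) := LinearMap.mulRight k (gen i)

/-- Left multiplication by the generators. -/
def lgen (a b c : k) (i : Fin 3) : End k (Sklyanin k a b c) := LinearMap.mulLeft k (gen i)

@[simp] lemma rgen_apply (i : Fin 3) (s : Sklyanin k a b c) : rgen a b c i s = s * gen i := rfl
@[simp] lemma lgen_apply (i : Fin 3) (s : Sklyanin k a b c) : lgen a b c i s = gen i * s := rfl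

lemma kos1_rgen_kos0 (s : Sklyanin k a b c) :
    kos1 b a c (rgen a b c) (kos0 (rgen a b c) s) = 0 := by
  funext l
  simp only [kos1_apply, kos0_apply, rgen_apply, Pi.zero_apply, mul_assoc]
  have := congrArg (s * ·) (isSkl_gen (a := a) (b := b) (c := c) l)
  simp only [mul_add, mul_zero, mul_smul_comm] at this
  rw [← this]; abel

lemma kos2_rgen_kos1 (f : Fin 3 → Sklyanin k a b c) :
    kos2 (rgen a b c) (kos1 b a c (rgen a b c) f) = 0 := by
  have h0 := congrArg (f 0 * ·) (isSkl_gen (a := a) (b := b) (c := c) 0)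
  have h1 := congrArg (f 1 * ·) (isSkl_gen (a := a) (b := b) (c := c) 1)
  have h2 := congrArg (f 2 * ·) (isSkl_gen (a := a) (b := b) (c := c) 2)
  obtain ⟨e1, e2, e3, e4, e5, e6⟩ := fin3_add
  simp only [kos2_apply, kos1_apply, rgen_apply, Fin.sum_univ_three, e1, e2, e3, e4, e5, e6,
    mul_add, add_mul, mul_smul_comm, smul_mul_assoc, mul_zero, mul_assoc] at *
  rw [← add_zero (0 : Sklyanin k a b c), ← add_zero ((0 : Sklyanin k a b c) + 0)]
  nth_rewrite 1 [← h0]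
  nth_rewrite 1 [← h1]
  nth_rewrite 1 [← h2]
  abel

/-- The middle Koszul map for right multiplication, as a map of left modules. -/
def foxRel (a b c : k) :
    (Fin 3 → Sklyanin k a b c) →ₗ[Sklyanin k a b c] (Fin 3 → Sklyanin k a b c) where
  toFun := kos1 b a c (rgen a b c)
  map_add' := map_add _
  map_smul' s f := by
    funext l
    simp [kos1_apply, mul_assoc, mul_add]

/-- The generators acting on the module of Fox derivatives. -/
def foxGen (a b c : k) (i : Fin 3) :
    End k (((Fin 3 → Sklyanin k a b c) ⧸ LinearMap.range (foxRel a b c)) × k) :=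
  LinearMap.inl k _ _ ∘ₗ
    ((Algebra.lsmul k k ((Fin 3 → Sklyanin k a b c) ⧸ LinearMap.range (foxRel a b c))
        (gen i : Sklyanin k a b c) ∘ₗ
        LinearMap.fst k _ _)
      + (LinearMap.toSpanSingleton k _
          (Submodule.Quotient.mk (p := LinearMap.range (foxRel a b c)) (Pi.single i 1))) ∘ₗ
        LinearMap.snd k _ _)

lemma foxGen_apply (i : Fin 3)
    (q : (Fin 3 → Sklyanin k a b c) ⧸ LinearMap.range (foxRel a b c)) (r : k) :
    foxGen a b c i (q, r) = ((gen i : Sklyanin k a b c) • q + r •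
      Submodule.Quotient.mk (p := LinearMap.range (foxRel a b c)) (Pi.single i 1), 0) := by
  simp [foxGen]

lemma isSkl_foxGen : IsSkl a b c (foxGen a b c) := by
  intro l
  refine LinearMap.ext ?_
  rintro ⟨q, r⟩
  simp only [LinearMap.add_apply, LinearMap.smul_apply, Module.End.mul_apply, foxGen_apply,
    LinearMap.zero_apply, zero_smul, add_zero, Prod.smul_mk, Prod.mk_add_mk, smul_zero]
  refine Prod.ext ?_ rfl
  simp only [smul_add, smul_smul, Prod.fst_zero]
  have hq := congrArg (fun s : Sklyanin k a b c => s • q)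
    (isSkl_gen (a := a) (b := b) (c := c) l)
  simp only [add_smul, smul_assoc, mul_smul, zero_smul] at hq
  have hr : (c • (gen l : Sklyanin k a b c) • Submodule.Quotient.mk
        (p := LinearMap.range (foxRel a b c)) (Pi.single l 1)
      + a • (gen (l + 1) : Sklyanin k a b c) • Submodule.Quotient.mk
        (p := LinearMap.range (foxRel a b c)) (Pi.single (l + 2) 1)
      + b • (gen (l + 2) : Sklyanin k a b c) • Submodule.Quotient.mk
        (p := LinearMap.range (foxRel a b c)) (Pi.single (l + 1) 1)) = 0 := by
    simp only [← Submodule.Quotient.mk_smul, ← Submodule.Quotient.mk_add]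
    rw [Submodule.Quotient.mk_eq_zero]
    refine ⟨Pi.single l 1, ?_⟩
    show kos1 b a c (rgen a b c) _ = _
    obtain ⟨e1, e2, e3, e4, e5, e6⟩ := fin3_add
    revert l
    refine forall_fin_three ?_ ?_ ?_ <;> intro _ <;>
    · funext j
      revert j
      refine forall_fin_three ?_ ?_ ?_ <;>
      simp [kos1_apply, e1, e2, e3, e4, e5, e6]
  have hr' := congrArg (r • ·) hr
  simp only [smul_add, smul_zero, smul_comm r] at hr'
  rw [← add_zero (0 : (Fin 3 → Sklyanin k a b c) ⧸ LinearMap.range (foxRel a b c))]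
  nth_rewrite 1 [← hq]
  rw [← hr']
  simp only [mul_smul, smul_comm _ r]
  abel

lemma lift_fox_apply (s : Sklyanin k a b c)
    (q : (Fin 3 → Sklyanin k a b c) ⧸ LinearMap.range (foxRel a b c)) :
    lift (foxGen a b c) isSkl_foxGen s (q, 0) = (s • q, 0) := by
  induction s using gen_induction generalizing q with
  | halg r => simp [AlgHom.commutes, Module.algebraMap_end_apply]
  | hgen l => rw [lift_gen, foxGen_apply]; simp
  | hadd s t hs ht => rw [map_add, LinearMap.add_apply, hs, ht, add_smul]; simp
  | hmul s t hs ht => rw [map_mul, Module.End.mul_apply, ht, hs, mul_smul]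

lemma exists_of_kos2_eq_zero (f : Fin 3 → Sklyanin k a b c) (hf : kos2 (rgen a b c) f = 0) :
    ∃ h, kos1 b a c (rgen a b c) h = f := by
  have h1 : lift (foxGen a b c) isSkl_foxGen (∑ i, f i * gen i) (0, 1) = 0 := by
    have : ∑ i, f i * gen i = 0 := by rw [← hf, kos2_apply]; rfl
    rw [this]; simp
  rw [map_sum, LinearMap.sum_apply] at h1
  simp only [map_mul, Module.End.mul_apply, lift_gen, foxGen_apply, lift_fox_apply, smul_zero,
    zero_add, one_smul] at h1
  have h2 := congrArg Prod.fst h1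
  rw [Prod.fst_sum] at h2
  simp only [← Submodule.Quotient.mk_smul, Prod.fst_zero] at h2
  have h3 := map_sum (Submodule.mkQ (LinearMap.range (foxRel a b c)))
    (fun i => f i • (Pi.single i 1 : Fin 3 → Sklyanin k a b c)) Finset.univ
  simp only [Submodule.mkQ_apply] at h3
  rw [← h3, Submodule.Quotient.mk_eq_zero] at h2
  obtain ⟨h, hh⟩ := h2
  refine ⟨h, hh.trans ?_⟩
  funext j
  simp [Finset.sum_apply, Pi.single_apply]

end Exact

end SklAz

namespace SklAz

open Module Matrix

lemma finrank_map_add_inf_ker {k A B : Type*} [Field k] [AddCommGroup A] [Module k A]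
    [AddCommGroup B] [Module k B] (f : A →ₗ[k] B) (P : Submodule k A) [FiniteDimensional k P] :
    finrank k (P.map f) + finrank k (P ⊓ LinearMap.ker f : Submodule k A) = finrank k P := by
  have h := LinearMap.finrank_range_add_finrank_ker (f.domRestrict P)
  have h1 : LinearMap.range (f.domRestrict P) = P.map f := by
    rw [LinearMap.range_domRestrict]
  have h2 : (LinearMap.ker (f.domRestrict P)).map P.subtype = P ⊓ LinearMap.ker f := by
    rw [LinearMap.ker_domRestrict, Submodule.map_comap_subtype]
  rw [h1] at h
  rw [← h2, LinearMap.finrank_map_eq_of_injective' _ P.injective_subtype]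
  exact h
where
  LinearMap.finrank_map_eq_of_injective' {k A B : Type _} [Field k] [AddCommGroup A] [Module k A]
    [AddCommGroup B] [Module k B] (f : A →ₗ[k] B) (hf : Function.Injective f)
    {P : Submodule k A} : finrank k (P.map f) = finrank k P :=
    (LinearEquiv.finrank_eq (Submodule.equivMapOfInjective f hf P)).symm

lemma finrank_pi_three {k A : Type*} [Field k] [AddCommGroup A] [Module k A]
    (P : Submodule k A) [FiniteDimensional k P] :
    finrank k (Submodule.pi Set.univ fun _ : Fin 3 => P) = 3 * finrank k P := by
  have e : (Submodule.pi Set.univ fun _ : Fin 3 => P) ≃ₗ[k] (Fin 3 → P) :=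
    { toFun := fun f i => ⟨f.1 i, f.2 i trivial⟩
      invFun := fun f => ⟨fun i => f i, fun i _ => (f i).2⟩
      map_add' := fun _ _ => rfl
      map_smul' := fun _ _ => rfl
      left_inv := fun _ => rfl
      right_inv := fun _ => rfl }
  rw [e.finrank_eq, finrank_pi_fintype]
  simp

instance finiteDimensional_pi_three {k A : Type*} [Field k] [AddCommGroup A] [Module k A]
    (P : Submodule k A) [FiniteDimensional k P] :
    FiniteDimensional k (Submodule.pi Set.univ fun _ : Fin 3 => P) :=
  Module.Finite.of_injective
    ({ toFun := fun f i => ⟨f.1 i, f.2 i trivial⟩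
       map_add' := fun _ _ => rfl
       map_smul' := fun _ _ => rfl } :
      (Submodule.pi Set.univ fun _ : Fin 3 => P) →ₗ[k] (Fin 3 → P))
    (fun _ _ h => Subtype.ext (funext fun i => congrArg Subtype.val (congrFun h i)))

section Hilbert

variable {k : Type*} [Field k] {a b c : k}

instance : Nontrivial (Sklyanin k a b c) :=
  (lift (k := k) (B := k) (a := a) (b := b) (c := c) (fun _ => 0)
    (by intro l; simp)).toRingHom.domain_nontrivial

/-- Triples of elements of degree `n`. -/
abbrev V3 (a b c : k) (n : ℕ) : Submodule k (Fin 3 → Sklyanin k a b c) :=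
  Submodule.pi Set.univ fun _ => V a b c n

lemma mul_gen_mem {n : ℕ} {s : Sklyanin k a b c} (hs : s ∈ V a b c n) (l : Fin 3) :
    s * gen l ∈ V a b c (n + 1) := by
  rw [V_succ]; exact Submodule.mul_mem_mul hs (gen_mem l)

lemma gen_mul_mem {n : ℕ} {s : Sklyanin k a b c} (hs : s ∈ V a b c n) (l : Fin 3) :
    gen l * s ∈ V a b c (n + 1) := by
  rw [add_comm]
  exact SetLike.mul_mem_graded (A := V a b c) (gen_mem_V l) hs

lemma kos1_rgen_mem {n : ℕ} {f : Fin 3 → Sklyanin k a b c} (hf : f ∈ V3 a b c n) :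
    kos1 b a c (rgen a b c) f ∈ V3 a b c (n + 1) := by
  intro l _
  exact Submodule.add_mem _ (Submodule.add_mem _
    (Submodule.smul_mem _ _ (mul_gen_mem (hf _ trivial) _))
    (Submodule.smul_mem _ _ (mul_gen_mem (hf _ trivial) _)))
    (Submodule.smul_mem _ _ (mul_gen_mem (hf _ trivial) _))

lemma proj_kos1_rgen (f : Fin 3 → Sklyanin k a b c) (n : ℕ) (l : Fin 3) :
    proj (n + 1) (kos1 b a c (rgen a b c) f l) =
      kos1 b a c (rgen a b c) (fun j => proj n (f j)) l := by
  simp [kos1_apply, proj_mul_gen]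

lemma map_kos2_V3 (n : ℕ) : (V3 a b c n).map (kos2 (rgen a b c)) = V a b c (n + 1) := by
  apply le_antisymm
  · rintro _ ⟨f, hf, rfl⟩
    rw [kos2_apply]
    exact Submodule.sum_mem _ fun l _ => mul_gen_mem (hf l trivial) l
  · rw [V_succ, Submodule.mul_le]
    intro s hs t ht
    rw [← range_lin] at ht
    obtain ⟨u, rfl⟩ := ht
    refine ⟨fun l => u l • s, fun l _ => Submodule.smul_mem _ _ hs, ?_⟩
    rw [kos2_apply, lin_apply, Finset.mul_sum]
    simp

lemma V3_inf_ker_kos2 (n : ℕ) : V3 a b c (n + 1) ⊓ LinearMap.ker (kos2 (rgen a b c)) =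
    (V3 a b c n).map (kos1 b a c (rgen a b c)) := by
  apply le_antisymm
  · rintro f ⟨hf, hf0⟩
    obtain ⟨h, rfl⟩ := exists_of_kos2_eq_zero f hf0
    refine ⟨fun j => proj n (h j), fun j _ => proj_mem _ _, ?_⟩
    funext l
    rw [← proj_kos1_rgen]
    exact proj_of_mem (hf l trivial)
  · rintro _ ⟨f, hf, rfl⟩
    exact ⟨kos1_rgen_mem hf, kos2_rgen_kos1 f⟩

lemma finrank_V_zero : finrank k (V a b c 0) = 1 := by
  rw [V_zero, finrank_span_singleton one_ne_zero]

lemma finrank_V_one : finrank k (V a b c 1) = 3 := by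
  have h := finrank_map_add_inf_ker (kos2 (rgen a b c)) (V3 a b c 0)
  rw [map_kos2_V3, finrank_pi_three, finrank_V_zero] at h
  have h0 : V3 a b c 0 ⊓ LinearMap.ker (kos2 (rgen a b c)) = ⊥ := by
    rw [eq_bot_iff]
    rintro f ⟨hf, hf0⟩
    obtain ⟨h, rfl⟩ := exists_of_kos2_eq_zero f hf0
    rw [Submodule.mem_bot]
    funext l
    rw [← proj_of_mem (hf l trivial)]
    simp [kos1_apply, proj_zero_mul_gen]
  rw [h0, finrank_bot] at h
  omega

lemma finrank_V_add_two (n : ℕ) : finrank k (V a b c (n + 2)) +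
    finrank k ((V3 a b c n).map (kos1 b a c (rgen a b c))) = 3 * finrank k (V a b c (n + 1)) := by
  have h := finrank_map_add_inf_ker (kos2 (rgen a b c)) (V3 a b c (n + 1))
  rwa [map_kos2_V3, finrank_pi_three, V3_inf_ker_kos2] at h

lemma V_mul_singleton (n : ℕ) (u : Sklyanin k a b c) :
    V a b c n * Submodule.span k {u} = (V a b c n).map (LinearMap.mulRight k u) := by
  rw [Submodule.mul_eq_map₂, Submodule.map₂_span_singleton_eq_map_flip]
  rfl

lemma mul_lin_injOn [IsAlgClosed k] (h : Nondeg a b c) {n : ℕ}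
    (h1 : finrank k (V a b c n) + (n + 2) ≤ finrank k (V a b c (n + 1)))
    {u : Fin 3 → k} (hu : u ≠ 0) {s : Sklyanin k a b c} (hs : s ∈ V a b c n)
    (hsu : s * lin a b c u = 0) : s = 0 := by
  have h2 := finrank_V_succ_le h n hu
  have h3 := finrank_map_add_inf_ker (LinearMap.mulRight k (lin a b c u)) (V a b c n)
  rw [V_mul_singleton] at h2
  have h4 : finrank k (V a b c n ⊓ LinearMap.ker (LinearMap.mulRight k (lin a b c u)) :
      Submodule k (Sklyanin k a b c)) = 0 := by omega
  have : FiniteDimensional k (V a b c n ⊓ LinearMap.ker (LinearMap.mulRight k (lin a b c u)) :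
      Submodule k (Sklyanin k a b c)) := Submodule.finiteDimensional_inf_left _ _
  rw [Submodule.finrank_eq_zero] at h4
  have : s ∈ (V a b c n ⊓ LinearMap.ker (LinearMap.mulRight k (lin a b c u)) :
      Submodule k (Sklyanin k a b c)) := ⟨hs, hsu⟩
  rwa [h4] at this

lemma kos0_injOn [IsAlgClosed k] (h : Nondeg a b c) {n : ℕ}
    (h1 : finrank k (V a b c n) + (n + 2) ≤ finrank k (V a b c (n + 1)))
    {s : Sklyanin k a b c} (hs : s ∈ V a b c n) (h0 : kos0 (rgen a b c) s = 0) : s = 0 := by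
  refine mul_lin_injOn h h1 (u := Pi.single 0 1) (by simp) hs ?_
  rw [lin_single]
  exact congrFun h0 0

lemma map_kos0_le (n : ℕ) : (V a b c n).map (kos0 (rgen a b c)) ≤
    V3 a b c (n + 1) ⊓ LinearMap.ker (kos1 b a c (rgen a b c)) := by
  rintro _ ⟨s, hs, rfl⟩
  exact ⟨fun l _ => mul_gen_mem hs l, kos1_rgen_kos0 s⟩

lemma finrank_map_kos0 [IsAlgClosed k] (h : Nondeg a b c) {n : ℕ}
    (h1 : finrank k (V a b c n) + (n + 2) ≤ finrank k (V a b c (n + 1))) :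
    finrank k ((V a b c n).map (kos0 (rgen a b c))) = finrank k (V a b c n) := by
  have h2 := finrank_map_add_inf_ker (kos0 (rgen a b c)) (V a b c n)
  have h0 : V a b c n ⊓ LinearMap.ker (kos0 (rgen a b c)) = ⊥ := by
    rw [eq_bot_iff]
    rintro f ⟨hf, hf0⟩
    exact kos0_injOn h h1 hf hf0
  rwa [h0, finrank_bot, add_zero] at h2

/-- The Hilbert series of the Sklyanin algebra is that of a polynomial ring in three
variables. -/
theorem finrank_V [IsAlgClosed k] (h : Nondeg a b c) (n : ℕ) :
    2 * finrank k (V a b c n) = (n + 1) * (n + 2) := by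
  induction n using Nat.strong_induction_on with
  | _ n ih =>
    have hup : ∀ n, finrank k (V a b c (n + 1)) ≤ finrank k (V a b c n) + (n + 2) := fun n =>
      (finrank_V_succ_le h n (u := Pi.single 0 1) (by simp)).trans
        (Nat.add_le_add_right (finrank_mul_singleton_le _ _) _)
    match n with
    | 0 => rw [finrank_V_zero]
    | 1 => rw [finrank_V_one]
    | 2 =>
      have h1 : finrank k (V a b c 2) + _ = 3 * finrank k (V a b c 1) := finrank_V_add_two 0
      have h2 := finrank_map_add_inf_ker (kos1 b a c (rgen a b c)) (V3 a b c 0)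
      rw [finrank_pi_three, finrank_V_zero] at h2
      have h3 : finrank k (V a b c 2) ≤ finrank k (V a b c 1) + 3 := hup 1
      rw [finrank_V_one] at h1 h3
      omega
    | n + 3 =>
      have h0 := ih n (by omega)
      have h1 := ih (n + 1) (by omega)
      have h2 := ih (n + 2) (by omega)
      have h3 := finrank_V_add_two (k := k) (a := a) (b := b) (c := c) (n + 1)
      have h4 := finrank_map_add_inf_ker (kos1 b a c (rgen a b c)) (V3 a b c (n + 1))
      have h5 := Submodule.finrank_mono (map_kos0_le (k := k) (a := a) (b := b) (c := c) n)
      rw [finrank_map_kos0 h (by nlinarith)] at h5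
      rw [finrank_pi_three] at h4
      have h6 := hup (n + 2)
      simp only [add_assoc] at *
      norm_num at *
      nlinarith

lemma finrank_V_succ [IsAlgClosed k] (h : Nondeg a b c) (n : ℕ) :
    finrank k (V a b c (n + 1)) = finrank k (V a b c n) + (n + 2) := by
  have h0 := finrank_V h n
  have h1 := finrank_V h (n + 1)
  nlinarith

lemma sum_proj_eq (s : Sklyanin k a b c) {n : ℕ} (hn : ∀ m, n ≤ m → proj m s = 0) :
    ∑ m ∈ Finset.range n, proj m s = s := by
  rw [← sub_eq_zero]
  refine eq_zero_of_proj fun j => ?_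
  rw [map_sub, map_sum, sub_eq_zero]
  by_cases hj : j < n
  · rw [Finset.sum_eq_single j, proj_of_mem (proj_mem _ _)]
    · intro m _ hm; exact proj_of_mem_ne (proj_mem _ _) hm
    · intro h; exact absurd (Finset.mem_range.2 hj) h
  · rw [hn j (by omega)]
    refine Finset.sum_eq_zero fun m hm => proj_of_mem_ne (proj_mem _ _) ?_
    have := Finset.mem_range.1 hm
    omega

/-- Right multiplication by a nonzero linear form is injective. -/
lemma mul_lin_injective [IsAlgClosed k] (h : Nondeg a b c) {u : Fin 3 → k} (hu : u ≠ 0)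
    {s : Sklyanin k a b c} (hsu : s * lin a b c u = 0) : s = 0 := by
  refine eq_zero_of_proj fun n => ?_
  refine mul_lin_injOn h (finrank_V_succ h n).ge hu (proj_mem _ _) ?_
  have := congrArg (proj (n + 1)) hsu
  rw [map_zero] at this
  rw [← this, lin_apply, Finset.mul_sum, Finset.mul_sum, map_sum]
  simp [proj_mul_gen]

theorem kosExact_rgen [IsAlgClosed k] (h : Nondeg a b c) : KosExact b a c (rgen a b c) where
  inj s hs := by
    refine mul_lin_injective h (u := Pi.single 0 1) (by simp) ?_
    rw [lin_single]
    exact congrFun hs 0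
  ex2 g hg := exists_of_kos2_eq_zero g hg
  ex1 g hg := by
    have hker : ∀ n, ∃ m, kos0 (rgen a b c) m = fun l => proj n (g l) := by
      intro n
      have hmem : (fun l => proj n (g l)) ∈
          V3 a b c n ⊓ LinearMap.ker (kos1 b a c (rgen a b c)) := by
        refine ⟨fun l _ => proj_mem _ _, ?_⟩
        rw [SetLike.mem_coe, LinearMap.mem_ker]
        funext l
        rw [← proj_kos1_rgen, hg]
        simp
      cases n with
      | zero =>
        have h1 : finrank k (V a b c 2) + _ = 3 * finrank k (V a b c 1) := finrank_V_add_two 0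
        have h2 := finrank_map_add_inf_ker (kos1 b a c (rgen a b c)) (V3 a b c 0)
        have h3 := finrank_V h 2
        rw [finrank_V_one] at h1
        rw [finrank_pi_three, finrank_V_zero] at h2
        have : FiniteDimensional k (V3 a b c 0 ⊓ LinearMap.ker (kos1 b a c (rgen a b c)) :
          Submodule k _) := Submodule.finiteDimensional_inf_left _ _
        have h4 : finrank k (V3 a b c 0 ⊓ LinearMap.ker (kos1 b a c (rgen a b c)) :
          Submodule k _) = 0 := by omega
        rw [Submodule.finrank_eq_zero] at h4
        rw [h4, Submodule.mem_bot] at hmem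
        exact ⟨0, by rw [hmem, map_zero]⟩
      | succ n =>
        have h1 : finrank k (V a b c (n + 3)) + _ = 3 * finrank k (V a b c (n + 2)) :=
          finrank_V_add_two (n + 1)
        have h2 := finrank_map_add_inf_ker (kos1 b a c (rgen a b c)) (V3 a b c (n + 1))
        have h3 := finrank_map_kos0 h (finrank_V_succ h n).ge
        have h4 := finrank_V_succ h n
        have h5 : finrank k (V a b c (n + 2)) = _ + (n + 3) := finrank_V_succ h (n + 1)
        have h6 : finrank k (V a b c (n + 3)) = _ + (n + 4) := finrank_V_succ h (n + 2)
        have h7 := finrank_V h n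
        rw [finrank_pi_three] at h2
        have : FiniteDimensional k (V3 a b c (n + 1) ⊓
          LinearMap.ker (kos1 b a c (rgen a b c)) : Submodule k _) :=
          Submodule.finiteDimensional_inf_left _ _
        have heq := Submodule.eq_of_le_of_finrank_le (map_kos0_le (k := k) (a := a) (b := b)
          (c := c) n) (by omega)
        rw [← heq] at hmem
        obtain ⟨m, -, hm⟩ := hmem
        exact ⟨m, hm⟩
    choose m hm using hker
    choose B hB using fun l => exists_proj_bound (g l)
    refine ⟨∑ n ∈ Finset.range (B 0 + B 1 + B 2), m n, ?_⟩
    rw [map_sum]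
    funext l
    rw [Finset.sum_apply, ← sum_proj_eq (g l) (n := B 0 + B 1 + B 2)]
    · exact Finset.sum_congr rfl fun n _ => congrFun (hm n) l
    · intro j hj
      refine hB l j (le_trans ?_ hj)
      revert l
      refine forall_fin_three ?_ ?_ ?_ <;> omega

/-- The anti-isomorphism between Sklyanin algebras exchanging the first two parameters. -/
def rev (a b c : k) : Sklyanin k a b c →ₗ[k] Sklyanin k b a c :=
  (MulOpposite.opLinearEquiv k).symm.toLinearMap ∘ₗ
    (lift (a := a) (b := b) (c := c) (fun l => MulOpposite.op (gen l : Sklyanin k b a c)) (by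
      intro l
      have := isSkl_gen (a := b) (b := a) (c := c) l
      simp only [← MulOpposite.op_mul, ← MulOpposite.op_smul, ← MulOpposite.op_add]
      rw [← MulOpposite.op_zero, ← this]
      congr 1; abel)).toLinearMap

lemma rev_gen (l : Fin 3) : rev a b c (gen l) = gen l :=
  congrArg MulOpposite.unop (lift_gen _ _ l)
lemma rev_one : rev a b c 1 = 1 := by simp [rev]
lemma rev_mul (s t : Sklyanin k a b c) : rev a b c (s * t) = rev a b c t * rev a b c s := by
  simp [rev]

lemma rev_rev (s : Sklyanin k a b c) : rev b a c (rev a b c s) = s := by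
  induction s using gen_induction with
  | halg r => rw [Algebra.algebraMap_eq_smul_one, map_smul, map_smul, rev_one, rev_one]
  | hgen l => rw [rev_gen, rev_gen]
  | hadd s t hs ht => rw [map_add, map_add, hs, ht]
  | hmul s t hs ht => rw [rev_mul, rev_mul, hs, ht]

lemma KosExact.transfer {M M' : Type*} [AddCommGroup M] [Module k M] [AddCommGroup M']
    [Module k M'] {γ : Fin 3 → End k M} {γ' : Fin 3 → End k M'} (hγ : KosExact a b c γ)
    (e : M' →ₗ[k] M) (f : M →ₗ[k] M') (hfe : ∀ m, f (e m) = m)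
    (he : ∀ l m, e (γ' l m) = γ l (e m)) (hf : ∀ l m, f (γ l m) = γ' l (f m)) :
    KosExact a b c γ' where
  inj m hm := by
    rw [← hfe m, hγ.inj (e m), map_zero]
    funext l
    rw [kos0_apply, ← he]
    have := congrFun hm l
    rw [kos0_apply] at this
    simp [this]
  ex1 g hg := by
    obtain ⟨m, hm⟩ := hγ.ex1 (fun l => e (g l)) (by
      funext l
      have := congrArg e (congrFun hg l)
      simp only [kos1_apply, map_add, map_smul, he] at this
      rw [kos1_apply, this]; simp)
    refine ⟨f m, ?_⟩
    funext l
    rw [kos0_apply, ← hf, ← kos0_apply γ, hm, hfe]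
  ex2 g hg := by
    obtain ⟨m, hm⟩ := hγ.ex2 (fun l => e (g l)) (by
      have := congrArg e hg
      rw [kos2_apply] at *
      simp only [map_sum, he] at this
      rw [this]; simp)
    refine ⟨fun l => f (m l), ?_⟩
    funext l
    have := congrArg f (congrFun hm l)
    simp only [kos1_apply, map_add, map_smul, hf, hfe] at this
    exact this

theorem kosExact_lgen [IsAlgClosed k] (h : Nondeg a b c) : KosExact a b c (lgen a b c) :=
  (kosExact_rgen h.symm).transfer (rev a b c) (rev b a c) rev_rev
    (fun l m => by simp [rev_mul, rev_gen]) (fun l m => by simp [rev_mul, rev_gen])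

end Hilbert

end SklAz

namespace SklAz

open Module Matrix

section Points

variable {k : Type*} [Field k] {a b c : k}

lemma rev_lin (u : Fin 3 → k) : rev a b c (lin a b c u) = lin b a c u := by
  simp [lin_apply, rev_gen]

/-- A point `p` on the cubic together with the relation `u' v + w u = 0` among the linear forms
`u, v` that vanish at `p`; here `u', w` span the linear forms vanishing at `p'`. -/
structure PtRel (a b c : k) (p p' u v u' w : Fin 3 → k) : Prop where
  hp : p ≠ 0
  hE : (N a b c p).det = 0
  hu : u ≠ 0
  hv : v ≠ 0
  hu' : u' ≠ 0
  hw : w ≠ 0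
  hup : u ⬝ᵥ p = 0
  hvp : v ⬝ᵥ p = 0
  bas : ∀ y, y ⬝ᵥ p = 0 → ∃ r s : k, y = r • u + s • v
  hp' : p' ≠ 0
  hE' : (N b a c p').det = 0
  hup' : u' ⬝ᵥ p' = 0
  hwp' : w ⬝ᵥ p' = 0
  bas' : ∀ y, y ⬝ᵥ p' = 0 → ∃ r s : k, y = r • w + s • u'
  rel : lin a b c u' * lin a b c v + lin a b c w * lin a b c u = 0

lemma PtRel.symm {p p' u v u' w : Fin 3 → k} (h : PtRel a b c p p' u v u' w) :
    PtRel b a c p' p w u' v u where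
  hp := h.hp'
  hE := h.hE'
  hu := h.hw
  hv := h.hu'
  hu' := h.hv
  hw := h.hu
  hup := h.hwp'
  hvp := h.hup'
  bas := h.bas'
  hp' := h.hp
  hE' := h.hE
  hup' := h.hvp
  hwp' := h.hup
  bas' := h.bas
  rel := by
    have := congrArg (rev a b c) h.rel
    simpa [rev_mul, rev_lin] using this

lemma exists_perp (u w : Fin 3 → k) : ∃ p : Fin 3 → k, p ≠ 0 ∧ u ⬝ᵥ p = 0 ∧ w ⬝ᵥ p = 0 := by
  obtain ⟨p, hp, h⟩ := Matrix.exists_mulVec_eq_zero_iff.2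
    (show (Matrix.of ![u, w, 0]).det = 0 from Matrix.det_eq_zero_of_row_eq_zero 2 (by simp))
  exact ⟨p, hp, by simpa [Matrix.mulVec] using congrFun h 0,
    by simpa [Matrix.mulVec] using congrFun h 1⟩

lemma exists_perp_one {p : Fin 3 → k} : ∃ u : Fin 3 → k, u ≠ 0 ∧ u ⬝ᵥ p = 0 := by
  obtain ⟨u, hu, h, -⟩ := exists_perp p p
  exact ⟨u, hu, by rwa [dotProduct_comm]⟩

lemma exists_ptRel [IsAlgClosed k] (h : Nondeg a b c) {p u : Fin 3 → k} (hp : p ≠ 0)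
    (hE : (N a b c p).det = 0) (hu : u ≠ 0) (hup : u ⬝ᵥ p = 0) :
    ∃ p' v u' w : Fin 3 → k, PtRel a b c p p' u v u' w := by
  obtain ⟨v, hv, hbas⟩ := exists_annihilator_basis hu hp hup
  obtain ⟨q, hq0, hq⟩ := Matrix.exists_vecMul_eq_zero_iff.2 hE
  rw [N_vecMul] at hq
  have : ∀ i, ∃ r s : k, N a b c q i = r • u + s • v := fun i => hbas _ (congrFun hq i)
  choose r s hrs using this
  have hrel : lin a b c s * lin a b c v + lin a b c r * lin a b c u = 0 := by
    have := rel_N (a := a) (b := b) (c := c) q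
    simp only [hrs, map_add, map_smul, mul_add, Finset.sum_add_distrib, mul_smul_comm] at this
    rw [lin_apply r, lin_apply s, Finset.sum_mul, Finset.sum_mul]
    simp only [smul_mul_assoc]
    rw [add_comm]; exact this
  have hs0 : s ≠ 0 := by
    rintro rfl
    refine hq0 (N_rank_one h (r := r) (m := u) fun i j => ?_)
    rw [hrs i]; simp
  have hr0 : r ≠ 0 := by
    rintro rfl
    refine hq0 (N_rank_one h (r := s) (m := v) fun i j => ?_)
    rw [hrs i]; simp
  have hv0 : v ≠ 0 := by
    rintro rfl
    refine hq0 (N_rank_one h (r := r) (m := u) fun i j => ?_)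
    rw [hrs i]; simp
  obtain ⟨p', hp', hrp, hsp⟩ := exists_perp r s
  obtain ⟨v', hv', hbas'⟩ := exists_annihilator_basis hr0 hp' hrp
  refine ⟨p', v, s, r, hp, hE, hu, hv0, hs0, hr0, hup, hv, hbas, hp', ?_, hsp, hrp, ?_, hrel⟩
  · rw [show (N b a c p').det = (N a b c p').det by rw [N_det, N_det]; ring]
    refine Matrix.exists_mulVec_eq_zero_iff.1 ⟨q, hq0, ?_⟩
    rw [← N_vecMul]
    have : ∀ j, (p' ᵥ* N a b c q) j = (r ⬝ᵥ p') * u j + (s ⬝ᵥ p') * v j := by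
      intro j
      simp only [Matrix.vecMul, dotProduct, Fin.sum_univ_three, hrs]
      simp
      ring
    funext j
    rw [this, hrp, hsp]; simp
  · intro y hy
    obtain ⟨r1, s1, h1⟩ := hbas' s hsp
    have hs1 : s1 ≠ 0 := by
      rintro rfl
      have h1' : s = r1 • r := by simpa using h1
      refine hq0 (N_rank_one h (r := r) (m := u + r1 • v) fun i j => ?_)
      rw [hrs i, h1']; simp; ring
    obtain ⟨r2, s2, h2⟩ := hbas' y hy
    refine ⟨r2 - s2 / s1 * r1, s2 / s1, ?_⟩
    rw [h2, h1]
    ext i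
    simp
    field_simp
    ring

lemma PtRel.U_eq {p p' u v u' w : Fin 3 → k} (h : PtRel a b c p p' u v u' w) :
    U a b c p = Submodule.span k {lin a b c u} ⊔ Submodule.span k {lin a b c v} := by
  apply le_antisymm
  · intro x hx
    obtain ⟨y, hy, rfl⟩ := mem_U.1 hx
    obtain ⟨r, s, rfl⟩ := h.bas y hy
    rw [map_add, map_smul, map_smul]
    exact Submodule.add_mem_sup (Submodule.smul_mem _ _ (Submodule.mem_span_singleton_self _))
      (Submodule.smul_mem _ _ (Submodule.mem_span_singleton_self _))
  · rw [sup_le_iff, Submodule.span_singleton_le_iff_mem, Submodule.span_singleton_le_iff_mem]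
    exact ⟨mem_U.2 ⟨u, h.hup, rfl⟩, mem_U.2 ⟨v, h.hvp, rfl⟩⟩

/-- The map `(s, t) ↦ s v + t u`. -/
def pairMap (a b c : k) (u v : Fin 3 → k) :
    Sklyanin k a b c × Sklyanin k a b c →ₗ[k] Sklyanin k a b c :=
  (LinearMap.mulRight k (lin a b c v)).coprod (LinearMap.mulRight k (lin a b c u))

/-- The map `r ↦ (r u', r w)`. -/
def relMap (a b c : k) (u' w : Fin 3 → k) :
    Sklyanin k a b c →ₗ[k] Sklyanin k a b c × Sklyanin k a b c :=
  (LinearMap.mulRight k (lin a b c u')).prod (LinearMap.mulRight k (lin a b c w))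

lemma pairMap_apply (u v : Fin 3 → k) (s t : Sklyanin k a b c) :
    pairMap a b c u v (s, t) = s * lin a b c v + t * lin a b c u := rfl

lemma relMap_apply (u' w : Fin 3 → k) (r : Sklyanin k a b c) :
    relMap a b c u' w r = (r * lin a b c u', r * lin a b c w) := rfl

lemma PtRel.pairMap_relMap {p p' u v u' w : Fin 3 → k} (h : PtRel a b c p p' u v u' w)
    (r : Sklyanin k a b c) : pairMap a b c u v (relMap a b c u' w r) = 0 := by
  rw [relMap_apply, pairMap_apply, mul_assoc, mul_assoc, ← mul_add, h.rel, mul_zero]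

lemma PtRel.map_pairMap {p p' u v u' w : Fin 3 → k} (h : PtRel a b c p p' u v u' w) (n : ℕ) :
    ((V a b c n).prod (V a b c n)).map (pairMap a b c u v) = V a b c n * U a b c p := by
  rw [h.U_eq, Submodule.mul_sup, V_mul_singleton, V_mul_singleton, pairMap,
    LinearMap.map_coprod_prod, sup_comm]

lemma mul_lin_mem {n : ℕ} {s : Sklyanin k a b c} (hs : s ∈ V a b c n) (u : Fin 3 → k) :
    s * lin a b c u ∈ V a b c (n + 1) := by
  rw [V_succ]; exact Submodule.mul_mem_mul hs (lin_mem u)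

/-- A product of two copies of a subspace, as a product of types. -/
def prodSelfEquiv {A : Type*} [AddCommGroup A] [Module k A] (P : Submodule k A) :
    (P.prod P) ≃ₗ[k] (P × P) where
  toFun x := (⟨x.1.1, x.2.1⟩, ⟨x.1.2, x.2.2⟩)
  invFun x := ⟨(x.1, x.2), ⟨x.1.2, x.2.2⟩⟩
  map_add' _ _ := rfl
  map_smul' _ _ := rfl
  left_inv _ := rfl
  right_inv _ := rfl

instance {A : Type*} [AddCommGroup A] [Module k A] (P : Submodule k A) [FiniteDimensional k P] :
    FiniteDimensional k (P.prod P) :=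
  Module.Finite.equiv (prodSelfEquiv P).symm

lemma finrank_prod_self {A : Type*} [AddCommGroup A] [Module k A] (P : Submodule k A)
    [FiniteDimensional k P] : finrank k (P.prod P) = 2 * finrank k P := by
  rw [(prodSelfEquiv P).finrank_eq, finrank_prod, two_mul]

lemma finrank_V_succ_le_mul_U (h : Nondeg a b c) {p : Fin 3 → k} (hp : p ≠ 0)
    (hE : (N a b c p).det = 0) (n : ℕ) : finrank k (V a b c (n + 1)) ≤
      finrank k (V a b c n * U a b c p : Submodule k (Sklyanin k a b c)) + 1 := by
  obtain ⟨s, hs⟩ := point_module h (n + 1) hp hE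
  have hfd : FiniteDimensional k (V a b c n * U a b c p : Submodule k (Sklyanin k a b c)) :=
    Submodule.finiteDimensional_of_le (S₂ := V a b c (n + 1))
      (by rw [V_succ]; exact mul_le_mul' le_rfl (U_le_V1 p))
  have hfd' : FiniteDimensional k (leftPart (U a b c p) (n + 1)) := hfd
  have h1 := Submodule.finrank_mono hs
  have h2 := Submodule.finrank_add_le_finrank_add_finrank (leftPart (U a b c p) (n + 1))
    (Submodule.span k {s})
  have h3 := finrank_span_le_card (R := k) ({s} : Set (Sklyanin k a b c))
  simp at h3
  have h4 : finrank k (leftPart (U a b c p) (n + 1)) =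
    finrank k (V a b c n * U a b c p : Submodule k (Sklyanin k a b c)) := rfl
  omega

lemma finrank_map_of_injOn {A B : Type*} [AddCommGroup A] [Module k A]
    [AddCommGroup B] [Module k B] (f : A →ₗ[k] B) (P : Submodule k A) [FiniteDimensional k P]
    (hf : ∀ x ∈ P, f x = 0 → x = 0) : finrank k (P.map f) = finrank k P := by
  have h2 := finrank_map_add_inf_ker f P
  have h0 : P ⊓ LinearMap.ker f = ⊥ := by
    rw [eq_bot_iff]
    rintro x ⟨hx, hx0⟩
    exact hf x hx hx0
  rwa [h0, finrank_bot, add_zero] at h2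

variable [IsAlgClosed k]

lemma PtRel.finrank_aux (hN : Nondeg a b c) {p p' u v u' w : Fin 3 → k}
    (h : PtRel a b c p p' u v u' w) (n : ℕ) :
    finrank k (V a b c n * U a b c p : Submodule k (Sklyanin k a b c)) + 1 =
      finrank k (V a b c (n + 1)) ∧
    ∀ x ∈ (V a b c n).prod (V a b c n), pairMap a b c u v x = 0 →
      ∃ r, x = relMap a b c u' w r := by
  have h1 := finrank_V_succ_le_mul_U hN h.hp h.hE n
  have h2 := finrank_map_add_inf_ker (pairMap a b c u v) ((V a b c n).prod (V a b c n))
  rw [h.map_pairMap, finrank_prod_self] at h2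
  have hfd : FiniteDimensional k ((V a b c n).prod (V a b c n) ⊓
      LinearMap.ker (pairMap a b c u v) : Submodule k _) :=
    Submodule.finiteDimensional_of_le inf_le_left
  have h3 := finrank_V_succ hN n
  cases n with
  | zero =>
    rw [finrank_V_zero] at h2 h3
    rw [h3] at h1
    have h4 : finrank k ((V a b c 0).prod (V a b c 0) ⊓
      LinearMap.ker (pairMap a b c u v) : Submodule k _) = 0 := by omega
    refine ⟨by omega, fun x hx hx0 => ⟨0, ?_⟩⟩
    rw [Submodule.finrank_eq_zero] at h4
    have : x ∈ ((V a b c 0).prod (V a b c 0) ⊓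
      LinearMap.ker (pairMap a b c u v) : Submodule k _) := ⟨hx, hx0⟩
    rw [h4] at this
    rw [map_zero]; exact this
  | succ n =>
    have h4 : finrank k ((V a b c n).map (relMap a b c u' w)) = finrank k (V a b c n) := by
      refine finrank_map_of_injOn _ _ fun x _ hx => ?_
      exact mul_lin_injective hN h.hu' (congrArg Prod.fst hx)
    have hle : (V a b c n).map (relMap a b c u' w) ≤
        (V a b c (n + 1)).prod (V a b c (n + 1)) ⊓ LinearMap.ker (pairMap a b c u v) := by
      rintro _ ⟨r, hr, rfl⟩
      exact ⟨⟨mul_lin_mem hr _, mul_lin_mem hr _⟩, h.pairMap_relMap r⟩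
    have h5 := Submodule.finrank_mono hle
    have h6 := finrank_V_succ hN n
    refine ⟨by omega, fun x hx hx0 => ?_⟩
    have h7 := Submodule.eq_of_le_of_finrank_le hle (by omega)
    have : x ∈ ((V a b c (n + 1)).prod (V a b c (n + 1)) ⊓
      LinearMap.ker (pairMap a b c u v) : Submodule k _) := ⟨hx, hx0⟩
    rw [← h7] at this
    obtain ⟨r, -, hr⟩ := this
    exact ⟨r, hr.symm⟩

omit [IsAlgClosed k] in
lemma proj_mul_lin (n : ℕ) (s : Sklyanin k a b c) (u : Fin 3 → k) :
    proj (n + 1) (s * lin a b c u) = proj n s * lin a b c u := by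
  rw [lin_apply, Finset.mul_sum, Finset.mul_sum, map_sum]
  simp [proj_mul_gen]

lemma PtRel.exact (hN : Nondeg a b c) {p p' u v u' w : Fin 3 → k}
    (h : PtRel a b c p p' u v u' w) {s t : Sklyanin k a b c}
    (hst : s * lin a b c v + t * lin a b c u = 0) :
    ∃ r, s = r * lin a b c u' ∧ t = r * lin a b c w := by
  have key : ∀ n, ∃ r, proj n s = r * lin a b c u' ∧ proj n t = r * lin a b c w := by
    intro n
    obtain ⟨r, hr⟩ := (h.finrank_aux hN n).2 (proj n s, proj n t) ⟨proj_mem _ _, proj_mem _ _⟩ (by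
      rw [pairMap_apply, ← proj_mul_lin, ← proj_mul_lin, ← map_add, hst, map_zero])
    exact ⟨r, congrArg Prod.fst hr, congrArg Prod.snd hr⟩
  choose r hr1 hr2 using key
  obtain ⟨n1, h1⟩ := exists_proj_bound s
  obtain ⟨n2, h2⟩ := exists_proj_bound t
  refine ⟨∑ m ∈ Finset.range (max n1 n2), r m, ?_, ?_⟩
  · rw [Finset.sum_mul, ← sum_proj_eq s (n := max n1 n2) fun m hm => h1 m (by omega)]
    exact Finset.sum_congr rfl fun m _ => hr1 m
  · rw [Finset.sum_mul, ← sum_proj_eq t (n := max n1 n2) fun m hm => h2 m (by omega)]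
    exact Finset.sum_congr rfl fun m _ => hr2 m

lemma lin_mul_injective (h : Nondeg a b c) {u : Fin 3 → k} (hu : u ≠ 0)
    {s : Sklyanin k a b c} (hsu : lin a b c u * s = 0) : s = 0 := by
  have h1 : rev a b c s = 0 := by
    refine mul_lin_injective h.symm hu ?_
    rw [← rev_lin, ← rev_mul, hsu, map_zero]
  rw [← rev_rev s, h1, map_zero]

lemma PtRel.exact_left (hN : Nondeg a b c) {p p' u v u' w : Fin 3 → k}
    (h : PtRel a b c p p' u v u' w) {s t : Sklyanin k a b c}
    (hst : lin a b c u' * s + lin a b c w * t = 0) :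
    ∃ r, s = lin a b c v * r ∧ t = lin a b c u * r := by
  obtain ⟨r, h1, h2⟩ := h.symm.exact hN.symm (s := rev a b c s) (t := rev a b c t) (by
    rw [← rev_lin (a := a) (b := b) u', ← rev_lin (a := a) (b := b) w, ← rev_mul, ← rev_mul,
      ← map_add, hst, map_zero])
  refine ⟨rev b a c r, ?_, ?_⟩
  · rw [← rev_rev s, h1, rev_mul, rev_lin]
  · rw [← rev_rev t, h2, rev_mul, rev_lin]

omit [IsAlgClosed k] in
lemma U_mul_V_le (h : Nondeg a b c) (d : ℕ) : ∀ {p : Fin 3 → k}, p ≠ 0 → (N a b c p).det = 0 →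
    ∃ q : Fin 3 → k, q ≠ 0 ∧ (N a b c q).det = 0 ∧
      U a b c q * V a b c d ≤ V a b c d * U a b c p := by
  induction d with
  | zero =>
    intro p hp hE
    refine ⟨p, hp, hE, ?_⟩
    rw [show V a b c 0 = 1 from pow_zero _, one_mul, mul_one]
  | succ d ih =>
    intro p hp hE
    obtain ⟨p1, hp1, h1, hE1⟩ := exists_next hp hE
    obtain ⟨q, hq, hEq, hle⟩ := ih hp1 hE1
    refine ⟨q, hq, hEq, ?_⟩
    rw [V_succ, ← mul_assoc]
    calc U a b c q * V a b c d * V1 a b c ≤ V a b c d * U a b c p1 * V1 a b c :=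
          mul_le_mul' hle le_rfl
      _ = V a b c d * (U a b c p1 * V1 a b c) := mul_assoc _ _ _
      _ ≤ V a b c d * (V1 a b c * U a b c p) := by
          refine mul_le_mul' le_rfl (Submodule.mul_le.2 fun x hx y hy => ?_)
          rw [← range_lin] at hy
          obtain ⟨y, rfl⟩ := hy
          exact point_step h hp hp1 h1 (Submodule.mul_mem_mul hx
            (Submodule.mem_span_singleton_self _))
      _ = V a b c d * V1 a b c * U a b c p := (mul_assoc _ _ _).symm

end Points

end SklAz

namespace SklAz

open Module Matrix

section Lines

variable {k : Type*} [Field k] {a b c : k}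

lemma PtRel.mem_top_mul_U {p p' u v u' w : Fin 3 → k} (h : PtRel a b c p p' u v u' w)
    {x : Sklyanin k a b c} : x ∈ (⊤ : Submodule k (Sklyanin k a b c)) * U a b c p ↔
      ∃ s t, x = s * lin a b c v + t * lin a b c u := by
  rw [h.U_eq, Submodule.mul_sup, Submodule.mem_sup]
  constructor
  · rintro ⟨y, hy, z, hz, rfl⟩
    obtain ⟨y, -, rfl⟩ := Submodule.mem_mul_span_singleton.1 hy
    obtain ⟨z, -, rfl⟩ := Submodule.mem_mul_span_singleton.1 hz
    exact ⟨z, y, add_comm _ _⟩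
  · rintro ⟨s, t, rfl⟩
    exact ⟨_, Submodule.mem_mul_span_singleton.2 ⟨t, trivial, rfl⟩, _,
      Submodule.mem_mul_span_singleton.2 ⟨s, trivial, rfl⟩, add_comm _ _⟩

lemma proj_mem_top_mul_U {p : Fin 3 → k} {x : Sklyanin k a b c}
    (hx : x ∈ (⊤ : Submodule k (Sklyanin k a b c)) * U a b c p) (n : ℕ) :
    proj n x ∈ leftPart (U a b c p) n := by
  induction hx using Submodule.mul_induction_on' with
  | mem_mul_mem s _ t ht =>
    obtain ⟨y, -, rfl⟩ := mem_U.1 ht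
    cases n with
    | zero =>
      have : proj 0 (s * lin a b c y) = 0 := by
        rw [lin_apply, Finset.mul_sum, map_sum]
        simp [proj_zero_mul_gen]
      rw [this]; exact zero_mem _
    | succ n =>
      rw [proj_mul_lin]
      exact Submodule.mul_mem_mul (proj_mem _ _) ht
  | add x _ y _ hx hy => rw [map_add]; exact add_mem hx hy

lemma leftPart_le_top_mul {p : Fin 3 → k} (n : ℕ) :
    leftPart (U a b c p) n ≤ (⊤ : Submodule k (Sklyanin k a b c)) * U a b c p := by
  cases n with
  | zero => exact bot_le
  | succ n => exact mul_le_mul' le_top le_rfl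

lemma mul_mem_top_mul {W : Submodule k (Sklyanin k a b c)} {x : Sklyanin k a b c}
    (hx : x ∈ (⊤ : Submodule k (Sklyanin k a b c)) * W) (s : Sklyanin k a b c) :
    s * x ∈ (⊤ : Submodule k (Sklyanin k a b c)) * W := by
  induction hx using Submodule.mul_induction_on' with
  | mem_mul_mem r _ t ht => rw [← mul_assoc]; exact Submodule.mul_mem_mul trivial ht
  | add x _ y _ hx hy => rw [mul_add]; exact add_mem hx hy

lemma V_le_leftPart_sup (h : Nondeg a b c) {p : Fin 3 → k} (hp : p ≠ 0)
    (hE : (N a b c p).det = 0) {d : ℕ} {m : Sklyanin k a b c} (hm : m ∈ V a b c d)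
    (hmp : m ∉ (⊤ : Submodule k (Sklyanin k a b c)) * U a b c p) :
    V a b c d ≤ leftPart (U a b c p) d ⊔ Submodule.span k {m} := by
  obtain ⟨s, hs⟩ := point_module h d hp hE
  obtain ⟨l, hl, z, hz, hlz⟩ := Submodule.mem_sup.1 (hs hm)
  obtain ⟨r, rfl⟩ := Submodule.mem_span_singleton.1 hz
  have hr : r ≠ 0 := by
    rintro rfl
    rw [zero_smul, add_zero] at hlz
    exact hmp (leftPart_le_top_mul _ (hlz ▸ hl))
  refine hs.trans (sup_le le_sup_left ?_)
  rw [Submodule.span_singleton_le_iff_mem]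
  have : s = r⁻¹ • (-l) + r⁻¹ • m := by
    rw [← hlz, ← smul_add, neg_add_cancel_left, smul_smul, inv_mul_cancel₀ hr, one_smul]
  rw [this]
  exact Submodule.add_mem_sup (Submodule.smul_mem _ _ (neg_mem hl))
    (Submodule.smul_mem _ _ (Submodule.mem_span_singleton_self _))

variable [IsAlgClosed k]

lemma PtRel.not_le (hN : Nondeg a b c) {p p' u v u' w : Fin 3 → k}
    (h : PtRel a b c p p' u v u' w) (n : ℕ) :
    ¬ V a b c n ≤ (⊤ : Submodule k (Sklyanin k a b c)) * U a b c p := by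
  intro hle
  have h1 : V a b c n ≤ leftPart (U a b c p) n := fun x hx => by
    rw [← proj_of_mem hx]; exact proj_mem_top_mul_U (hle hx) n
  cases n with
  | zero =>
    have h2 : V a b c 0 = ⊥ := le_bot_iff.1 h1
    have := finrank_V_zero (k := k) (a := a) (b := b) (c := c)
    rw [h2, finrank_bot] at this
    omega
  | succ n =>
    have := (h.finrank_aux hN n).1
    have h2 : FiniteDimensional k (V a b c n * U a b c p : Submodule k (Sklyanin k a b c)) :=
      Submodule.finiteDimensional_of_le (S₂ := V a b c (n + 1))
        (by rw [V_succ]; exact mul_le_mul' le_rfl (U_le_V1 p))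
    have h3 : finrank k (V a b c (n + 1)) ≤
      finrank k (V a b c n * U a b c p : Submodule k (Sklyanin k a b c)) :=
      Submodule.finrank_mono h1
    omega

lemma PtRel.exists_mul_notMem (hN : Nondeg a b c) {p p' u v u' w : Fin 3 → k}
    (h : PtRel a b c p p' u v u' w) {d : ℕ} {m : Sklyanin k a b c} (hm : m ∈ V a b c d)
    (hmp : m ∉ (⊤ : Submodule k (Sklyanin k a b c)) * U a b c p) (n : ℕ) :
    ∃ x ∈ V a b c n, x * m ∉ (⊤ : Submodule k (Sklyanin k a b c)) * U a b c p := by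
  by_contra hcon
  push Not at hcon
  refine h.not_le hN (n + d) ?_
  rw [show V a b c (n + d) = V a b c n * V a b c d from pow_add _ _ _, Submodule.mul_le]
  intro x hx y hy
  obtain ⟨l, hl, z, hz, rfl⟩ :=
    Submodule.mem_sup.1 (V_le_leftPart_sup hN h.hp h.hE hm hmp hy)
  obtain ⟨r, rfl⟩ := Submodule.mem_span_singleton.1 hz
  rw [mul_add, mul_smul_comm]
  exact add_mem (mul_mem_top_mul (leftPart_le_top_mul _ hl) _)
    (Submodule.smul_mem _ _ (hcon x hx))

/-- The left ideal generated by a linear form. -/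
def lineIdeal (a b c : k) (u : Fin 3 → k) : Submodule k (Sklyanin k a b c) :=
  LinearMap.range (LinearMap.mulRight k (lin a b c u))

omit [IsAlgClosed k] in
lemma mem_lineIdeal {u : Fin 3 → k} {x : Sklyanin k a b c} :
    x ∈ lineIdeal a b c u ↔ ∃ t, t * lin a b c u = x := Iff.rfl

/-- The map `x ↦ x m` to the line module. -/
def lineMap (a b c : k) (u : Fin 3 → k) (m : Sklyanin k a b c) :
    Sklyanin k a b c →ₗ[k] Sklyanin k a b c ⧸ lineIdeal a b c u :=
  (lineIdeal a b c u).mkQ ∘ₗ LinearMap.mulRight k m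

omit [IsAlgClosed k] in
lemma lineMap_eq_zero {u : Fin 3 → k} {m x : Sklyanin k a b c} :
    lineMap a b c u m x = 0 ↔ x * m ∈ lineIdeal a b c u := by
  simp [lineMap]

omit [IsAlgClosed k] in
lemma finrank_map_eq_of_ker_eq {A B C : Type*} [AddCommGroup A] [Module k A] [AddCommGroup B]
    [Module k B] [AddCommGroup C] [Module k C] (f : A →ₗ[k] B) (g : A →ₗ[k] C)
    (hfg : LinearMap.ker f = LinearMap.ker g) (P : Submodule k A) [FiniteDimensional k P] :
    finrank k (P.map f) = finrank k (P.map g) := by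
  have h1 := finrank_map_add_inf_ker f P
  have h2 := finrank_map_add_inf_ker g P
  rw [hfg] at h1
  omega

lemma line_pure_step (hN : Nondeg a b c) {p p' u v u' w : Fin 3 → k}
    (h : PtRel a b c p p' u v u' w) {d : ℕ} {m : Sklyanin k a b c} (hm : m ∈ V a b c d)
    (hmp : m ∉ (⊤ : Submodule k (Sklyanin k a b c)) * U a b c p) :
    ∃ y : Fin 3 → k, lin a b c y * m ∈ (⊤ : Submodule k (Sklyanin k a b c)) * U a b c p ∧
      lin a b c y * m ∉ lineIdeal a b c u := by
  obtain ⟨q, hq, hEq, hle⟩ := U_mul_V_le hN d h.hp h.hE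
  obtain ⟨uq, huq, huqq⟩ := exists_perp_one (p := q)
  obtain ⟨q', vq, uq', wq, hr⟩ := exists_ptRel hN hq hEq huq huqq
  have hle' : V a b c d * U a b c p ≤ (⊤ : Submodule k (Sklyanin k a b c)) * U a b c p :=
    mul_le_mul' le_top le_rfl
  have hmem : ∀ y : Fin 3 → k, y ⬝ᵥ q = 0 →
      lin a b c y * m ∈ (⊤ : Submodule k (Sklyanin k a b c)) * U a b c p := fun y hy =>
    hle' (hle (Submodule.mul_mem_mul (mem_U.2 ⟨y, hy, rfl⟩) hm))
  by_contra hcon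
  push Not at hcon
  obtain ⟨s, hs⟩ := mem_lineIdeal.1 (hcon vq (hmem vq hr.hvp))
  obtain ⟨t, ht⟩ := mem_lineIdeal.1 (hcon uq (hmem uq hr.hup))
  have h1 : lin a b c uq' * s + lin a b c wq * t = 0 := by
    refine mul_lin_injective hN h.hu ?_
    rw [add_mul, mul_assoc, mul_assoc, hs, ht, ← mul_assoc, ← mul_assoc, ← add_mul, hr.rel,
      zero_mul]
  obtain ⟨r, rfl, -⟩ := hr.exact_left hN h1
  have h2 : m = r * lin a b c u := by
    rw [← sub_eq_zero]
    refine lin_mul_injective hN hr.hv ?_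
    rw [mul_sub, ← mul_assoc, hs, sub_self]
  rw [h2] at hmp
  exact hmp (h.mem_top_mul_U.2 ⟨0, r, by simp⟩)

lemma PtRel.mul_mem_lineIdeal (hN : Nondeg a b c) {p p' u v u' w : Fin 3 → k}
    (h : PtRel a b c p p' u v u' w) (s t : Sklyanin k a b c) :
    s * lin a b c v + t * lin a b c u ∈ lineIdeal a b c u ↔ s ∈ lineIdeal a b c u' := by
  constructor
  · intro hx
    obtain ⟨z, hz⟩ := mem_lineIdeal.1 hx
    obtain ⟨r, hr, -⟩ := h.exact hN (s := s) (t := t - z) (by rw [sub_mul, hz]; abel)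
    exact ⟨r, hr.symm⟩
  · intro hx
    obtain ⟨r, rfl⟩ := mem_lineIdeal.1 hx
    refine ⟨t - r * lin a b c w, ?_⟩
    have := congrArg (r * ·) h.rel
    simp only [mul_add, mul_zero, ← mul_assoc] at this
    rw [LinearMap.mulRight_apply, sub_mul, eq_neg_of_add_eq_zero_left this]
    abel

/-- Line modules have no nonzero submodules of bounded growth. -/
theorem line_pure (hN : Nondeg a b c) (r : ℕ) : ∀ (n0 d : ℕ) {u : Fin 3 → k}
    {m : Sklyanin k a b c}, u ≠ 0 → m ∈ V a b c d →
    (∀ n, n0 ≤ n → finrank k ((V a b c n).map (lineMap a b c u m)) < r) →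
    m ∈ lineIdeal a b c u := by
  induction r with
  | zero => intro n0 d u m hu hm hr; exact absurd (hr n0 le_rfl) (Nat.not_lt_zero _)
  | succ r ihr =>
    intro n0 d
    induction d with
    | zero =>
      intro u m hu hm hr
      obtain ⟨p, hp, hup, hE⟩ := exists_zero_on_line a b c hu
      obtain ⟨p', v, u', w, h⟩ := exists_ptRel hN hp hE hu hup
      by_cases hmp : m ∈ (⊤ : Submodule k (Sklyanin k a b c)) * U a b c p
      · have : m = 0 := by
          rw [← proj_of_mem hm]; exact proj_mem_top_mul_U hmp 0
        rw [this]; exact zero_mem _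
      · exact step ihr hN hu h hm hmp hr
    | succ d ihd =>
      intro u m hu hm hr
      obtain ⟨p, hp, hup, hE⟩ := exists_zero_on_line a b c hu
      obtain ⟨p', v, u', w, h⟩ := exists_ptRel hN hp hE hu hup
      by_cases hmp : m ∈ (⊤ : Submodule k (Sklyanin k a b c)) * U a b c p
      · obtain ⟨s, t, hst⟩ := h.mem_top_mul_U.1 hmp
        have hm' : m = proj d s * lin a b c v + proj d t * lin a b c u := by
          rw [← proj_mul_lin, ← proj_mul_lin, ← map_add, ← hst, proj_of_mem hm]
        have hker : LinearMap.ker (lineMap a b c u m) =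
            LinearMap.ker (lineMap a b c u' (proj d s)) := by
          ext x
          rw [LinearMap.mem_ker, LinearMap.mem_ker, lineMap_eq_zero, lineMap_eq_zero, hm',
            mul_add, ← mul_assoc, ← mul_assoc, h.mul_mem_lineIdeal hN]
        rw [hm', h.mul_mem_lineIdeal hN]
        refine ihd h.hu' (proj_mem _ _) fun n hn => ?_
        rw [← finrank_map_eq_of_ker_eq _ _ hker]
        exact hr n hn
      · exact step ihr hN hu h hm hmp hr
where
  step {r n0 d : ℕ} (ihr : ∀ (n0 d : ℕ) {u : Fin 3 → k} {m : Sklyanin k a b c}, u ≠ 0 →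
      m ∈ V a b c d → (∀ n, n0 ≤ n → finrank k ((V a b c n).map (lineMap a b c u m)) < r) →
      m ∈ lineIdeal a b c u) (hN : Nondeg a b c) {p p' u v u' w : Fin 3 → k}
      {m : Sklyanin k a b c} (hu : u ≠ 0) (h : PtRel a b c p p' u v u' w) (hm : m ∈ V a b c d)
      (hmp : m ∉ (⊤ : Submodule k (Sklyanin k a b c)) * U a b c p)
      (hr : ∀ n, n0 ≤ n → finrank k ((V a b c n).map (lineMap a b c u m)) < r + 1) :
      m ∈ lineIdeal a b c u := by
    obtain ⟨y, hy1, hy2⟩ := line_pure_step hN h hm hmp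
    refine absurd (ihr n0 (d + 1) hu ?_ fun n hn => ?_) hy2
    · show _ ∈ V1 a b c ^ (d + 1)
      rw [pow_succ']
      exact Submodule.mul_mem_mul (lin_mem y) hm
    refine lt_of_lt_of_le ?_ (Nat.lt_succ_iff.1 (hr (n + 1) (by omega)))
    apply Submodule.finrank_lt_finrank_of_lt
    refine lt_of_le_of_ne ?_ ?_
    · rintro _ ⟨x, hx, rfl⟩
      exact ⟨x * lin a b c y, mul_lin_mem hx y, by simp [lineMap, mul_assoc]⟩
    · intro heq
      obtain ⟨x, hx, hxm⟩ := h.exists_mul_notMem hN hm hmp (n + 1)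
      have : lineMap a b c u m x ∈ (V a b c n).map (lineMap a b c u (lin a b c y * m)) := by
        rw [heq]; exact ⟨x, hx, rfl⟩
      obtain ⟨x', -, hx'⟩ := this
      rw [lineMap, lineMap, LinearMap.comp_apply, LinearMap.comp_apply, Submodule.mkQ_apply,
        Submodule.mkQ_apply, Submodule.Quotient.eq] at hx'
      obtain ⟨t, ht⟩ := hx'
      refine hxm ?_
      have h1 : x * m = x' * (lin a b c y * m) - t * lin a b c u := by
        simp only [LinearMap.mulRight_apply] at ht
        rw [ht]; abel
      rw [h1]
      exact sub_mem (mul_mem_top_mul hy1 _) (h.mem_top_mul_U.2 ⟨0, t, by simp⟩)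

end Lines

end SklAz

namespace SklAz

open Module Matrix

section Center

variable {k A : Type*} [Field k] [Ring A] [Algebra k A]

/-- An algebra as an algebra over its center. -/
abbrev centerAlgebra (k A : Type*) [Field k] [Ring A] [Algebra k A] :
    Algebra (Subalgebra.center k A) A :=
  Algebra.ofModule' (fun r x => by simp [Subalgebra.smul_def])
    (fun r x => by
      simpa [Subalgebra.smul_def] using ((Subalgebra.mem_center_iff.1 r.2) x))

lemma center_comm (z : Subalgebra.center k A) (s : A) : s * (z : A) = z * s :=
  Subalgebra.mem_center_iff.1 z.2 s

/-- The center of an affine algebra that is finite over its center is affine. -/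
theorem center_finiteType (hA : (⊤ : Subalgebra k A).FG)
    (hfin : Module.Finite (Subalgebra.center k A) A) :
    Algebra.FiniteType k (Subalgebra.center k A) := by
  let _ := centerAlgebra k A
  have : IsScalarTower k (Subalgebra.center k A) A := inferInstance
  obtain ⟨B₀, hB, hBA⟩ := exists_subalgebra_of_fg k (Subalgebra.center k A) A hA hfin.1
  refine ⟨Algebra.fg_trans' (B₀.fg_top.2 hB) ?_⟩
  refine Subalgebra.fg_of_submodule_fg ?_
  have : IsNoetherianRing B₀ := isNoetherianRing_of_fg hB
  have : Module.Finite B₀ A := ⟨hBA⟩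
  exact _root_.fg_of_injective
    (IsScalarTower.toAlgHom B₀ (Subalgebra.center k A) A).toLinearMap
    (fun x y h => Subtype.ext (by
      have h' : (x : A) * 1 = (y : A) * 1 := h
      simpa using h'))

end Center

section

variable {k : Type*} [Field k] {a b c : k}

lemma sklyanin_top_fg : (⊤ : Subalgebra k (Sklyanin k a b c)).FG := by
  classical
  refine ⟨Finset.univ.image gen, ?_⟩
  rw [eq_top_iff]
  intro s _
  induction s using gen_induction with
  | halg r => exact Subalgebra.algebraMap_mem _ r
  | hgen i => exact Algebra.subset_adjoin (by simp)
  | hadd x y hx hy => exact add_mem (hx trivial) (hy trivial)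
  | hmul x y hx hy => exact mul_mem (hx trivial) (hy trivial)

/-- The center of the Sklyanin algebra. -/
abbrev Ctr (k : Type*) [Field k] (a b c : k) := Subalgebra.center k (Sklyanin k a b c)

lemma ctr_noetherian (hfin : Module.Finite (Ctr k a b c) (Sklyanin k a b c)) :
    IsNoetherianRing (Ctr k a b c) :=
  have := center_finiteType sklyanin_top_fg hfin
  Algebra.FiniteType.isNoetherianRing k _

end

end SklAz

namespace SklAz

open Module Matrix

section Homotopy

variable {k : Type*} [Field k] {a b c : k}

lemma exists_eq_algebraMap_add (s : Sklyanin k a b c) :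
    ∃ (r : k) (w : Fin 3 → Sklyanin k a b c), s = algebraMap k _ r + kos2 (lgen a b c) w := by
  induction s using gen_induction with
  | halg r => exact ⟨r, 0, by simp⟩
  | hgen i => exact ⟨0, Pi.single i 1, by simp [kos2_apply, Pi.single_apply]⟩
  | hadd x y hx hy =>
    obtain ⟨r, w, rfl⟩ := hx
    obtain ⟨r', w', rfl⟩ := hy
    exact ⟨r + r', w + w', by simp only [map_add]; abel⟩
  | hmul x y hx hy =>
    obtain ⟨r, w, rfl⟩ := hx
    obtain ⟨r', w', rfl⟩ := hy
    refine ⟨r * r', r • w' + fun l => w l * (algebraMap k _ r' + kos2 (lgen a b c) w'), ?_⟩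
    have h1 : kos2 (lgen a b c) (fun l => w l * (algebraMap k _ r' + kos2 (lgen a b c) w'))
        = kos2 (lgen a b c) w * (algebraMap k _ r' + kos2 (lgen a b c) w') := by
      simp [kos2_apply, Finset.sum_mul, mul_assoc]
    rw [map_add, h1, map_smul, Algebra.smul_def, map_mul, add_mul, mul_add]
    abel

lemma proj_zero_kos2_lgen (w : Fin 3 → Sklyanin k a b c) : proj 0 (kos2 (lgen a b c) w) = 0 := by
  simp [kos2_apply, proj_zero_gen_mul]

lemma proj_zero_algebraMap (r : k) :
    proj 0 (algebraMap k (Sklyanin k a b c) r) = algebraMap k _ r := by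
  refine proj_of_mem ?_
  exact SetLike.algebraMap_mem_graded (V a b c) r

lemma exists_proj_zero_eq (s : Sklyanin k a b c) : ∃ r : k, proj 0 s = algebraMap k _ r := by
  obtain ⟨r, w, rfl⟩ := exists_eq_algebraMap_add s
  exact ⟨r, by rw [map_add, proj_zero_algebraMap, proj_zero_kos2_lgen, add_zero]⟩

lemma exists_kos2_eq {s : Sklyanin k a b c} (hs : proj 0 s = 0) :
    ∃ w, kos2 (lgen a b c) w = s := by
  obtain ⟨r, w, rfl⟩ := exists_eq_algebraMap_add s
  rw [map_add, proj_zero_algebraMap, proj_zero_kos2_lgen, add_zero] at hs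
  exact ⟨w, by rw [hs, zero_add]⟩

lemma kos2_lgen_mul (w : Fin 3 → Sklyanin k a b c) (m : Sklyanin k a b c) :
    kos2 (lgen a b c) (fun l => w l * m) = kos2 (lgen a b c) w * m := by
  simp [kos2_apply, Finset.sum_mul, mul_assoc]

lemma kos1_lgen_mul (w : Fin 3 → Sklyanin k a b c) (m : Sklyanin k a b c) :
    kos1 a b c (lgen a b c) (fun l => w l * m) = fun l => kos1 a b c (lgen a b c) w l * m := by
  funext l
  simp [kos1_apply, add_mul, mul_assoc]

lemma kos2_lgen_kos1 (f : Fin 3 → Sklyanin k a b c) :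
    kos2 (lgen a b c) (kos1 a b c (lgen a b c) f) = 0 := by
  have h0 := congrArg (· * f 0) (isSkl_gen (a := a) (b := b) (c := c) 0)
  have h1 := congrArg (· * f 1) (isSkl_gen (a := a) (b := b) (c := c) 1)
  have h2 := congrArg (· * f 2) (isSkl_gen (a := a) (b := b) (c := c) 2)
  obtain ⟨e1, e2, e3, e4, e5, e6⟩ := fin3_add
  simp only [kos2_apply, kos1_apply, lgen_apply, Fin.sum_univ_three, e1, e2, e3, e4, e5, e6,
    mul_add, add_mul, mul_smul_comm, smul_mul_assoc, zero_mul, ← mul_assoc] at *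
  rw [← add_zero (0 : Sklyanin k a b c), ← add_zero ((0 : Sklyanin k a b c) + 0)]
  nth_rewrite 1 [← h0]
  nth_rewrite 1 [← h1]
  nth_rewrite 1 [← h2]
  abel

lemma kos1_lgen_kos0 (s : Sklyanin k a b c) :
    kos1 a b c (lgen a b c) (kos0 (lgen a b c) s) = 0 := by
  funext l
  simp only [kos1_apply, kos0_apply, lgen_apply, Pi.zero_apply, ← mul_assoc]
  have := congrArg (· * s) (isSkl_gen (a := a) (b := b) (c := c) l)
  simp only [add_mul, zero_mul, smul_mul_assoc] at this
  rw [← this]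

/-- A central element of positive degree acts as zero on Koszul homology: explicit
contracting homotopies. -/
theorem exists_homotopy [IsAlgClosed k] (hN : Nondeg a b c) {z : Sklyanin k a b c}
    (hz : ∀ s, s * z = z * s) (hz0 : proj 0 z = 0) :
    ∃ (w : Fin 3 → Sklyanin k a b c) (h : Fin 3 → Fin 3 → Sklyanin k a b c)
      (t : Fin 3 → Sklyanin k a b c),
      (∀ m, kos2 (lgen a b c) (fun l => w l * m) = z * m) ∧
      (∀ g, kos2 (lgen a b c) g = 0 →
        kos1 a b c (lgen a b c) (fun l => ∑ j, h j l * g j) = fun l => z * g l) ∧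
      (∀ g, kos1 a b c (lgen a b c) g = 0 →
        kos0 (lgen a b c) (∑ j, t j * g j) = fun l => z * g l) := by
  have hK := kosExact_lgen hN
  obtain ⟨w, hw⟩ := exists_kos2_eq hz0
  have hw' : ∀ m, kos2 (lgen a b c) (fun l => w l * m) = z * m := fun m => by
    rw [kos2_lgen_mul, hw]
  have hsingle : ∀ j, kos2 (lgen a b c) (Pi.single j z) = gen j * z := fun j => by
    simp [kos2_apply, Pi.single_apply]
  have h1 : ∀ j, ∃ h, kos1 a b c (lgen a b c) h = Pi.single j z - fun l => w l * gen j := fun j =>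
    hK.ex2 _ (by rw [map_sub, hsingle, hw', hz, sub_self])
  choose h hh using h1
  have hh' : ∀ g, kos1 a b c (lgen a b c) (fun l => ∑ j, h j l * g j) =
      (fun l => z * g l) - fun l => w l * kos2 (lgen a b c) g := fun g => by
    have e1 : (fun l => ∑ j, h j l * g j) = ∑ j, fun l => h j l * g j := by
      funext l; simp
    rw [e1, map_sum]
    simp only [kos1_lgen_mul, hh]
    funext l
    simp [kos2_apply, Finset.sum_apply, sub_mul, Finset.mul_sum, Pi.single_apply, mul_assoc]
  have hz1 : ∀ g, kos1 a b c (lgen a b c) (fun l => z * g l) =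
      fun l => z * kos1 a b c (lgen a b c) g l := fun g => by
    funext l
    simp only [kos1_apply, lgen_apply, mul_add, mul_smul_comm, ← mul_assoc, hz]
  have h2 : ∀ j, ∃ t, kos0 (lgen a b c) t = (fun l => z * (Pi.single j 1 : Fin 3 → _) l) -
      fun l => ∑ i, h i l * kos1 a b c (lgen a b c) (Pi.single j 1) i := fun j =>
    hK.ex1 _ (by rw [map_sub, hz1, hh', kos2_lgen_kos1]; simp; rfl)
  choose t ht using h2
  refine ⟨w, h, t, hw', fun g hg => ?_, fun g hg => ?_⟩
  · rw [hh', hg]; simp; rfl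
  · have e2 : ∀ j m, kos0 (lgen a b c) (t j * m) = fun l => kos0 (lgen a b c) (t j) l * m :=
      fun j m => by funext l; simp [kos0_apply, mul_assoc]
    rw [map_sum]
    simp only [e2, ht]
    funext l
    have e3 : g = ∑ j, fun l => (Pi.single j 1 : Fin 3 → Sklyanin k a b c) l * g j := by
      funext l; simp [Pi.single_apply]
    have e4 : ∀ i, ∑ j, kos1 a b c (lgen a b c) (Pi.single j 1) i * g j = 0 := fun i => by
      have := congrFun hg i
      rw [e3, map_sum] at this
      simp only [kos1_lgen_mul, Finset.sum_apply] at this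
      exact this
    simp only [Finset.sum_apply, Pi.sub_apply, sub_mul, Finset.sum_sub_distrib]
    have e5 : ∑ j, (∑ i, h i l * kos1 a b c (lgen a b c) (Pi.single j 1) i) * g j = 0 := by
      simp only [Finset.sum_mul, mul_assoc]
      rw [Finset.sum_comm]
      refine Finset.sum_eq_zero fun i _ => ?_
      rw [← Finset.mul_sum, e4, mul_zero]
    rw [e5, sub_zero]
    simp [Pi.single_apply]

/-- Submodules differing by modules killed by the augmentation ideal agree in large degrees. -/
lemma exists_degree_bound {M : Type*} [AddCommGroup M] [Module k M] [Module (Ctr k a b c) M]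
    [IsScalarTower k (Ctr k a b c) M] (P : ℕ → M →ₗ[k] M)
    (hP : ∀ m, ∃ N, ∀ n, N ≤ n → P n m = 0) (C B : Submodule (Ctr k a b c) M) (hC : C.FG)
    (hB : ∀ n, ∀ x ∈ B, P n x ∈ B)
    (hCB : ∀ z : Ctr k a b c, proj 0 (z : Sklyanin k a b c) = 0 → ∀ x ∈ C, z • x ∈ B) :
    ∃ N, ∀ n, N ≤ n → ∀ x ∈ C, P n x ∈ B := by
  obtain ⟨s, rfl⟩ := hC
  choose f hf using hP
  refine ⟨s.sup f, fun n hn x hx => ?_⟩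
  induction hx using Submodule.span_induction with
  | mem x hx =>
    rw [hf x n ((Finset.le_sup hx).trans hn)]
    exact zero_mem _
  | zero => rw [map_zero]; exact zero_mem _
  | add x y _ _ hx hy => rw [map_add]; exact add_mem hx hy
  | smul z x hx ih =>
    obtain ⟨r, hr⟩ := exists_proj_zero_eq (z : Sklyanin k a b c)
    have hz : z = algebraMap k _ r + (z - algebraMap k _ r) := by abel
    rw [hz, add_smul, map_add, algebraMap_smul, map_smul]
    refine add_mem ?_ (hB n _ (hCB _ ?_ x hx))
    · rw [← algebraMap_smul (Ctr k a b c) r]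
      exact Submodule.smul_mem _ _ ih
    · rw [AddSubgroupClass.coe_sub, map_sub, hr, Subalgebra.coe_algebraMap,
        proj_zero_algebraMap, sub_self]

end Homotopy

end SklAz

namespace SklAz

open Module Matrix

section Hilbert

variable {k : Type*} [Field k] {a b c : k}

/-- Graded left ideals. -/
structure IsGrLeft (I : Submodule k (Sklyanin k a b c)) : Prop where
  mul : ∀ s x, x ∈ I → s * x ∈ I
  grade : ∀ n x, x ∈ I → proj n x ∈ I

lemma ctr_smul (z : Ctr k a b c) (s : Sklyanin k a b c) : z • s = (z : Sklyanin k a b c) * s := rfl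

lemma kos0_lgen_smul (z : Ctr k a b c) (s : Sklyanin k a b c) :
    kos0 (lgen a b c) (z • s) = z • kos0 (lgen a b c) s := by
  funext l
  simp only [kos0_apply, Pi.smul_apply, ctr_smul, lgen_apply, ← mul_assoc, center_comm]

lemma kos1_lgen_smul (z : Ctr k a b c) (g : Fin 3 → Sklyanin k a b c) :
    kos1 a b c (lgen a b c) (z • g) = z • kos1 a b c (lgen a b c) g := by
  funext l
  simp only [kos1_apply, Pi.smul_apply, ctr_smul, lgen_apply, mul_add, mul_smul_comm,
    ← mul_assoc, center_comm]

lemma kos2_lgen_smul (z : Ctr k a b c) (g : Fin 3 → Sklyanin k a b c) :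
    kos2 (lgen a b c) (z • g) = z • kos2 (lgen a b c) g := by
  simp only [kos2_apply, Pi.smul_apply, ctr_smul, lgen_apply, Finset.mul_sum,
    ← mul_assoc, center_comm]

lemma IsGrLeft.kos1_mem {I : Submodule k (Sklyanin k a b c)} (hI : IsGrLeft I)
    {g : Fin 3 → Sklyanin k a b c} (hg : ∀ l, g l ∈ I) (l : Fin 3) :
    kos1 a b c (lgen a b c) g l ∈ I :=
  add_mem (add_mem (I.smul_mem _ (hI.mul _ _ (hg _))) (I.smul_mem _ (hI.mul _ _ (hg _))))
    (I.smul_mem _ (hI.mul _ _ (hg _)))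

lemma IsGrLeft.kos2_mem {I : Submodule k (Sklyanin k a b c)} (hI : IsGrLeft I)
    {g : Fin 3 → Sklyanin k a b c} (hg : ∀ l, g l ∈ I) : kos2 (lgen a b c) g ∈ I := by
  rw [kos2_apply]
  exact sum_mem fun l _ => hI.mul _ _ (hg _)

lemma proj_kos0_lgen (m : Sklyanin k a b c) (n : ℕ) (l : Fin 3) :
    proj (n + 1) (kos0 (lgen a b c) m l) = kos0 (lgen a b c) (proj n m) l := by
  simp [kos0_apply, proj_gen_mul]

lemma proj_kos1_lgen (f : Fin 3 → Sklyanin k a b c) (n : ℕ) (l : Fin 3) :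
    proj (n + 1) (kos1 a b c (lgen a b c) f l) =
      kos1 a b c (lgen a b c) (fun j => proj n (f j)) l := by
  simp [kos1_apply, proj_gen_mul]

lemma proj_kos2_lgen (f : Fin 3 → Sklyanin k a b c) (n : ℕ) :
    proj (n + 1) (kos2 (lgen a b c) f) = kos2 (lgen a b c) (fun j => proj n (f j)) := by
  simp [kos2_apply, proj_gen_mul]

lemma exists_proj_bound_three (g : Fin 3 → Sklyanin k a b c) :
    ∃ N, ∀ n, N ≤ n → (proj n).compLeft (Fin 3) g = 0 := by
  choose f hf using fun l => exists_proj_bound (g l)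
  refine ⟨Finset.univ.sup f, fun n hn => funext fun l => ?_⟩
  exact hf l n ((Finset.le_sup (Finset.mem_univ l)).trans hn)

variable [IsAlgClosed k]

lemma IsGrLeft.exists_bound_zero (hN : Nondeg a b c)
    [IsNoetherian (Ctr k a b c) (Sklyanin k a b c)]
    {I : Submodule k (Sklyanin k a b c)} (hI : IsGrLeft I) :
    ∃ N, ∀ n, N ≤ n → ∀ g : Fin 3 → Sklyanin k a b c, (∀ l, g l ∈ I) →
      kos1 a b c (lgen a b c) g = 0 →
      ∃ m ∈ I, kos0 (lgen a b c) m = (proj n).compLeft (Fin 3) g := by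
  let C : Submodule (Ctr k a b c) (Fin 3 → Sklyanin k a b c) :=
    { carrier := {g | (∀ l, g l ∈ I) ∧ kos1 a b c (lgen a b c) g = 0}
      zero_mem' := ⟨fun l => zero_mem _, map_zero _⟩
      add_mem' := fun hx hy => ⟨fun l => add_mem (hx.1 l) (hy.1 l), by
        rw [map_add, hx.2, hy.2, add_zero]⟩
      smul_mem' := fun z x hx => ⟨fun l => hI.mul _ _ (hx.1 l), by
        rw [kos1_lgen_smul, hx.2, smul_zero]⟩ }
  let B : Submodule (Ctr k a b c) (Fin 3 → Sklyanin k a b c) :=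
    { carrier := {g | ∃ m ∈ I, kos0 (lgen a b c) m = g}
      zero_mem' := ⟨0, zero_mem _, map_zero _⟩
      add_mem' := by
        rintro _ _ ⟨x, hx, rfl⟩ ⟨y, hy, rfl⟩
        exact ⟨x + y, add_mem hx hy, map_add _ _ _⟩
      smul_mem' := by
        rintro z _ ⟨x, hx, rfl⟩
        exact ⟨z • x, hI.mul _ _ hx, kos0_lgen_smul _ _⟩ }
  obtain ⟨N, hb⟩ := exists_degree_bound (fun n => (proj n).compLeft (Fin 3))
    exists_proj_bound_three C B (IsNoetherian.noetherian C) (by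
      rintro n _ ⟨m, hm, rfl⟩
      rcases n with _ | n
      · refine ⟨0, zero_mem _, ?_⟩
        funext l
        simp [kos0_apply, proj_zero_gen_mul]
      · exact ⟨proj n m, hI.grade _ _ hm, funext fun l => (proj_kos0_lgen _ _ _).symm⟩) (by
      rintro z hz g ⟨hg, hg0⟩
      obtain ⟨w, h, t, -, -, ht⟩ := exists_homotopy hN (center_comm z) hz
      exact ⟨∑ j, t j * g j, sum_mem fun j _ => hI.mul _ _ (hg j), ht g hg0⟩)
  exact ⟨N, fun n hn g hg hg0 => hb n hn g ⟨hg, hg0⟩⟩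

lemma IsGrLeft.exists_bound_one (hN : Nondeg a b c)
    [IsNoetherian (Ctr k a b c) (Sklyanin k a b c)]
    {I : Submodule k (Sklyanin k a b c)} (hI : IsGrLeft I) :
    ∃ N, ∀ n, N ≤ n → ∀ g : Fin 3 → Sklyanin k a b c, (∀ l, g l ∈ I) →
      kos2 (lgen a b c) g = 0 →
      ∃ h, (∀ l, h l ∈ I) ∧ kos1 a b c (lgen a b c) h = (proj n).compLeft (Fin 3) g := by
  let C : Submodule (Ctr k a b c) (Fin 3 → Sklyanin k a b c) :=
    { carrier := {g | (∀ l, g l ∈ I) ∧ kos2 (lgen a b c) g = 0}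
      zero_mem' := ⟨fun l => zero_mem _, map_zero _⟩
      add_mem' := fun hx hy => ⟨fun l => add_mem (hx.1 l) (hy.1 l), by
        rw [map_add, hx.2, hy.2, add_zero]⟩
      smul_mem' := fun z x hx => ⟨fun l => hI.mul _ _ (hx.1 l), by
        rw [kos2_lgen_smul, hx.2, smul_zero]⟩ }
  let B : Submodule (Ctr k a b c) (Fin 3 → Sklyanin k a b c) :=
    { carrier := {g | ∃ h, (∀ l, h l ∈ I) ∧ kos1 a b c (lgen a b c) h = g}
      zero_mem' := ⟨0, fun _ => zero_mem _, map_zero _⟩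
      add_mem' := by
        rintro _ _ ⟨x, hx, rfl⟩ ⟨y, hy, rfl⟩
        exact ⟨x + y, fun l => add_mem (hx l) (hy l), map_add _ _ _⟩
      smul_mem' := by
        rintro z _ ⟨x, hx, rfl⟩
        exact ⟨z • x, fun l => hI.mul _ _ (hx l), kos1_lgen_smul _ _⟩ }
  obtain ⟨N, hb⟩ := exists_degree_bound (fun n => (proj n).compLeft (Fin 3))
    exists_proj_bound_three C B (IsNoetherian.noetherian C) (by
      rintro n _ ⟨m, hm, rfl⟩
      rcases n with _ | n
      · refine ⟨0, fun _ => zero_mem _, ?_⟩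
        funext l
        simp [kos1_apply, proj_zero_gen_mul]
      · exact ⟨fun l => proj n (m l), fun l => hI.grade _ _ (hm l),
          funext fun l => (proj_kos1_lgen _ _ _).symm⟩) (by
      rintro z hz g ⟨hg, hg0⟩
      obtain ⟨w, h, t, -, hh, -⟩ := exists_homotopy hN (center_comm z) hz
      exact ⟨_, fun l => sum_mem fun j _ => hI.mul _ _ (hg j), hh g hg0⟩)
  exact ⟨N, fun n hn g hg hg0 => hb n hn g ⟨hg, hg0⟩⟩

lemma IsGrLeft.exists_bound_two (hN : Nondeg a b c)
    [IsNoetherian (Ctr k a b c) (Sklyanin k a b c)]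
    {I : Submodule k (Sklyanin k a b c)} (hI : IsGrLeft I) :
    ∃ N, ∀ n, N ≤ n → ∀ m ∈ I,
      ∃ h, (∀ l, h l ∈ I) ∧ kos2 (lgen a b c) h = proj n m := by
  let C : Submodule (Ctr k a b c) (Sklyanin k a b c) :=
    { carrier := I
      zero_mem' := zero_mem _
      add_mem' := fun hx hy => add_mem hx hy
      smul_mem' := fun z x hx => hI.mul _ _ hx }
  let B : Submodule (Ctr k a b c) (Sklyanin k a b c) :=
    { carrier := {g | ∃ h, (∀ l, h l ∈ I) ∧ kos2 (lgen a b c) h = g}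
      zero_mem' := ⟨0, fun _ => zero_mem _, map_zero _⟩
      add_mem' := by
        rintro _ _ ⟨x, hx, rfl⟩ ⟨y, hy, rfl⟩
        exact ⟨x + y, fun l => add_mem (hx l) (hy l), map_add _ _ _⟩
      smul_mem' := by
        rintro z _ ⟨x, hx, rfl⟩
        exact ⟨z • x, fun l => hI.mul _ _ (hx l), kos2_lgen_smul _ _⟩ }
  obtain ⟨N, hb⟩ := exists_degree_bound (fun n => proj n)
    exists_proj_bound C B (IsNoetherian.noetherian C) (by
      rintro n _ ⟨m, hm, rfl⟩
      rcases n with _ | n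
      · refine ⟨0, fun _ => zero_mem _, ?_⟩
        simp [kos2_apply, proj_zero_gen_mul]
      · exact ⟨fun l => proj n (m l), fun l => hI.grade _ _ (hm l), (proj_kos2_lgen _ _).symm⟩) (by
      rintro z hz m hm
      obtain ⟨w, h, t, hw, -, -⟩ := exists_homotopy hN (center_comm z) hz
      exact ⟨_, fun l => hI.mul _ _ hm, hw m⟩)
  exact ⟨N, hb⟩

/-- The Hilbert function of a graded left ideal. -/
def hilb (I : Submodule k (Sklyanin k a b c)) (n : ℕ) : ℕ :=
  finrank k (I ⊓ V a b c n : Submodule k _)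

/-- The Hilbert function of a graded left ideal is eventually quadratic. -/
theorem IsGrLeft.hilb_rec (hN : Nondeg a b c)
    [IsNoetherian (Ctr k a b c) (Sklyanin k a b c)]
    {I : Submodule k (Sklyanin k a b c)} (hI : IsGrLeft I) :
    ∃ N, ∀ n, N ≤ n →
      hilb I (n + 3) + 3 * hilb I (n + 1) = 3 * hilb I (n + 2) + hilb I n := by
  obtain ⟨N0, h0⟩ := hI.exists_bound_zero hN
  obtain ⟨N1, h1⟩ := hI.exists_bound_one hN
  obtain ⟨N2, h2⟩ := hI.exists_bound_two hN
  refine ⟨N0 + N1 + N2, fun n hn => ?_⟩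
  let T : ℕ → Submodule k (Fin 3 → Sklyanin k a b c) := fun j =>
    Submodule.pi Set.univ fun _ => I ⊓ V a b c j
  have hT : ∀ j, finrank k (T j) = 3 * hilb I j := fun j => finrank_pi_three _
  have hproj : ∀ {j : ℕ} {g : Fin 3 → Sklyanin k a b c}, g ∈ T j →
      (proj j).compLeft (Fin 3) g = g := fun hg => funext fun l => proj_of_mem (hg l trivial).2
  have e0 : (I ⊓ V a b c n).map (kos0 (lgen a b c)) =
      T (n + 1) ⊓ LinearMap.ker (kos1 a b c (lgen a b c)) := by
    apply le_antisymm
    · rintro _ ⟨m, hm, rfl⟩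
      exact ⟨fun l _ => ⟨hI.mul _ _ hm.1, gen_mul_mem hm.2 _⟩, kos1_lgen_kos0 m⟩
    · rintro g ⟨hg, hg0⟩
      obtain ⟨m, hm, hmg⟩ := h0 (n + 1) (by omega) g (fun l => (hg l trivial).1) hg0
      rw [hproj hg] at hmg
      refine ⟨proj n m, ⟨hI.grade _ _ hm, proj_mem _ _⟩, funext fun l => ?_⟩
      rw [← proj_kos0_lgen, hmg]
      exact proj_of_mem (hg l trivial).2
  have e1 : (T (n + 1)).map (kos1 a b c (lgen a b c)) =
      T (n + 2) ⊓ LinearMap.ker (kos2 (lgen a b c)) := by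
    apply le_antisymm
    · rintro _ ⟨m, hm, rfl⟩
      refine ⟨fun l _ => ⟨hI.kos1_mem (fun l => (hm l trivial).1) l, ?_⟩, kos2_lgen_kos1 m⟩
      exact add_mem (add_mem (Submodule.smul_mem _ _ (gen_mul_mem (hm _ trivial).2 _))
        (Submodule.smul_mem _ _ (gen_mul_mem (hm _ trivial).2 _)))
        (Submodule.smul_mem _ _ (gen_mul_mem (hm _ trivial).2 _))
    · rintro g ⟨hg, hg0⟩
      obtain ⟨m, hm, hmg⟩ := h1 (n + 2) (by omega) g (fun l => (hg l trivial).1) hg0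
      rw [hproj hg] at hmg
      refine ⟨fun l => proj (n + 1) (m l), fun l _ => ⟨hI.grade _ _ (hm l), proj_mem _ _⟩,
        funext fun l => ?_⟩
      rw [← proj_kos1_lgen, hmg]
      exact proj_of_mem (hg l trivial).2
  have e2 : (T (n + 2)).map (kos2 (lgen a b c)) = I ⊓ V a b c (n + 3) := by
    apply le_antisymm
    · rintro _ ⟨m, hm, rfl⟩
      refine ⟨hI.kos2_mem (fun l => (hm l trivial).1), ?_⟩
      rw [kos2_apply]
      exact sum_mem fun l _ => gen_mul_mem (hm _ trivial).2 _
    · rintro g ⟨hg, hg0⟩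
      obtain ⟨m, hm, hmg⟩ := h2 (n + 3) (by omega) g hg
      rw [proj_of_mem hg0] at hmg
      refine ⟨fun l => proj (n + 2) (m l), fun l _ => ⟨hI.grade _ _ (hm l), proj_mem _ _⟩, ?_⟩
      rw [← proj_kos2_lgen, hmg]
      exact proj_of_mem hg0
  have r0 := finrank_map_of_injOn (kos0 (lgen a b c)) (I ⊓ V a b c n)
    fun x _ hx => (kosExact_lgen hN).inj x hx
  have r1 := finrank_map_add_inf_ker (kos1 a b c (lgen a b c)) (T (n + 1))
  have r2 := finrank_map_add_inf_ker (kos2 (lgen a b c)) (T (n + 2))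
  rw [← e0, r0, e1, hT] at r1
  rw [e2, hT] at r2
  simp only [hilb] at *
  omega

lemma quadratic_form {f : ℕ → ℤ} {N : ℕ}
    (hf : ∀ n, N ≤ n → f (n + 3) + 3 * f (n + 1) = 3 * f (n + 2) + f n) (n : ℕ) :
    2 * f (N + n) = 2 * f N + 2 * n * (f (N + 1) - f N) +
      n * (n - 1) * (f (N + 2) - 2 * f (N + 1) + f N) := by
  have h : ∀ n : ℕ, f (N + n + 2) - 2 * f (N + n + 1) + f (N + n) =
      f (N + 2) - 2 * f (N + 1) + f N := by
    intro n
    induction n with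
    | zero => rfl
    | succ n ih => rw [← ih]; have := hf (N + n) (by omega); simp only [← add_assoc]
                   simp only [add_assoc] at *; norm_num at *; linarith
  induction n using Nat.strong_induction_on with
  | _ n ih =>
    match n with
    | 0 => simp
    | 1 => push_cast; ring
    | n + 2 =>
      have h1 := ih (n + 1) (by omega)
      have h2 := ih n (by omega)
      have h3 := h n
      have e1 : N + (n + 2) = N + n + 2 := by ring
      have e2 : N + (n + 1) = N + n + 1 := by ring
      rw [e2] at h1
      rw [e1]
      push_cast at *
      linear_combination 2 * h1 - h2 + 2 * h3

end Hilbert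

end SklAz

namespace SklAz

open Module Matrix

section Growth

variable {k : Type*} [Field k] {a b c : k}

/-- Subspaces whose graded pieces grow at most linearly. -/
def LinGrowth (P : Submodule k (Sklyanin k a b c)) : Prop :=
  ∃ C : ℕ, ∀ n, finrank k (P.map (proj n)) ≤ C * (n + 1)

lemma map_proj_le (P : Submodule k (Sklyanin k a b c)) (n : ℕ) : P.map (proj n) ≤ V a b c n := by
  rintro _ ⟨x, -, rfl⟩
  exact proj_mem _ _

instance (P : Submodule k (Sklyanin k a b c)) (n : ℕ) : FiniteDimensional k (P.map (proj n)) :=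
  Submodule.finiteDimensional_of_le (map_proj_le P n)

lemma LinGrowth.of_map_le {P Q : Submodule k (Sklyanin k a b c)}
    (h : ∀ n, P.map (proj n) ≤ Q.map (proj n)) (hQ : LinGrowth Q) : LinGrowth P := by
  obtain ⟨C, hC⟩ := hQ
  exact ⟨C, fun n => (Submodule.finrank_mono (h n)).trans (hC n)⟩

lemma LinGrowth.mono {P Q : Submodule k (Sklyanin k a b c)} (h : P ≤ Q) (hQ : LinGrowth Q) :
    LinGrowth P :=
  hQ.of_map_le fun _ => Submodule.map_mono h

lemma LinGrowth.sup {P Q : Submodule k (Sklyanin k a b c)} (hP : LinGrowth P)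
    (hQ : LinGrowth Q) : LinGrowth (P ⊔ Q) := by
  obtain ⟨C, hC⟩ := hP
  obtain ⟨D, hD⟩ := hQ
  refine ⟨C + D, fun n => ?_⟩
  rw [Submodule.map_sup]
  have := Submodule.finrank_add_le_finrank_add_finrank (P.map (proj n)) (Q.map (proj n))
  have h1 := hC n
  have h2 := hD n
  nlinarith

lemma linGrowth_bot : LinGrowth (⊥ : Submodule k (Sklyanin k a b c)) :=
  ⟨0, fun n => by simp⟩

lemma IsGrLeft.map_proj {I : Submodule k (Sklyanin k a b c)} (hI : IsGrLeft I) (n : ℕ) :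
    I.map (SklAz.proj n) = I ⊓ V a b c n := by
  apply le_antisymm
  · rintro _ ⟨x, hx, rfl⟩
    exact ⟨hI.grade _ _ hx, proj_mem _ _⟩
  · rintro x ⟨hx, hn⟩
    exact ⟨x, hx, proj_of_mem hn⟩

/-- The left ideal generated by an element, as a subspace. -/
abbrev leftIdeal (s : Sklyanin k a b c) : Submodule k (Sklyanin k a b c) :=
  LinearMap.range (LinearMap.mulRight k s)

lemma proj_mul_of_mem {d : ℕ} {y : Sklyanin k a b c} (hy : y ∈ V a b c d) (s : Sklyanin k a b c)
    (n : ℕ) : proj n (s * y) = if d ≤ n then proj (n - d) s * y else 0 := by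
  split_ifs with h
  · exact DirectSum.coe_decompose_mul_of_right_mem_of_le (V a b c) hy h
  · exact DirectSum.coe_decompose_mul_of_right_mem_of_not_le (V a b c) hy h

lemma proj_mul_of_mem_left {d : ℕ} {y : Sklyanin k a b c} (hy : y ∈ V a b c d)
    (s : Sklyanin k a b c) (n : ℕ) :
    proj n (y * s) = if d ≤ n then y * proj (n - d) s else 0 := by
  split_ifs with h
  · exact DirectSum.coe_decompose_mul_of_left_mem_of_le (V a b c) hy h
  · exact DirectSum.coe_decompose_mul_of_left_mem_of_not_le (V a b c) hy h

lemma LinGrowth.leftIdeal_proj {x : Sklyanin k a b c} (hx : LinGrowth (leftIdeal x)) (d : ℕ) :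
    LinGrowth (leftIdeal (proj d x)) := by
  refine hx.of_map_le fun n => ?_
  rintro _ ⟨_, ⟨s, rfl⟩, rfl⟩
  simp only [LinearMap.mulRight_apply]
  rw [proj_mul_of_mem (proj_mem d x)]
  split_ifs with h
  · refine ⟨proj (n - d) s * x, ⟨_, rfl⟩, ?_⟩
    rw [proj_mul_of_mem_left (proj_mem (n - d) s), if_pos (Nat.sub_le _ _), Nat.sub_sub_self h]
  · exact zero_mem _

lemma proj_zero_mul_lin (s : Sklyanin k a b c) (u : Fin 3 → k) : proj 0 (s * lin a b c u) = 0 := by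
  rw [lin_apply, Finset.mul_sum, map_sum]
  simp [proj_zero_mul_gen]

lemma map_proj_leftIdeal_mul_lin (x : Sklyanin k a b c) (u : Fin 3 → k) (n : ℕ) :
    (leftIdeal (x * lin a b c u)).map (proj (n + 1)) =
      ((leftIdeal x).map (proj n)).map (LinearMap.mulRight k (lin a b c u)) := by
  ext y
  constructor
  · rintro ⟨_, ⟨s, rfl⟩, rfl⟩
    refine ⟨_, ⟨_, ⟨s, rfl⟩, rfl⟩, ?_⟩
    simp [← proj_mul_lin, mul_assoc]
  · rintro ⟨_, ⟨_, ⟨s, rfl⟩, rfl⟩, rfl⟩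
    refine ⟨_, ⟨s, rfl⟩, ?_⟩
    simp [← proj_mul_lin, mul_assoc]

/-- The elements generating a left ideal of at most linear growth. -/
def smallIdeal (a b c : k) : Submodule k (Sklyanin k a b c) where
  carrier := {s | LinGrowth (leftIdeal s)}
  zero_mem' := by
    refine linGrowth_bot.mono ?_
    rintro _ ⟨s, rfl⟩
    simp
  add_mem' {x y} hx hy := by
    refine (LinGrowth.sup hx hy).mono ?_
    rintro _ ⟨s, rfl⟩
    rw [LinearMap.mulRight_apply, mul_add]
    exact Submodule.add_mem_sup ⟨s, rfl⟩ ⟨s, rfl⟩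
  smul_mem' r x hx := by
    refine LinGrowth.mono ?_ hx
    rintro _ ⟨s, rfl⟩
    exact ⟨r • s, by simp⟩

lemma isGrLeft_smallIdeal : IsGrLeft (smallIdeal a b c) where
  mul s x hx := by
    refine LinGrowth.mono ?_ hx
    rintro _ ⟨t, rfl⟩
    exact ⟨t * s, by simp [mul_assoc]⟩
  grade n x hx := LinGrowth.leftIdeal_proj hx n

lemma linGrowth_smallIdeal [IsNoetherian (Ctr k a b c) (Sklyanin k a b c)] :
    LinGrowth (smallIdeal a b c) := by
  classical
  let C : Submodule (Ctr k a b c) (Sklyanin k a b c) :=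
    { carrier := smallIdeal a b c
      zero_mem' := zero_mem _
      add_mem' := fun hx hy => add_mem hx hy
      smul_mem' := fun z x hx => isGrLeft_smallIdeal.mul _ _ hx }
  obtain ⟨s, hs⟩ := IsNoetherian.noetherian C
  have hsC : ∀ x ∈ s, LinGrowth (leftIdeal x) := fun x hx => by
    have : x ∈ C := hs ▸ Submodule.subset_span hx
    exact this
  have h1 : ∀ t : Finset (Sklyanin k a b c), t ⊆ s → LinGrowth (t.sup leftIdeal) := by
    intro t
    induction t using Finset.induction_on with
    | empty => intro _; exact linGrowth_bot
    | insert x t _ ih =>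
      intro h
      rw [Finset.sup_insert]
      exact (hsC x (h (Finset.mem_insert_self _ _))).sup
        (ih ((Finset.subset_insert _ _).trans h))
  refine (h1 s subset_rfl).mono fun x hx => ?_
  have hx' : x ∈ Submodule.span (Ctr k a b c) (s : Set (Sklyanin k a b c)) := by
    rw [hs]; exact hx
  have h2 : ∀ y (r : Sklyanin k a b c), y ∈ s.sup leftIdeal → r * y ∈ s.sup leftIdeal := by
    intro y r hy
    have h3 : s.sup leftIdeal ≤ (s.sup leftIdeal).comap (LinearMap.mulLeft k r) := by
      refine Finset.sup_le fun x hx => ?_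
      rintro _ ⟨t, rfl⟩
      exact Finset.le_sup (f := leftIdeal) hx ⟨r * t, by simp [mul_assoc]⟩
    exact h3 hy
  clear hx
  induction hx' using Submodule.span_induction with
  | mem x hx => exact Finset.le_sup (f := leftIdeal) hx ⟨1, by simp⟩
  | zero => exact zero_mem _
  | add x y _ _ hx hy => exact add_mem hx hy
  | smul z x _ hx => exact h2 _ _ hx

variable [IsAlgClosed k]

lemma mul_lin_mem_smallIdeal (hN : Nondeg a b c) {u : Fin 3 → k} (hu : u ≠ 0)
    {x : Sklyanin k a b c} : x * lin a b c u ∈ smallIdeal a b c ↔ x ∈ smallIdeal a b c := by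
  have h : ∀ n, finrank k ((leftIdeal (x * lin a b c u)).map (proj (n + 1))) =
      finrank k ((leftIdeal x).map (proj n)) := fun n => by
    rw [map_proj_leftIdeal_mul_lin]
    exact finrank_map_of_injOn _ _ fun y _ hy => mul_lin_injective hN hu hy
  constructor
  · rintro ⟨C, hC⟩
    refine ⟨2 * C, fun n => ?_⟩
    rw [← h]
    refine (hC (n + 1)).trans ?_
    nlinarith
  · rintro ⟨C, hC⟩
    refine ⟨C, fun n => ?_⟩
    rcases n with _ | n
    · have : (leftIdeal (x * lin a b c u)).map (proj 0) = ⊥ := by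
        rw [eq_bot_iff]
        rintro _ ⟨_, ⟨s, rfl⟩, rfl⟩
        rw [LinearMap.mulRight_apply, ← mul_assoc, proj_zero_mul_lin]
        exact zero_mem _
      rw [this]; simp
    · rw [h]
      refine (hC n).trans ?_
      nlinarith

omit [IsAlgClosed k] in
lemma nonpos_of_quadratic_le {A B E : ℤ} (h : ∀ n : ℕ, (n : ℤ) * (n - 1) * E ≤ A + n * B) :
    E ≤ 0 := by
  by_contra hE
  have hE' : 1 ≤ E := by omega
  have h1 := h (A.natAbs + B.natAbs + 2)
  push_cast at h1
  have hA := le_abs_self A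
  have hB := le_abs_self B
  have hA0 := abs_nonneg A
  have hB0 := abs_nonneg B
  set α := |A|
  set β := |B|
  have h2 : (α + β + 2) * (α + β + 2 - 1) * 1 ≤ (α + β + 2) * (α + β + 2 - 1) * E :=
    mul_le_mul_of_nonneg_left hE' (by nlinarith)
  have h3 : (α + β + 2) * B ≤ (α + β + 2) * β := mul_le_mul_of_nonneg_left hB (by positivity)
  nlinarith

/-- The second difference of the Hilbert function of a graded left ideal is eventually a
nonnegative constant, which vanishes exactly for linear growth. -/
theorem IsGrLeft.exists_second_difference (hN : Nondeg a b c)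
    [IsNoetherian (Ctr k a b c) (Sklyanin k a b c)]
    {I : Submodule k (Sklyanin k a b c)} (hI : IsGrLeft I) :
    ∃ (E : ℤ) (N : ℕ) (_ : 0 ≤ E), (∀ n, N ≤ n →
      (hilb I (n + 2) : ℤ) - 2 * hilb I (n + 1) + hilb I n = E) ∧ (E = 0 ↔ LinGrowth I) := by
  obtain ⟨N, hf⟩ := hI.hilb_rec hN
  let f : ℕ → ℤ := fun n => hilb I n
  have hf' : ∀ n, N ≤ n → f (n + 3) + 3 * f (n + 1) = 3 * f (n + 2) + f n := fun n hn => by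
    simp only [f]; exact_mod_cast hf n hn
  have hq := quadratic_form hf'
  set E := f (N + 2) - 2 * f (N + 1) + f N
  set D := f (N + 1) - f N
  have hpos : ∀ n, 0 ≤ f n := fun n => by simp [f]
  refine ⟨E, N, ?_, fun n hn => ?_, fun hE => ?_, ?_⟩
  · have := nonpos_of_quadratic_le (A := 2 * f N) (B := 2 * D) (E := -E) fun n => by
      have h1 := hq n
      have h2 := hpos (N + n)
      nlinarith
    omega
  · obtain ⟨j, rfl⟩ := Nat.exists_eq_add_of_le hn
    have h0 := hq j
    have h1 := hq (j + 1)
    have h2 := hq (j + 2)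
    push_cast at h0 h1 h2
    change f (N + j + 2) - 2 * f (N + j + 1) + f (N + j) = E
    simp only [← add_assoc] at h1 h2
    linarith
  · refine ⟨(∑ j ∈ Finset.range N, hilb I j) + hilb I N + D.natAbs, fun n => ?_⟩
    rw [hI.map_proj]
    change hilb I n ≤ _
    rcases lt_or_ge n N with hn | hn
    · have h1 : hilb I n ≤ ∑ j ∈ Finset.range N, hilb I j :=
        Finset.single_le_sum (f := fun j => hilb I j) (fun _ _ => Nat.zero_le _)
          (Finset.mem_range.2 hn)
      refine h1.trans (le_trans ?_ (Nat.le_mul_of_pos_right _ n.succ_pos))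
      omega
    · obtain ⟨j, rfl⟩ := Nat.exists_eq_add_of_le hn
      have h1 := hq j
      rw [hE, mul_zero, add_zero] at h1
      have h2 : f (N + j) = f N + j * D := by linarith
      have h3 : (hilb I (N + j) : ℤ) ≤ hilb I N + D.natAbs * (N + j + 1) := by
        change f (N + j) ≤ f N + _
        rw [h2]
        push_cast
        have := le_abs_self D
        have := abs_nonneg D
        nlinarith
      have h4 : hilb I (N + j) ≤ hilb I N + D.natAbs * (N + j + 1) := by exact_mod_cast h3
      nlinarith [Nat.zero_le (∑ j ∈ Finset.range N, hilb I j)]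
  · rintro ⟨C, hC⟩
    have h1 : E ≤ 0 := nonpos_of_quadratic_le (A := 2 * C * (N + 1) - 2 * f N)
        (B := 2 * C - 2 * D) fun n => by
      have h1 := hq n
      have h2 : f (N + n) ≤ C * (N + n + 1) := by
        have := hC (N + n)
        rw [hI.map_proj] at this
        change hilb I (N + n) ≤ _ at this
        simp only [f]; exact_mod_cast this
      nlinarith
    have h2 : -E ≤ 0 := nonpos_of_quadratic_le (A := 2 * f N) (B := 2 * D) fun n => by
      have h1 := hq n
      have h2 := hpos (N + n)
      nlinarith
    omega

end Growth

end SklAz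

namespace SklAz

open Module Matrix

section Domain

variable {k : Type*} [Field k] [IsAlgClosed k] {a b c : k}

omit [IsAlgClosed k] in
lemma mul_mem_V {i j n : ℕ} {s t : Sklyanin k a b c} (hs : s ∈ V a b c i) (ht : t ∈ V a b c j)
    (h : i + j = n) : s * t ∈ V a b c n := by
  subst h
  exact SetLike.mul_mem_graded (A := V a b c) hs ht

lemma exists_hilb_smallIdeal_diff (hN : Nondeg a b c)
    [IsNoetherian (Ctr k a b c) (Sklyanin k a b c)] :
    ∃ r N : ℕ, ∀ n, N ≤ n → hilb (smallIdeal a b c) (n + 1) ≤ hilb (smallIdeal a b c) n + r := by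
  obtain ⟨E, N, -, hE, h0⟩ :=
    (isGrLeft_smallIdeal (a := a) (b := b) (c := c)).exists_second_difference hN
  have hE0 : E = 0 := h0.2 linGrowth_smallIdeal
  refine ⟨hilb (smallIdeal a b c) (N + 1), N, fun n hn => ?_⟩
  have h : ∀ j : ℕ, (hilb (smallIdeal a b c) (N + j + 1) : ℤ) - hilb (smallIdeal a b c) (N + j) =
      hilb (smallIdeal a b c) (N + 1) - hilb (smallIdeal a b c) N := by
    intro j
    induction j with
    | zero => rfl
    | succ j ih =>
      have := hE (N + j) (by omega)
      rw [hE0] at this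
      simp only [← add_assoc] at *
      linarith
  obtain ⟨j, rfl⟩ := Nat.exists_eq_add_of_le hn
  have := h j
  omega

lemma smallIdeal_eq_zero (hN : Nondeg a b c) [IsNoetherian (Ctr k a b c) (Sklyanin k a b c)]
    (d : ℕ) : ∀ m ∈ smallIdeal a b c, m ∈ V a b c d → m = 0 := by
  have hJ := isGrLeft_smallIdeal (a := a) (b := b) (c := c)
  set u : Fin 3 → k := Pi.single 0 1 with hu_def
  have hu : u ≠ 0 := by simp [hu_def]
  obtain ⟨r, N, hr⟩ := exists_hilb_smallIdeal_diff hN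
  have hquot : ∀ n, N ≤ n → finrank k
      ((smallIdeal a b c ⊓ V a b c (n + 1)).map (lineIdeal a b c u).mkQ) ≤ r := by
    intro n hn
    have h1 := finrank_map_add_inf_ker (lineIdeal a b c u).mkQ
      (smallIdeal a b c ⊓ V a b c (n + 1))
    have h2 : (smallIdeal a b c ⊓ V a b c (n + 1)) ⊓ LinearMap.ker (lineIdeal a b c u).mkQ =
        (smallIdeal a b c ⊓ V a b c n).map (LinearMap.mulRight k (lin a b c u)) := by
      rw [Submodule.ker_mkQ]
      apply le_antisymm
      · rintro x ⟨⟨hx, hxn⟩, t, rfl⟩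
        have ht : t ∈ smallIdeal a b c := (mul_lin_mem_smallIdeal hN hu).1 hx
        refine ⟨proj n t, ⟨hJ.grade _ _ ht, proj_mem _ _⟩, ?_⟩
        rw [LinearMap.mulRight_apply, ← proj_mul_lin]
        exact proj_of_mem hxn
      · rintro _ ⟨t, ⟨ht, htn⟩, rfl⟩
        exact ⟨⟨(mul_lin_mem_smallIdeal hN hu).2 ht, mul_lin_mem htn u⟩, t, rfl⟩
    rw [h2, finrank_map_of_injOn (LinearMap.mulRight k (lin a b c u)) _
      fun y _ hy => mul_lin_injective hN hu hy] at h1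
    have h3 := hr n hn
    simp only [hilb] at h3
    omega
  induction d with
  | zero =>
    intro m hm hmd
    have h1 : m ∈ lineIdeal a b c u := line_pure hN (r + 1) (N + 1) 0 hu hmd fun n hn => by
      obtain ⟨n, rfl⟩ : ∃ j, n = j + 1 := ⟨n - 1, by omega⟩
      refine Nat.lt_succ_of_le (le_trans (Submodule.finrank_mono ?_) (hquot n (by omega)))
      rintro _ ⟨x, hx, rfl⟩
      refine ⟨x * m, ⟨hJ.mul _ _ hm, ?_⟩, rfl⟩
      exact mul_mem_V hx hmd (by omega)
    obtain ⟨t, rfl⟩ := h1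
    rw [← proj_of_mem hmd]
    exact proj_zero_mul_lin _ _
  | succ d ih =>
    intro m hm hmd
    have h1 : m ∈ lineIdeal a b c u := line_pure hN (r + 1) (N + 1) (d + 1) hu hmd fun n hn => by
      have h2 := hquot (n + d) (by omega)
      refine Nat.lt_succ_of_le (le_trans (Submodule.finrank_mono ?_) h2)
      rintro _ ⟨x, hx, rfl⟩
      refine ⟨x * m, ⟨hJ.mul _ _ hm, ?_⟩, rfl⟩
      exact mul_mem_V hx hmd (by omega)
    obtain ⟨t, rfl⟩ := h1
    have ht : t ∈ smallIdeal a b c := (mul_lin_mem_smallIdeal hN hu).1 hm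
    rw [← proj_of_mem hmd, LinearMap.mulRight_apply, proj_mul_lin,
      ih (proj d t) (hJ.grade _ _ ht) (proj_mem _ _), zero_mul]

lemma IsGrLeft.eq_bot_of_linGrowth (hN : Nondeg a b c)
    [IsNoetherian (Ctr k a b c) (Sklyanin k a b c)]
    {I : Submodule k (Sklyanin k a b c)} (hI : IsGrLeft I) (h : LinGrowth I) : I = ⊥ := by
  rw [eq_bot_iff]
  intro x hx
  refine eq_zero_of_proj fun n => smallIdeal_eq_zero hN n _ ?_ (proj_mem _ _)
  refine isGrLeft_smallIdeal.grade _ _ (h.mono ?_)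
  rintro _ ⟨s, rfl⟩
  exact hI.mul _ _ hx

lemma mul_eq_zero_of_mem_V (hN : Nondeg a b c) [IsNoetherian (Ctr k a b c) (Sklyanin k a b c)]
    {d : ℕ} {t s : Sklyanin k a b c} (hs : s ∈ V a b c d) (hts : t * s = 0) :
    t = 0 ∨ s = 0 := by
  let A : Submodule k (Sklyanin k a b c) := LinearMap.ker (LinearMap.mulRight k s)
  have hA : IsGrLeft A := ⟨fun r x hx => by
      have hx' : x * s = 0 := hx
      change r * x * s = 0
      rw [mul_assoc, hx', mul_zero], fun n x hx => by
      have hx' : x * s = 0 := hx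
      change proj n x * s = 0
      have := proj_mul_of_mem hs x (n + d)
      rwa [hx', map_zero, if_pos (Nat.le_add_left _ _), Nat.add_sub_cancel, eq_comm] at this⟩
  have hB : IsGrLeft (leftIdeal s) := ⟨fun r x hx => by
      obtain ⟨y, rfl⟩ := hx
      exact ⟨r * y, by simp [mul_assoc]⟩, fun n x hx => by
      obtain ⟨y, rfl⟩ := hx
      rw [LinearMap.mulRight_apply, proj_mul_of_mem hs]
      split_ifs
      · exact ⟨_, rfl⟩
      · exact zero_mem _⟩
  have hsum : ∀ n, hilb (leftIdeal s) (n + d) + hilb A n = finrank k (V a b c n) := by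
    intro n
    rw [← finrank_map_add_inf_ker (LinearMap.mulRight k s) (V a b c n)]
    have h1 : leftIdeal s ⊓ V a b c (n + d) = (V a b c n).map (LinearMap.mulRight k s) := by
      apply le_antisymm
      · rintro _ ⟨⟨y, rfl⟩, hy⟩
        refine ⟨proj n y, proj_mem _ _, ?_⟩
        have := proj_mul_of_mem hs y (n + d)
        rw [if_pos (Nat.le_add_left _ _), Nat.add_sub_cancel] at this
        rw [LinearMap.mulRight_apply, ← this]
        exact proj_of_mem hy
      · rintro _ ⟨y, hy, rfl⟩
        exact ⟨⟨y, rfl⟩, SetLike.mul_mem_graded (A := V a b c) hy hs⟩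
    have h2 : A ⊓ V a b c n = V a b c n ⊓ LinearMap.ker (LinearMap.mulRight k s) := inf_comm _ _
    unfold hilb
    rw [h1, h2]
  obtain ⟨E, N, hE0, hE, hE'⟩ := hA.exists_second_difference hN
  obtain ⟨F, N', hF0, hF, hF'⟩ := hB.exists_second_difference hN
  have hEF : E + F = 1 := by
    have h1 := hE (N + N') (by omega)
    have h2 := hF (N + N' + d) (by omega)
    have s0 := hsum (N + N')
    have s1 := hsum (N + N' + 1)
    have s2 := hsum (N + N' + 2)
    have r1 := finrank_V_succ hN (N + N')
    have r2 := finrank_V_succ hN (N + N' + 1)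
    have e1 : N + N' + 1 + d = N + N' + d + 1 := by ring
    have e2 : N + N' + 2 + d = N + N' + d + 2 := by ring
    rw [e1] at s1
    rw [e2] at s2
    change finrank k (V a b c (N + N' + 2)) = _ at r2
    omega
  rcases (show E = 0 ∨ F = 0 by omega) with h | h
  · left
    have : t ∈ A := hts
    rw [hA.eq_bot_of_linGrowth hN (hE'.1 h)] at this
    exact this
  · right
    have : s ∈ leftIdeal s := ⟨1, one_mul s⟩
    rw [hB.eq_bot_of_linGrowth hN (hF'.1 h)] at this
    exact this

omit [IsAlgClosed k] in
lemma exists_top_degree {s : Sklyanin k a b c} (hs : s ≠ 0) :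
    ∃ d, proj d s ≠ 0 ∧ ∀ n, d < n → proj n s = 0 := by
  classical
  obtain ⟨N, hN⟩ := exists_proj_bound s
  have hex : ∃ d, proj d s ≠ 0 := by
    by_contra! h
    exact hs (eq_zero_of_proj h)
  refine ⟨Nat.findGreatest (fun d => proj d s ≠ 0) N, ?_, fun n hn => ?_⟩
  · obtain ⟨d, hd⟩ := hex
    refine Nat.findGreatest_spec (P := fun d => proj d s ≠ 0) (m := d) ?_ hd
    by_contra! h
    exact hd (hN d h.le)
  · by_contra h
    rcases le_or_gt n N with h' | h'
    · exact absurd (Nat.le_findGreatest (P := fun d => proj d s ≠ 0) h' h) (by omega)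
    · exact h (hN n h'.le)

/-- The Sklyanin algebra is a domain. -/
theorem noZeroDivisors (hN : Nondeg a b c) [IsNoetherian (Ctr k a b c) (Sklyanin k a b c)] :
    NoZeroDivisors (Sklyanin k a b c) where
  eq_zero_or_eq_zero_of_mul_eq_zero {s t} hst := by
    by_contra! h
    obtain ⟨d, hd, hd'⟩ := exists_top_degree h.1
    obtain ⟨e, he, he'⟩ := exists_top_degree h.2
    have h1 : proj d s * proj e t = proj (d + e) (s * t) := by
      have hs := sum_proj_eq s (n := d + 1) fun m hm => hd' m hm
      have ht := sum_proj_eq t (n := e + 1) fun m hm => he' m hm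
      conv_rhs => rw [← hs, Finset.sum_mul, map_sum]
      rw [Finset.sum_eq_single d]
      · rw [proj_mul_of_mem_left (proj_mem d s), if_pos (Nat.le_add_right _ _),
          Nat.add_sub_cancel_left]
      · intro j hj hjd
        have := Finset.mem_range.1 hj
        rw [proj_mul_of_mem_left (proj_mem j s), if_pos (by omega), he' _ (by omega), mul_zero]
      · intro h; exact absurd (Finset.mem_range.2 (Nat.lt_succ_self d)) h
    rw [hst, map_zero] at h1
    rcases mul_eq_zero_of_mem_V hN (proj_mem e t) h1 with h2 | h2
    · exact hd h2
    · exact he h2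

end Domain

end SklAz

namespace SklAz

open Module Matrix

section Split

variable {k : Type*} [Field k]

/-- Over a field, a linear map factors through another one as soon as the kernels allow it. -/
lemma exists_comp_eq_of_ker_le {U V W : Type*} [AddCommGroup U] [Module k U] [AddCommGroup V]
    [Module k V] [AddCommGroup W] [Module k W] (f : V →ₗ[k] W) (g : V →ₗ[k] U)
    (h : LinearMap.ker f ≤ LinearMap.ker g) : ∃ q : W →ₗ[k] U, q ∘ₗ f = g := by
  obtain ⟨r, hr⟩ := f.rangeRestrict.exists_rightInverse_of_surjective f.range_rangeRestrict
  obtain ⟨q, hq⟩ := LinearMap.exists_extend r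
  refine ⟨g ∘ₗ q, LinearMap.ext fun v => ?_⟩
  have h1 : f (q (f v)) = f v := by
    have h2 := congrArg Subtype.val (LinearMap.congr_fun hr (f.rangeRestrict v))
    have h3 := LinearMap.congr_fun hq (f.rangeRestrict v)
    simp only [LinearMap.comp_apply, Submodule.subtype_apply, LinearMap.codRestrict_apply,
      LinearMap.rangeRestrict, LinearMap.id_apply] at h2 h3
    rw [h3]
    exact h2
  have h4 : q (f v) - v ∈ LinearMap.ker g := h (by simp [h1])
  rw [LinearMap.mem_ker, map_sub, sub_eq_zero] at h4
  exact h4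

/-- Over a field, lifts of a linear map into a range can be chosen linearly. -/
lemma exists_comp_eq_of_range_le {U V W : Type*} [AddCommGroup U] [Module k U] [AddCommGroup V]
    [Module k V] [AddCommGroup W] [Module k W] (f : V →ₗ[k] W) (g : U →ₗ[k] W)
    (h : ∀ u, ∃ v, f v = g u) : ∃ q : U →ₗ[k] V, ∀ u, f (q u) = g u := by
  obtain ⟨r, hr⟩ := f.rangeRestrict.exists_rightInverse_of_surjective f.range_rangeRestrict
  refine ⟨r ∘ₗ g.codRestrict (LinearMap.range f) h, fun u => ?_⟩
  exact congrArg Subtype.val (LinearMap.congr_fun hr (g.codRestrict (LinearMap.range f) h u))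

variable {M : Type*} [AddCommGroup M] [Module k M] {a b c : k} {γ : Fin 3 → End k M}

lemma kos1_kos0 (hγ : IsSkl a b c γ) (m : M) : kos1 a b c γ (kos0 γ m) = 0 := by
  funext l
  simpa [kos1_apply, kos0_apply] using LinearMap.congr_fun (hγ l) m

/-- The matrix of the middle Koszul map. -/
def kosMat {R : Type*} [Ring R] [Algebra k R] (a b c : k) (γ : Fin 3 → R) (l j : Fin 3) : R :=
  (if j = l then c • γ l else 0) + (if j = l + 2 then a • γ (l + 1) else 0)
    + (if j = l + 1 then b • γ (l + 2) else 0)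

/-- Linear contracting homotopies of the one-sided Koszul complex, in matrix form. -/
structure KosSplit {R : Type*} [Ring R] [Algebra k R] (a b c : k) (γ : Fin 3 → R) : Prop where
  split : ∃ (s0 : Fin 3 → R) (s1 : Fin 3 → Fin 3 → R) (s2 : Fin 3 → R),
    (∑ i, s0 i * γ i = 1) ∧
    (∀ l j, γ l * s0 j + ∑ i, s1 l i * kosMat a b c γ i j = if l = j then 1 else 0) ∧
    (∀ l j, ∑ i, kosMat a b c γ l i * s1 i j + s2 l * γ j = if l = j then 1 else 0)

lemma KosSplit.map {R R' : Type*} [Ring R] [Algebra k R] [Ring R'] [Algebra k R'] (Φ : R →ₐ[k] R')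
    {γ : Fin 3 → R} (h : KosSplit a b c γ) : KosSplit a b c fun i => Φ (γ i) := by
  obtain ⟨s0, s1, s2, h0, h1, h2⟩ := h.split
  have hm : ∀ l j, kosMat a b c (fun i => Φ (γ i)) l j = Φ (kosMat a b c γ l j) := by
    intro l j
    simp only [kosMat, map_add, apply_ite Φ, map_smul, map_zero]
  refine ⟨fun i => Φ (s0 i), fun i j => Φ (s1 i j), fun i => Φ (s2 i), ?_, fun l j => ?_,
    fun l j => ?_⟩
  · simpa using congrArg Φ h0
  · simpa [hm, apply_ite Φ] using congrArg Φ (h1 l j)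
  · simpa [hm, apply_ite Φ] using congrArg Φ (h2 l j)

lemma kos1_eq_kosMat (g : Fin 3 → M) (l : Fin 3) :
    kos1 a b c γ g l = ∑ j, kosMat a b c γ l j (g j) := by
  simp only [kos1_apply, kosMat, LinearMap.add_apply, Finset.sum_add_distrib]
  simp [Finset.sum_ite_eq', DFunLike.ite_apply]

lemma apply_eq_sum_single {U : Type*} [AddCommGroup U] [Module k U] (f : (Fin 3 → M) →ₗ[k] U)
    (g : Fin 3 → M) : f g = ∑ j, f (Pi.single j (g j)) := by
  rw [← map_sum, Finset.univ_sum_single]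

lemma KosExact.kosSplit (h : KosExact a b c γ) (hγ : IsSkl a b c γ) : KosSplit a b c γ := by
  obtain ⟨s0, h0⟩ := exists_comp_eq_of_ker_le (kos0 γ) LinearMap.id (fun m hm => h.inj m hm)
  obtain ⟨s1, h1⟩ := exists_comp_eq_of_ker_le (kos1 a b c γ) (LinearMap.id - kos0 γ ∘ₗ s0)
    (fun g hg => by
      obtain ⟨m, rfl⟩ := h.ex1 g hg
      have := LinearMap.congr_fun h0 m
      simp only [LinearMap.comp_apply, LinearMap.id_apply] at this
      simp [this])
  obtain ⟨s2, h2⟩ := exists_comp_eq_of_ker_le (kos2 γ) (LinearMap.id - kos1 a b c γ ∘ₗ s1)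
    (fun g hg => by
      obtain ⟨m, rfl⟩ := h.ex2 g hg
      have := LinearMap.congr_fun h1 m
      simp only [LinearMap.comp_apply, LinearMap.id_apply, LinearMap.sub_apply] at this
      simp [this, kos1_kos0 hγ])
  have h0' : ∀ m, s0 (kos0 γ m) = m := LinearMap.congr_fun h0
  have h1' : ∀ g, kos0 γ (s0 g) + s1 (kos1 a b c γ g) = g := fun g => by
    have : s1 (kos1 a b c γ g) = g - kos0 γ (s0 g) := LinearMap.congr_fun h1 g
    rw [this]; abel
  have h2' : ∀ g, kos1 a b c γ (s1 g) + s2 (kos2 γ g) = g := fun g => by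
    have : s2 (kos2 γ g) = g - kos1 a b c γ (s1 g) := LinearMap.congr_fun h2 g
    rw [this]; abel
  refine ⟨fun i => s0 ∘ₗ LinearMap.single k (fun _ => M) i,
    fun l j => LinearMap.proj l ∘ₗ s1 ∘ₗ LinearMap.single k (fun _ => M) j,
    fun l => LinearMap.proj l ∘ₗ s2, ?_, fun l j => ?_, fun l j => ?_⟩
  · refine LinearMap.ext fun m => ?_
    have := h0' m
    rw [apply_eq_sum_single] at this
    simpa [kos0_apply] using this
  · refine LinearMap.ext fun m => ?_
    have := congrFun (h1' (Pi.single j m)) l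
    rw [Pi.add_apply, apply_eq_sum_single s1, Finset.sum_apply] at this
    simp only [kos1_eq_kosMat, kos0_apply] at this
    have e : ∀ i, ∑ j', kosMat a b c γ i j' ((Pi.single j m : Fin 3 → M) j') =
        kosMat a b c γ i j m := fun i => by
      rw [Finset.sum_eq_single j] <;> simp +contextual
    simp only [e] at this
    rw [LinearMap.add_apply, LinearMap.sum_apply]
    refine this.trans ?_
    by_cases hlj : l = j
    · subst hlj; simp
    · simp [hlj]
  · refine LinearMap.ext fun m => ?_
    have := congrFun (h2' (Pi.single j m)) l
    rw [Pi.add_apply, kos1_eq_kosMat] at this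
    have e : kos2 γ (Pi.single j m) = γ j m := by
      rw [kos2_apply, Finset.sum_eq_single j] <;> simp +contextual
    rw [e] at this
    rw [LinearMap.add_apply, LinearMap.sum_apply]
    refine this.trans ?_
    by_cases hlj : l = j
    · subst hlj; simp
    · simp [hlj]

lemma KosSplit.kosExact (h : KosSplit a b c γ) : KosExact a b c γ := by
  obtain ⟨s0, s1, s2, h0, h1, h2⟩ := h.split
  refine ⟨fun m hm => ?_, fun g hg => ⟨∑ j, s0 j (g j), ?_⟩,
    fun g hg => ⟨fun l => ∑ j, s1 l j (g j), ?_⟩⟩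
  · have := LinearMap.congr_fun h0 m
    have hm' : ∀ i, γ i m = 0 := fun i => congrFun hm i
    simpa [hm'] using this.symm
  · funext l
    have e : ∑ j, ∑ i, (s1 l i * kosMat a b c γ i j) (g j) = 0 := by
      rw [Finset.sum_comm]
      refine Finset.sum_eq_zero fun i _ => ?_
      simp only [Module.End.mul_apply]
      rw [← map_sum, ← kos1_eq_kosMat, hg]
      exact map_zero _
    have e2 : ∑ j, (if l = j then (1 : End k M) else 0) (g j) = g l := by
      rw [Finset.sum_eq_single l] <;> simp +contextual [eq_comm]
    rw [← e2]
    simp only [Module.End.mul_apply] at e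
    simp only [← h1, LinearMap.add_apply, LinearMap.sum_apply, Finset.sum_add_distrib,
      kos0_apply, map_sum, Module.End.mul_apply]
    rw [e, add_zero]
  · funext l
    have e : ∑ j, (s2 l * γ j) (g j) = 0 := by
      simp only [Module.End.mul_apply]
      rw [← map_sum, ← kos2_apply, hg, map_zero]
    have e2 : ∑ j, (if l = j then (1 : End k M) else 0) (g j) = g l := by
      rw [Finset.sum_eq_single l] <;> simp +contextual [eq_comm]
    rw [← e2]
    simp only [Module.End.mul_apply] at e
    simp only [← h2, LinearMap.add_apply, LinearMap.sum_apply, Finset.sum_add_distrib,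
      kos1_eq_kosMat, map_sum, Module.End.mul_apply]
    rw [e, add_zero, Finset.sum_comm]

end Split

end SklAz

namespace SklAz

open Module Matrix

section Bi

variable {k : Type*} [Field k]

/-- A family of orthogonal projections exhibiting `M` as a graded vector space. -/
structure Grading {M : Type*} [AddCommGroup M] [Module k M] (P : ℕ → M →ₗ[k] M) : Prop where
  idem : ∀ j y, P j (P j y) = P j y
  orth : ∀ i j y, i ≠ j → P i (P j y) = 0
  bound : ∀ y, ∃ N, ∀ j, N ≤ j → P j y = 0
  zero : ∀ y, (∀ j, P j y = 0) → y = 0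

/-- Exactness of a filtered perturbation: if the degree raising parts form an exact pair, then so do
the perturbed maps. -/
lemma Grading.exists_of_raise {X Y W : Type*} [AddCommGroup X] [Module k X] [AddCommGroup Y]
    [Module k Y] [AddCommGroup W] [Module k W] {P : ℕ → X →ₗ[k] X} {Q : ℕ → Y →ₗ[k] Y}
    {R : ℕ → W →ₗ[k] W} (hP : Grading P) (hQ : Grading Q)
    (d d' : X →ₗ[k] Y) (e e' : Y →ₗ[k] W)
    (hd : ∀ j x, Q (j + 1) (d x) = d (P j x)) (hd0 : ∀ x, Q 0 (d x) = 0)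
    (hd' : ∀ j x, Q j (d' x) = d' (P j x))
    (he : ∀ j y, R (j + 1) (e y) = e (Q j y))
    (he' : ∀ j y, R j (e' y) = e' (Q j y))
    (hex : ∀ y, e y = 0 → ∃ x, d x = y)
    (hde : ∀ x, e (d x) + e (d' x) + e' (d x) + e' (d' x) = 0)
    (y : Y) (hy : e y + e' y = 0) : ∃ x, d x + d' x = y := by
  obtain ⟨N, hN⟩ := hQ.bound y
  induction N generalizing y with
  | zero => exact ⟨0, by rw [hQ.zero y fun j => hN j (Nat.zero_le _)]; simp⟩
  | succ n ih =>
    have h1 : e (Q n y) = 0 := by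
      have := congrArg (R (n + 1)) hy
      rw [map_add, he, he', hN (n + 1) le_rfl, map_zero, map_zero, add_zero] at this
      exact this
    obtain ⟨x, hx⟩ := hex _ h1
    obtain ⟨x', hx', hdeg⟩ : ∃ x', d x' = Q n y ∧ ∀ j, n ≤ j → P j x' = 0 := by
      cases n with
      | zero =>
        refine ⟨0, ?_, by simp⟩
        rw [map_zero, ← hQ.idem, ← hx, hd0]
      | succ n =>
        refine ⟨P n x, ?_, fun j hj => hP.orth _ _ _ (by omega)⟩
        rw [← hd, hx, hQ.idem]
    obtain ⟨x'', hx''⟩ := ih (y - (d x' + d' x'))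
      (by
        have h2 := hde x'
        simp only [map_sub, map_add]
        have h3 : e y - (e (d x') + e (d' x')) + (e' y - (e' (d x') + e' (d' x'))) =
            (e y + e' y) - (e (d x') + e (d' x') + e' (d x') + e' (d' x')) := by abel
        rw [h3, hy, h2, sub_zero])
      (fun j hj => by
        rw [map_sub, map_add, hx', hd', hdeg j hj, map_zero, add_zero]
        obtain rfl | hlt := eq_or_lt_of_le hj
        · rw [hQ.idem, sub_self]
        · rw [hN j hlt, hQ.orth _ _ _ hlt.ne', sub_zero])
    refine ⟨x'' + x', ?_⟩
    rw [map_add, map_add, ← sub_eq_zero]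
    rw [← sub_eq_zero] at hx''
    rw [← hx'']
    abel

lemma Grading.pi {M : Type*} [AddCommGroup M] [Module k M] {P : ℕ → M →ₗ[k] M} (hP : Grading P) :
    Grading (fun j => LinearMap.pi fun l : Fin 3 => P j ∘ₗ LinearMap.proj (R := k) l) where
  idem j y := funext fun l => hP.idem _ _
  orth i j y h := funext fun l => hP.orth _ _ _ h
  bound y := by
    choose N hN using fun l => hP.bound (y l)
    refine ⟨∑ l, N l, fun j hj => funext fun l => hN l j (le_trans ?_ hj)⟩
    exact Finset.single_le_sum (fun _ _ => Nat.zero_le _) (Finset.mem_univ l)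
  zero y h := funext fun l => hP.zero _ fun j => congrFun (h j) l

variable {M : Type*} [AddCommGroup M] [Module k M]

/-- The first map of the Koszul complex of a bimodule with actions `α` and `β`. -/
def bi0 (α β : Fin 3 → End k M) : M →ₗ[k] (Fin 3 → M) := kos0 α - kos0 β

/-- The second map of the Koszul complex of a bimodule with actions `α` and `β`. -/
def bi1 (a b c : k) (α β : Fin 3 → End k M) : (Fin 3 → M) →ₗ[k] (Fin 3 → M) :=
  kos1 a b c α + kos1 b a c β

/-- The third map of the Koszul complex of a bimodule with actions `α` and `β`. -/
def bi2 (α β : Fin 3 → End k M) : (Fin 3 → M) →ₗ[k] M := kos2 α - kos2 β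

lemma bi0_apply (α β : Fin 3 → End k M) (m : M) (i : Fin 3) : bi0 α β m i = α i m - β i m := rfl

lemma bi1_apply (a b c : k) (α β : Fin 3 → End k M) (g : Fin 3 → M) (l : Fin 3) :
    bi1 a b c α β g l = (c • α l (g l) + a • α (l + 1) (g (l + 2)) + b • α (l + 2) (g (l + 1))) +
      (c • β l (g l) + b • β (l + 1) (g (l + 2)) + a • β (l + 2) (g (l + 1))) := by
  rw [bi1, LinearMap.add_apply, Pi.add_apply, kos1_apply, kos1_apply]

lemma bi2_apply (α β : Fin 3 → End k M) (g : Fin 3 → M) :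
    bi2 α β g = ∑ l, (α l (g l) - β l (g l)) := by
  rw [bi2, LinearMap.sub_apply, kos2_apply, kos2_apply, Finset.sum_sub_distrib]

variable {a b c : k} {α β : Fin 3 → End k M}

lemma kos2_kos1 {γ : Fin 3 → End k M} (hγ : IsSkl a b c γ) (g : Fin 3 → M) :
    kos2 γ (kos1 a b c γ g) = 0 := by
  have h := fun l => LinearMap.congr_fun (hγ l) (g l)
  have h0 := h 0
  have h1 := h 1
  have h2 := h 2
  simp [Fin.sum_univ_three, kos2_apply, kos1_apply] at h0 h1 h2 ⊢
  rw [← add_zero (0 : M), ← add_zero ((0 : M) + 0)]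
  nth_rewrite 1 [← h0]
  nth_rewrite 1 [← h1]
  nth_rewrite 1 [← h2]
  abel

/-- Commuting actions. -/
structure BiSkl (a b c : k) (α β : Fin 3 → End k M) : Prop where
  left : IsSkl a b c α
  right : IsSkl b a c β
  comm : ∀ i j m, α i (β j m) = β j (α i m)

lemma BiSkl.bi1_bi0 (h : BiSkl a b c α β) (m : M) : bi1 a b c α β (bi0 α β m) = 0 := by
  have e1 := kos1_kos0 h.left m
  have e2 := kos1_kos0 h.right m
  have e3 : kos1 b a c β (kos0 α m) = kos1 a b c α (kos0 β m) := by
    funext l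
    simp only [kos1_apply, kos0_apply, h.comm]
    abel
  rw [bi1, bi0, LinearMap.add_apply, LinearMap.sub_apply, map_sub, map_sub, e1, e2, e3]
  abel

lemma BiSkl.bi2_bi1 (h : BiSkl a b c α β) (g : Fin 3 → M) : bi2 α β (bi1 a b c α β g) = 0 := by
  have e1 := kos2_kos1 h.left g
  have e2 := kos2_kos1 h.right g
  have e3 : kos2 β (kos1 a b c α g) = kos2 α (kos1 b a c β g) := by
    simp [kos2_apply, kos1_apply, Fin.sum_univ_three, ← h.comm]
    abel
  rw [bi1, bi2, LinearMap.add_apply, LinearMap.sub_apply, map_add, map_add, e1, e2, e3]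
  abel

/-- Exactness of the Koszul complex of a bimodule. -/
structure BiExact (a b c : k) (α β : Fin 3 → End k M) : Prop where
  inj : ∀ m, bi0 α β m = 0 → m = 0
  ex1 : ∀ g, bi1 a b c α β g = 0 → ∃ m, bi0 α β m = g
  ex2 : ∀ g, bi2 α β g = 0 → ∃ f, bi1 a b c α β f = g

lemma BiSkl.biExact_of_left (h : BiSkl a b c α β) (hα : KosExact a b c α) {P : ℕ → M →ₗ[k] M}
    (hP : Grading P) (h0 : ∀ i m, P 0 (α i m) = 0) (hs : ∀ j i m, P (j + 1) (α i m) = α i (P j m))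
    (hβ : ∀ j i m, P j (β i m) = β i (P j m)) : BiExact a b c α β := by
  have hP3 := hP.pi
  refine ⟨fun m hm => ?_, fun g hg => ?_, fun g hg => ?_⟩
  · obtain ⟨x, hx⟩ := Grading.exists_of_raise (X := PUnit.{1}) (P := fun _ => 0)
      (R := fun j => LinearMap.pi fun l : Fin 3 => P j ∘ₗ LinearMap.proj (R := k) l)
      ⟨fun _ _ => rfl, fun _ _ _ _ => rfl, fun _ => ⟨0, fun _ _ => rfl⟩, fun _ _ => rfl⟩ hP
      0 0 (kos0 α) (-kos0 β) (by simp) (by simp) (by simp)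
      (fun j y => funext fun l => hs j l y) (fun j y => funext fun l => by
        simp [kos0_apply, hβ])
      (fun y hy => ⟨0, (hα.inj y hy).symm⟩) (by simp) m
      (by rw [LinearMap.neg_apply, ← sub_eq_add_neg]; exact hm)
    simpa using hx.symm
  · obtain ⟨x, hx⟩ := Grading.exists_of_raise hP hP3
      (R := fun j => LinearMap.pi fun l : Fin 3 => P j ∘ₗ LinearMap.proj (R := k) l)
      (kos0 α) (-kos0 β) (kos1 a b c α) (kos1 b a c β)
      (fun j y => funext fun l => hs j l y) (fun y => funext fun l => h0 l y)
      (fun j y => funext fun l => by simp [kos0_apply, hβ])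
      (fun j y => funext fun l => by simp [kos1_apply, hs])
      (fun j y => funext fun l => by simp [kos1_apply, hβ])
      hα.ex1 (fun x => by
        have := h.bi1_bi0 x
        simp only [bi1, bi0, LinearMap.add_apply, LinearMap.sub_apply, map_sub] at this
        simp only [LinearMap.neg_apply, map_neg]
        rw [← this]; abel) g hg
    exact ⟨x, by rw [← hx, LinearMap.neg_apply, ← sub_eq_add_neg]; rfl⟩
  · obtain ⟨x, hx⟩ := Grading.exists_of_raise hP3 hP3 (R := P)
      (kos1 a b c α) (kos1 b a c β) (kos2 α) (-kos2 β)
      (fun j y => funext fun l => by simp [kos1_apply, hs])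
      (fun y => funext fun l => by simp [kos1_apply, h0])
      (fun j y => funext fun l => by simp [kos1_apply, hβ])
      (fun j y => by simp [kos2_apply, hs])
      (fun j y => by simp [kos2_apply, hβ])
      hα.ex2 (fun x => by
        have := h.bi2_bi1 x
        simp only [bi1, bi2, LinearMap.add_apply, LinearMap.sub_apply, map_add] at this
        simp only [LinearMap.neg_apply]
        rw [← this]; abel) g (by
          rw [LinearMap.neg_apply, ← sub_eq_add_neg]; exact hg)
    exact ⟨x, hx⟩

lemma BiSkl.symm (h : BiSkl a b c α β) : BiSkl b a c β α :=
  ⟨h.right, h.left, fun i j m => (h.comm j i m).symm⟩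

lemma bi0_symm : bi0 β α = -bi0 α β := by rw [bi0, bi0, neg_sub]

lemma bi1_symm : bi1 b a c β α = bi1 a b c α β := by rw [bi1, bi1, add_comm]

lemma bi2_symm : bi2 β α = -bi2 α β := by rw [bi2, bi2, neg_sub]

lemma BiExact.symm (h : BiExact b a c β α) : BiExact a b c α β := by
  refine ⟨fun m hm => h.inj m ?_, fun g hg => ?_, fun g hg => ?_⟩
  · rw [bi0_symm, LinearMap.neg_apply, hm, neg_zero]
  · obtain ⟨m, hm⟩ := h.ex1 g (by rw [bi1_symm]; exact hg)
    exact ⟨-m, by rw [← hm, bi0_symm (α := β), LinearMap.neg_apply, map_neg, neg_neg]⟩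
  · obtain ⟨m, hm⟩ := h.ex2 g (by rw [bi2_symm, LinearMap.neg_apply, hg, neg_zero])
    exact ⟨m, by rw [← hm, bi1_symm]⟩

end Bi

end SklAz

namespace SklAz

open Module Matrix TensorProduct

section Instances

variable {k : Type*} [Field k] {a b c : k}

lemma isSkl_lgen : IsSkl a b c (lgen a b c) := fun l => LinearMap.ext fun s => by
  have := congrArg (· * s) (isSkl_gen (a := a) (b := b) (c := c) l)
  simpa [add_mul, mul_assoc] using this

lemma isSkl_rgen : IsSkl b a c (rgen a b c) := fun l => LinearMap.ext fun s => by
  have := congrArg (s * ·) (isSkl_gen (a := a) (b := b) (c := c) l)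
  simp only [mul_add, mul_zero, mul_smul_comm] at this
  simp only [LinearMap.add_apply, LinearMap.smul_apply, Module.End.mul_apply, rgen_apply, mul_assoc,
    LinearMap.zero_apply]
  rw [← this]; abel

lemma IsSkl.map {R R' : Type*} [Ring R] [Algebra k R] [Ring R'] [Algebra k R'] (Φ : R →ₐ[k] R')
    {y : Fin 3 → R} (h : IsSkl a b c y) : IsSkl a b c fun i => Φ (y i) := fun l => by
  simpa using congrArg Φ (h l)

lemma grading_proj : Grading (fun n => (proj n : Sklyanin k a b c →ₗ[k] _)) where
  idem j y := proj_of_mem (proj_mem j y)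
  orth _ j y h := proj_of_mem_ne (proj_mem j y) h.symm
  bound := exists_proj_bound
  zero _ := eq_zero_of_proj

variable {A : Type*} [Ring A] [Algebra k A] (ρ : Sklyanin k a b c →ₐ[k] A)

/-- The action of the generators on `S ⊗ A` by left multiplication on the second factor. -/
def tenL (i : Fin 3) : End k (Sklyanin k a b c ⊗[k] A) :=
  LinearMap.mulLeft k (1 ⊗ₜ ρ (gen i))

variable (A) in
/-- The action of the generators on `S ⊗ A` by right multiplication on the first factor. -/
def tenR (a b c : k) (i : Fin 3) : End k (Sklyanin k a b c ⊗[k] A) :=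
  LinearMap.mulRight k (gen i ⊗ₜ 1)

@[simp] lemma tenL_apply (i : Fin 3) (u : Sklyanin k a b c ⊗[k] A) :
    tenL ρ i u = (1 ⊗ₜ ρ (gen i)) * u := rfl

@[simp] lemma tenR_apply (i : Fin 3) (u : Sklyanin k a b c ⊗[k] A) :
    tenR A a b c i u = u * (gen i ⊗ₜ 1) := rfl

lemma tenR_eq (i : Fin 3) : tenR A a b c i = LinearMap.rTensor A (rgen a b c i) :=
  TensorProduct.ext' fun s x => by simp

/-- `f ↦ f ⊗ id` as an algebra homomorphism. -/
def rTen (M N : Type*) [AddCommGroup M] [Module k M] [AddCommGroup N] [Module k N] :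
    End k M →ₐ[k] End k (M ⊗[k] N) :=
  AlgHom.ofLinearMap (LinearMap.rTensorHom N) (LinearMap.rTensor_id N M)
    (fun f g => LinearMap.rTensor_comp N f g)

lemma tenR_eq_rTen : tenR A a b c = fun i => rTen (Sklyanin k a b c) A (rgen a b c i) :=
  funext tenR_eq

lemma biSkl_ten : BiSkl a b c (tenL ρ) (tenR A a b c) where
  left l := LinearMap.ext fun u => by
    have := congrArg (fun s => ((1 : Sklyanin k a b c) ⊗ₜ[k] ρ s) * u)
      (isSkl_gen (a := a) (b := b) (c := c) l)
    simp only [map_add, map_smul, map_mul, map_zero, tmul_zero, zero_mul, tmul_add, add_mul,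
      tmul_smul, smul_mul_assoc] at this
    simp only [LinearMap.add_apply, LinearMap.smul_apply, Module.End.mul_apply, tenL_apply,
      LinearMap.zero_apply, ← mul_assoc, Algebra.TensorProduct.tmul_mul_tmul, mul_one]
    exact this
  right := by
    rw [tenR_eq_rTen]
    exact isSkl_rgen.map _
  comm i j u := (mul_assoc _ _ _).symm

lemma grading_rTensor {M N : Type*} [AddCommGroup M] [Module k M] [AddCommGroup N] [Module k N]
    {P : ℕ → M →ₗ[k] M} (hP : Grading P)
    (hsum : ∀ y, ∃ N, ∀ n, N ≤ n → ∑ j ∈ Finset.range n, P j y = y) :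
    Grading fun n => (P n).rTensor N where
  idem j y := by
    rw [← LinearMap.rTensor_comp_apply]
    congr 2
    exact LinearMap.ext (hP.idem j)
  orth i j y h := by
    rw [← LinearMap.rTensor_comp_apply]
    have : P i ∘ₗ P j = 0 := LinearMap.ext fun x => hP.orth i j x h
    rw [this, LinearMap.rTensor_zero, LinearMap.zero_apply]
  bound y := by
    induction y with
    | zero => exact ⟨0, by simp⟩
    | tmul s x =>
      obtain ⟨N, h⟩ := hP.bound s
      exact ⟨N, fun j hj => by rw [LinearMap.rTensor_tmul, h j hj, zero_tmul]⟩
    | add u v hu hv =>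
      obtain ⟨N, hN⟩ := hu
      obtain ⟨N', hN'⟩ := hv
      exact ⟨max N N', fun j hj => by
        rw [map_add, hN j (le_trans (le_max_left _ _) hj), hN' j (le_trans (le_max_right _ _) hj),
          add_zero]⟩
  zero y hy := by
    suffices h : ∃ N', ∀ n, N' ≤ n → ∑ j ∈ Finset.range n, (P j).rTensor N y = y by
      obtain ⟨n, hn⟩ := h
      rw [← hn n le_rfl]
      exact Finset.sum_eq_zero fun j _ => hy j
    clear hy
    induction y with
    | zero => exact ⟨0, by simp⟩
    | tmul s x =>
      obtain ⟨N, h⟩ := hsum s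
      exact ⟨N, fun n hn => by simp only [LinearMap.rTensor_tmul, ← sum_tmul, h n hn]⟩
    | add u v hu hv =>
      obtain ⟨N, hN⟩ := hu
      obtain ⟨N', hN'⟩ := hv
      exact ⟨max N N', fun j hj => by
        simp only [map_add, Finset.sum_add_distrib]
        rw [hN j (le_trans (le_max_left _ _) hj), hN' j (le_trans (le_max_right _ _) hj)]⟩

lemma exists_sum_proj (y : Sklyanin k a b c) :
    ∃ N, ∀ n, N ≤ n → ∑ j ∈ Finset.range n, proj j y = y := by
  obtain ⟨N, hN⟩ := exists_proj_bound y
  exact ⟨N, fun n hn => sum_proj_eq y fun j hj => hN j (hn.trans hj)⟩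

theorem biExact_ten [IsAlgClosed k] (h : Nondeg a b c) :
    BiExact a b c (tenL ρ) (tenR A a b c) := by
  refine ((biSkl_ten ρ).symm.biExact_of_left ?_ (grading_rTensor grading_proj exists_sum_proj)
    ?_ ?_ ?_).symm
  · rw [tenR_eq_rTen]
    exact (((kosExact_rgen h).kosSplit isSkl_rgen).map _).kosExact
  · intro i m
    rw [tenR_eq, ← LinearMap.rTensor_comp_apply]
    have : proj 0 ∘ₗ rgen a b c i = 0 := LinearMap.ext fun s => proj_zero_mul_gen _ _
    rw [this, LinearMap.rTensor_zero, LinearMap.zero_apply]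
  · intro j i m
    rw [tenR_eq, ← LinearMap.rTensor_comp_apply, ← LinearMap.rTensor_comp_apply]
    have : proj (j + 1) ∘ₗ rgen a b c i = rgen a b c i ∘ₗ proj j :=
      LinearMap.ext fun s => proj_mul_gen _ _ _
    rw [this]
  · intro j i u
    induction u with
    | zero => simp
    | tmul s x => simp
    | add u v hu hv => simp only [map_add, hu, hv]

/-- The action of the generators on `Hom(A, S)` by left multiplication on values. -/
def homL (A : Type*) [Ring A] [Algebra k A] (a b c : k) (i : Fin 3) :
    End k (A →ₗ[k] Sklyanin k a b c) :=
  LinearMap.compRight k (lgen a b c i)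

/-- The action of the generators on `Hom(A, S)` by left multiplication on arguments. -/
def homR (i : Fin 3) : End k (A →ₗ[k] Sklyanin k a b c) :=
  LinearMap.lcomp k _ (LinearMap.mulLeft k (ρ (gen i)))

@[simp] lemma homL_apply (i : Fin 3) (F : A →ₗ[k] Sklyanin k a b c) (x : A) :
    homL A a b c i F x = gen i * F x := rfl

@[simp] lemma homR_apply (i : Fin 3) (F : A →ₗ[k] Sklyanin k a b c) (x : A) :
    homR ρ i F x = F (ρ (gen i) * x) := rfl

/-- Composition as an algebra homomorphism. -/
def compRightAlg (M N : Type*) [AddCommGroup M] [Module k M] [AddCommGroup N] [Module k N] :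
    End k M →ₐ[k] End k (N →ₗ[k] M) where
  toFun f := LinearMap.compRight k f
  map_one' := rfl
  map_mul' _ _ := rfl
  map_zero' := rfl
  map_add' _ _ := rfl
  commutes' _ := rfl

lemma biSkl_hom : BiSkl a b c (homL A a b c) (homR ρ) where
  left := isSkl_lgen.map (compRightAlg (Sklyanin k a b c) A)
  right l := LinearMap.ext fun F => LinearMap.ext fun x => by
    have := congrArg (fun s => F (ρ s * x)) (isSkl_gen (a := a) (b := b) (c := c) l)
    simp only [map_add, map_smul, map_mul, map_zero, zero_mul, add_mul, smul_mul_assoc] at this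
    simp only [LinearMap.add_apply, LinearMap.smul_apply, Module.End.mul_apply, homR_apply,
      LinearMap.zero_apply, ← mul_assoc]
    rw [← this]; abel
  comm i j F := rfl

lemma Grading.hom {M N : Type*} [AddCommGroup M] [Module k M] [AddCommGroup N] [Module k N]
    [FiniteDimensional k N] {P : ℕ → M →ₗ[k] M} (hP : Grading P) :
    Grading fun n => (LinearMap.compRight k (P n) : End k (N →ₗ[k] M)) where
  idem j y := LinearMap.ext fun x => hP.idem j (y x)
  orth i j y h := LinearMap.ext fun x => hP.orth i j (y x) h
  bound y := by
    choose b hb using fun i => hP.bound (y (finBasis k N i))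
    refine ⟨∑ i, b i, fun j hj => (finBasis k N).ext fun i => hb i j (le_trans ?_ hj)⟩
    exact Finset.single_le_sum (fun _ _ => Nat.zero_le _) (Finset.mem_univ i)
  zero y hy := LinearMap.ext fun x => hP.zero _ fun j => LinearMap.congr_fun (hy j) x

theorem biExact_hom [FiniteDimensional k A] [IsAlgClosed k] (h : Nondeg a b c) :
    BiExact a b c (homL A a b c) (homR ρ) :=
  (biSkl_hom ρ).biExact_of_left
    (((kosExact_lgen h).kosSplit isSkl_lgen).map (compRightAlg _ A)).kosExact
    (grading_proj.hom (N := A))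
    (fun _ _ => LinearMap.ext fun _ => proj_zero_gen_mul _ _)
    (fun _ _ _ => LinearMap.ext fun _ => proj_gen_mul _ _ _)
    (fun _ _ _ => rfl)

end Instances

end SklAz

namespace SklAz

open Module Matrix

section Capelli

/-- An algebra without zero divisors that maps onto `n × n` matrices cannot be generated, up to
multiplication by a nonzero central element, by fewer than `n²` elements. -/
theorem sq_le_of_generators {R S k : Type*} [CommRing R] [Ring S] [Algebra R S] [NoZeroDivisors S]
    [Field k] {n r : ℕ} (hn : 0 < n) (ρ : S →+* Matrix (Fin n) (Fin n) k)
    (hρ : Function.Surjective ρ) (f : R) (hf : algebraMap R S f ≠ 0) (b : Fin r → S)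
    (hb : ∀ s, ∃ z : Fin r → R, f • s = ∑ j, z j • b j) : n * n ≤ r := by
  classical
  by_contra! hlt
  obtain ⟨p⟩ : Nonempty (Fin (r + 1) ↪ Fin n × Fin n) :=
    Function.Embedding.nonempty_of_card_le (by simpa using hlt)
  let o : Fin n := ⟨0, hn⟩
  choose s hs using fun l => hρ (Matrix.single (p l).1 (p l).2 1)
  choose w hw using fun l => hρ (Matrix.single o (p l).1 1)
  choose v hv using fun l => hρ (Matrix.single (p l).2 o 1)
  have hT : ∀ l m, ρ (w l * s m * v l) = if m = l then Matrix.single o o 1 else 0 := by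
    intro l m
    rw [map_mul, map_mul, hs, hw, hv]
    by_cases h1 : (p l).1 = (p m).1
    · by_cases h2 : (p m).2 = (p l).2
      · have : m = l := p.injective (Prod.ext h1.symm h2)
        subst this
        simp
      · have : m ≠ l := fun h => h2 (by rw [h])
        rw [if_neg this, ← h1, Matrix.single_mul_single_same, Matrix.single_mul_single_of_ne _ _ _ _ h2]
    · have : m ≠ l := fun h => h1 (by rw [h])
      rw [if_neg this, Matrix.single_mul_single_of_ne _ _ _ _ h1, zero_mul]
  let T : ∀ _ : Fin (r + 1), S →ₗ[R] S := fun l =>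
    LinearMap.mulRight R (v l) ∘ₗ LinearMap.mulLeft R (w l)
  let F : S [⋀^Fin (r + 1)]→ₗ[R] S :=
    MultilinearMap.alternatization ((MultilinearMap.mkPiAlgebraFin R (r + 1) S).compLinearMap T)
  choose z hz using fun l => hb (s l)
  have hF : F s = 0 := by
    have h1 : F (fun l => f • s l) = 0 := by
      have : (fun l => f • s l) = fun l => ∑ j, z l j • b j := funext hz
      rw [this, ← AlternatingMap.coe_multilinearMap, MultilinearMap.map_sum]
      refine Finset.sum_eq_zero fun φ _ => ?_
      rw [MultilinearMap.map_smul_univ F.toMultilinearMap (fun i => z i (φ i)) (fun i => b (φ i))]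
      have : F.toMultilinearMap (fun i => b (φ i)) = 0 :=
        F.map_eq_zero_of_not_injective _ fun hinj => by
          have h2 : Function.Injective φ := fun x y hxy => hinj (by simp only [hxy])
          have := Fintype.card_le_of_injective φ h2
          simp at this
      rw [this, smul_zero]
    have h2 : F (fun l => f • s l) = (∏ _l : Fin (r + 1), f) • F s :=
      F.toMultilinearMap.map_smul_univ (fun _ => f) s
    rw [h2, Finset.prod_const, Algebra.smul_def, map_pow] at h1
    exact (mul_eq_zero.1 h1).resolve_left (pow_ne_zero _ hf)
  have h3 : F s = ∑ σ : Equiv.Perm (Fin (r + 1)), Equiv.Perm.sign σ •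
      (List.ofFn fun l => w l * s (σ l) * v l).prod := by
    rw [MultilinearMap.alternatization_apply]
    rfl
  have h4 : ρ (F s) = Matrix.single o o 1 := by
    rw [h3, map_sum, Finset.sum_eq_single 1]
    · have : ∀ l, ρ (w l * s l * v l) = Matrix.single o o 1 := fun l => by rw [hT, if_pos rfl]
      simp only [Equiv.Perm.sign_one, one_smul, Equiv.Perm.one_apply, map_list_prod, List.map_ofFn,
        Function.comp_def, this, List.ofFn_const, List.prod_replicate]
      clear h3 hF hz hT hs hw hv F T z this s w v p hlt hb b
      induction r with
      | zero => simp
      | succ r ih => rw [pow_succ, ih]; simp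
    · intro σ _ hσ
      have : (List.ofFn fun l => ρ (w l * s (σ l) * v l)).prod = 0 := by
        obtain ⟨l, hl⟩ : ∃ l, σ l ≠ l := by
          by_contra! h
          exact hσ (Equiv.ext h)
        exact List.prod_eq_zero (List.mem_ofFn.2 ⟨l, by rw [hT, if_neg hl]⟩)
      rw [Units.smul_def, map_zsmul, map_list_prod, List.map_ofFn, Function.comp_def, this,
        smul_zero]
    · simp
  rw [hF, map_zero] at h4
  simpa using congrFun (congrFun h4 o) o

end Capelli

end SklAz

namespace SklAz

open Module Matrix

section Points

variable {k : Type*} [Field k]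

/-- A finite-dimensional simple module over an algebra gives a surjection onto matrices. -/
theorem exists_matrix_surjection [IsAlgClosed k] {S M : Type*} [Ring S] [Algebra k S] [AddCommGroup M] [Module k M]
    [Module S M] [IsScalarTower k S M] [IsSimpleModule S M] {n : ℕ} (hn : 0 < n)
    (hM : Module.rank k M = n) :
    ∃ ρ : S →+* Matrix (Fin n) (Fin n) k, Function.Surjective ρ := by
  have hfr : finrank k M = n := finrank_eq_of_rank_eq hM
  have : FiniteDimensional k M := FiniteDimensional.of_finrank_pos (by omega)
  let e : End k M ≃ₐ[k] Matrix (Fin n) (Fin n) k := LinearMap.toMatrixAlgEquiv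
    (finBasisOfFinrankEq k M hfr)
  refine ⟨(e : End k M →+* _).comp (Module.toModuleEnd k (S := S) M), ?_⟩
  refine e.surjective.comp fun g => ?_
  classical
  let g' : End (End S M) M :=
    { toFun := g
      map_add' := map_add g
      map_smul' := fun φ x => by
        obtain ⟨t, rfl⟩ := (IsSimpleModule.algebraMap_end_bijective_of_isAlgClosed (A := S) k).2 φ
        simp }
  let B := finBasisOfFinrankEq k M hfr
  obtain ⟨s, hs⟩ := jacobson_density (R := S) g' (Finset.univ.image B)
  refine ⟨s, B.ext fun i => ?_⟩
  exact (hs (B i) (by simp)).symm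

/-- Matrix quotients of an algebra have size bounded by the dimension of simple modules. -/
theorem size_le_of_bound {S : Type*} [Ring S] [Algebra k S] {n e : ℕ} [Small.{0} k] (he : 0 < e)
    (ρ : S →ₐ[k] Matrix (Fin e) (Fin e) k) (hρ : Function.Surjective ρ)
    (hbound : ∀ (M : Type) (_ : AddCommGroup M) (_ : Module k M) (_ : Module S M)
      (_ : IsScalarTower k S M), IsSimpleModule S M → Module.rank k M ≤ n) : e ≤ n := by
  classical
  let _ : Module S (Fin e → k) := Module.compHom _
    ((Matrix.toLinAlgEquiv' : Matrix (Fin e) (Fin e) k ≃ₐ[k] _).toAlgHom.comp ρ).toRingHom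
  have hsmul : ∀ (s : S) (v : Fin e → k), s • v = ρ s *ᵥ v := fun s v => rfl
  have : Nonempty (Fin e) := ⟨⟨0, he⟩⟩
  have hsimple : IsSimpleModule S (Fin e → k) := by
    rw [isSimpleModule_iff_toSpanSingleton_surjective]
    refine ⟨inferInstance, fun v hv w => ?_⟩
    obtain ⟨i, hi⟩ := Function.ne_iff.1 hv
    obtain ⟨s, hs⟩ := hρ (vecMulVec w (Pi.single i (v i)⁻¹))
    refine ⟨s, ?_⟩
    rw [LinearMap.toSpanSingleton_apply, hsmul, hs, vecMulVec_mulVec]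
    have : v i ≠ 0 := hi
    simp [this]
  have htower : IsScalarTower k S (Fin e → k) := ⟨fun r s v => by
    rw [hsmul, hsmul, map_smul, smul_mulVec]⟩
  have hs' : IsSimpleModule S (Shrink.{0} (Fin e → k)) :=
    IsSimpleModule.congr (Shrink.linearEquiv S (Fin e → k))
  have ht' : IsScalarTower k S (Shrink.{0} (Fin e → k)) := ⟨fun r s v => by
    apply (equivShrink (Fin e → k)).symm.injective
    simp [equivShrink_symm_smul]⟩
  have h := hbound (Shrink.{0} (Fin e → k)) inferInstance inferInstance inferInstance ht' hs'
  have h2 : finrank k (Shrink.{0} (Fin e → k)) = e := by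
    rw [(Shrink.linearEquiv k (Fin e → k)).finrank_eq]; simp
  rw [← h2]
  have h3 : FiniteDimensional k (Shrink.{0} (Fin e → k)) :=
    FiniteDimensional.of_finrank_pos (by rw [h2]; exact he)
  rw [← finrank_eq_rank] at h
  exact_mod_cast h

lemma small_of_rank_pos {M : Type} [AddCommGroup M] [Module k M] {n : ℕ} (hn : 0 < n)
    (hM : Module.rank k M = n) : Small.{0} k := by
  have : Nontrivial M := by
    rw [← rank_pos_iff_nontrivial (R := k), hM]
    exact_mod_cast hn
  obtain ⟨v, hv⟩ := exists_ne (0 : M)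
  exact small_of_injective (f := fun r : k => r • v) (smul_left_injective k hv)

/-- A maximal ideal of an affine algebra is the kernel of a character. -/
theorem exists_character [IsAlgClosed k] {Z : Type*} [CommRing Z] [Algebra k Z] [Algebra.FiniteType k Z]
    (m : Ideal Z) [hm : m.IsMaximal] : ∃ ε : Z →ₐ[k] k, ∀ z, ε z = 0 ↔ z ∈ m := by
  let _ : Field (Z ⧸ m) := Ideal.Quotient.field m
  have : Module.Finite k (Z ⧸ m) := finite_of_finite_type_of_isJacobsonRing k _
  let e := AlgEquiv.ofBijective (Algebra.ofId k (Z ⧸ m))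
    (IsAlgClosed.algebraMap_bijective_of_isIntegral (k := k))
  refine ⟨(e.symm : (Z ⧸ m) →ₐ[k] k).comp (Ideal.Quotient.mkₐ k m), fun z => ?_⟩
  rw [← Ideal.Quotient.eq_zero_iff_mem]
  exact e.symm.map_eq_zero_iff (x := Ideal.Quotient.mk m z)

/-- Nakayama's lemma away from a closed subset. -/
theorem exists_smul_mem_of_sup {Z M : Type*} [CommRing Z] [AddCommGroup M] [Module Z M]
    [Module.Finite Z M] (m : Ideal Z) [hm : m.IsMaximal] (N : Submodule Z M)
    (h : ∀ x : M, ∃ y ∈ N, x - y ∈ m • (⊤ : Submodule Z M)) :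
    ∃ f : Z, f ∉ m ∧ ∀ x : M, f • x ∈ N := by
  obtain ⟨f, hf, hf2⟩ := Submodule.exists_sub_one_mem_and_smul_eq_zero_of_fg_of_le_smul m
    (⊤ : Submodule Z (M ⧸ N)) Module.Finite.fg_top (fun q _ => by
      obtain ⟨x, rfl⟩ := N.mkQ_surjective q
      obtain ⟨y, hy, hxy⟩ := h x
      have h1 : N.mkQ x = N.mkQ (x - y) := by
        rw [map_sub, (Submodule.Quotient.mk_eq_zero N (x := y)).2 hy |> fun h => (show N.mkQ y = 0 from h),
          sub_zero]
      rw [h1, ← N.range_mkQ, LinearMap.range_eq_map, ← Submodule.map_smul'']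
      exact Submodule.mem_map_of_mem hxy)
  refine ⟨f, fun hfm => hm.ne_top ((Ideal.eq_top_iff_one m).2 ?_), fun x => ?_⟩
  · have := m.sub_mem hfm hf
    simpa using this
  · rw [← Submodule.Quotient.mk_eq_zero, Submodule.Quotient.mk_smul]
    exact hf2 _ trivial

end Points

end SklAz

namespace SklAz

open Module Matrix

section Casimir

variable {k : Type*} [Field k]

/-- A finite-dimensional algebra in characteristic zero with a symmetrising form whose Casimir map
takes scalar values is simple. -/
theorem isSimpleRing_of_casimir [CharZero k] {A ι : Type*} [Ring A] [Algebra k A] [Nontrivial A]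
    [FiniteDimensional k A] [Fintype ι] (p q : ι → A) (t : A →ₗ[k] k)
    (ht : ∀ x y, t (x * y) = t (y * x)) (hx : ∀ x, ∑ i, t (p i * x) • q i = x)
    (hc : ∀ s, ∃ r : k, ∑ i, q i * s * p i = algebraMap k A r) : IsSimpleRing A := by
  choose c hc using hc
  have hL : ∀ s, LinearMap.trace k A (LinearMap.mulLeft k s) = c 1 * t s := by
    intro s
    have e : LinearMap.mulLeft k s =
        ∑ i, (t ∘ₗ LinearMap.mulLeft k (p i)).smulRight (s * q i) := by
      refine LinearMap.ext fun x => ?_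
      simp only [LinearMap.mulLeft_apply, LinearMap.sum_apply, LinearMap.smulRight_apply,
        LinearMap.comp_apply]
      conv_lhs => rw [← hx x]
      rw [Finset.mul_sum]
      simp
    rw [e, map_sum]
    have e2 : ∀ i, t (p i * (s * q i)) = t (s * (q i * 1 * p i)) := fun i => by
      rw [ht, mul_one, mul_assoc]
    simp only [LinearMap.trace_smulRight, LinearMap.comp_apply, LinearMap.mulLeft_apply, e2]
    rw [← map_sum, ← Finset.mul_sum, hc, ← Algebra.commutes, ← Algebra.smul_def, map_smul,
      smul_eq_mul]
  have hR : ∀ s, LinearMap.trace k A (LinearMap.mulRight k s) = c s * t 1 := by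
    intro s
    have e : LinearMap.mulRight k s =
        ∑ i, (t ∘ₗ LinearMap.mulLeft k (p i)).smulRight (q i * s) := by
      refine LinearMap.ext fun x => ?_
      simp only [LinearMap.mulRight_apply, LinearMap.sum_apply, LinearMap.smulRight_apply,
        LinearMap.comp_apply, LinearMap.mulLeft_apply]
      conv_lhs => rw [← hx x]
      rw [Finset.sum_mul]
      simp
    rw [e, map_sum]
    have e2 : ∀ i, t (p i * (q i * s)) = t (q i * s * p i) := fun i => ht _ _
    simp only [LinearMap.trace_smulRight, LinearMap.comp_apply, LinearMap.mulLeft_apply, e2]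
    rw [← map_sum, hc, Algebra.algebraMap_eq_smul_one, map_smul, smul_eq_mul]
  have hinj : ∀ x, (∀ y, t (y * x) = 0) → x = 0 := fun x h => by
    rw [← hx x]
    exact Finset.sum_eq_zero fun i _ => by rw [h, zero_smul]
  let B : A →ₗ[k] Dual k A := (LinearMap.mul k A).compr₂ t
  have hB : Function.Injective B := by
    rw [← LinearMap.ker_eq_bot, LinearMap.ker_eq_bot']
    intro x h
    refine hinj x fun y => ?_
    rw [ht]
    exact LinearMap.congr_fun h y
  let e : A ≃ₗ[k] Dual k A := LinearEquiv.ofInjectiveOfFinrankEq B hB Subspace.dual_finrank_eq.symm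
  have hLR : ∀ s, LinearMap.trace k A (LinearMap.mulLeft k s) =
      LinearMap.trace k A (LinearMap.mulRight k s) := by
    intro s
    rw [← LinearMap.trace_transpose', ← LinearMap.trace_conj' (LinearMap.mulRight k s) e]
    congr 1
    refine LinearMap.ext fun φ => ?_
    obtain ⟨y, rfl⟩ := e.surjective φ
    refine LinearMap.ext fun x => ?_
    simp only [LinearEquiv.conj_apply_apply, LinearEquiv.symm_apply_apply]
    change t (y * (s * x)) = t (y * s * x)
    rw [mul_assoc]
  have hc1 : c 1 ≠ 0 := by
    intro h
    have h1 := hL 1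
    rw [h, zero_mul, LinearMap.mulLeft_one, LinearMap.trace_id] at h1
    have : finrank k A ≠ 0 := finrank_pos.ne'
    exact this (by exact_mod_cast h1)
  have hmem : ∀ I : TwoSidedIdeal A, I ≠ ⊤ → ∀ x ∈ I, t x = 0 := by
    intro I hI x hxI
    have h1 : algebraMap k A (c x) ∈ I := by
      rw [← hc]
      exact sum_mem fun i _ => I.mul_mem_right _ _ (I.mul_mem_left _ _ hxI)
    have h2 : c x = 0 := by
      by_contra hne
      apply hI
      rw [← TwoSidedIdeal.one_mem_iff]
      have := I.mul_mem_left (algebraMap k A (c x)⁻¹) _ h1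
      rwa [← map_mul, inv_mul_cancel₀ hne, map_one] at this
    have h3 : c 1 * t x = 0 := by rw [← hL, hLR, hR, h2, zero_mul]
    exact (mul_eq_zero.1 h3).resolve_left hc1
  refine ⟨⟨fun I => ?_⟩⟩
  by_cases hI : I = ⊤
  · exact Or.inr hI
  · refine Or.inl ?_
    rw [eq_bot_iff]
    intro x hxI
    rw [TwoSidedIdeal.mem_bot]
    exact hinj x fun y => hmem I hI _ (I.mul_mem_left _ _ hxI)

end Casimir

end SklAz

namespace SklAz

open Module

section Reg

variable {R : Type*} [CommRing R] {M : Type*} [AddCommGroup M] [Module R M]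

variable (M) in
/-- `t` is a nonzerodivisor on `M`. -/
def Reg1 (t : R) : Prop := ∀ s : M, t • s = 0 → s = 0

variable (M) in
/-- `t₁` is a nonzerodivisor modulo `t₀`. -/
def Reg2 (t₀ t₁ : R) : Prop := ∀ s u : M, t₁ • s = t₀ • u → ∃ v, s = t₀ • v

variable (M) in
/-- `t₂` is a nonzerodivisor modulo `t₀` and `t₁`. -/
def Reg3 (t₀ t₁ t₂ : R) : Prop :=
  ∀ s u₀ u₁ : M, t₂ • s = t₀ • u₀ + t₁ • u₁ → ∃ v₀ v₁, s = t₀ • v₀ + t₁ • v₁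

variable {t₀ t₁ t₂ : R} {ι : Type*}

lemma Reg1.pi (h : Reg1 M t₀) : Reg1 (ι → M) t₀ := fun s hs =>
  funext fun i => h (s i) (congrFun hs i)

lemma Reg2.pi (h : Reg2 M t₀ t₁) : Reg2 (ι → M) t₀ t₁ := fun s u hs => by
  choose v hv using fun i => h (s i) (u i) (congrFun hs i)
  exact ⟨v, funext hv⟩

lemma Reg3.pi (h : Reg3 M t₀ t₁ t₂) : Reg3 (ι → M) t₀ t₁ t₂ := fun s u₀ u₁ hs => by
  choose v₀ v₁ hv using fun i => h (s i) (u₀ i) (u₁ i) (congrFun hs i)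
  exact ⟨v₀, v₁, funext hv⟩

end Reg

section Chase

variable {k : Type*} [Field k] {a b c : k} {E : Type*} [AddCommGroup E] [Module k E]
  {α β : Fin 3 → End k E} {R : Type*} [CommRing R] [Module R E]

/-- A commutative ring acts compatibly with two families of endomorphisms. -/
structure SMulBi (R : Type*) [CommRing R] [Module R E] (α β : Fin 3 → End k E) : Prop where
  left : ∀ (z : R) i m, α i (z • m) = z • α i m
  right : ∀ (z : R) i m, β i (z • m) = z • β i m

lemma SMulBi.bi0 (h : SMulBi R α β) (z : R) (m : E) : bi0 α β (z • m) = z • bi0 α β m :=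
  funext fun i => by simp [bi0_apply, h.left, h.right, smul_sub]

lemma SMulBi.bi1 [SMulCommClass k R E] (h : SMulBi R α β) (z : R) (g : Fin 3 → E) :
    bi1 a b c α β (z • g) = z • bi1 a b c α β g :=
  funext fun i => by
    simp only [bi1_apply, Pi.smul_apply, h.left, h.right, smul_add, smul_comm _ z]

lemma SMulBi.bi2 (h : SMulBi R α β) (z : R) (g : Fin 3 → E) :
    bi2 α β (z • g) = z • bi2 α β g := by
  simp only [bi2_apply, Pi.smul_apply, h.left, h.right, Finset.smul_sum, smul_sub]

lemma BiExact.eq_smul_of_bi0 [SMulCommClass k R E] (hx : BiExact a b c α β) (hb : BiSkl a b c α β)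
    (hR : SMulBi R α β) {t₀ : R} (h1 : Reg1 E t₀) (F : E) (G : Fin 3 → E)
    (hF : bi0 α β F = t₀ • G) : ∃ H, F = t₀ • H := by
  have e : bi1 a b c α β G = 0 := h1.pi _ (by rw [← hR.bi1, ← hF, hb.bi1_bi0])
  obtain ⟨H, rfl⟩ := hx.ex1 G e
  exact ⟨H, sub_eq_zero.1 (hx.inj _ (by rw [map_sub, hF, hR.bi0, sub_self]))⟩

lemma BiExact.eq_smul_add_smul_of_bi0 [SMulCommClass k R E] (hx : BiExact a b c α β) (hb : BiSkl a b c α β)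
    (hR : SMulBi R α β) {t₀ t₁ : R} (h1 : Reg1 E t₀) (h2 : Reg2 E t₀ t₁) (F : E)
    (G₀ G₁ : Fin 3 → E) (hF : bi0 α β F = t₀ • G₀ + t₁ • G₁) :
    ∃ H₀ H₁, F = t₀ • H₀ + t₁ • H₁ := by
  have e : t₁ • bi1 a b c α β G₁ = t₀ • -bi1 a b c α β G₀ := by
    have := hb.bi1_bi0 F
    rw [hF, map_add, hR.bi1, hR.bi1] at this
    rw [smul_neg, ← sub_eq_zero, sub_neg_eq_add, add_comm, this]
  obtain ⟨P, hP⟩ := h2.pi _ _ e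
  have hP0 : bi1 a b c α β G₀ = -(t₁ • P) := by
    rw [← sub_eq_zero]
    refine h1.pi _ ?_
    rw [hP, smul_comm, smul_neg, ← sub_eq_zero, sub_neg_eq_add, add_comm] at e
    rw [sub_neg_eq_add, smul_add, e]
  have hPe : bi2 α β P = 0 := h1 _ (by rw [← hR.bi2, ← hP, hb.bi2_bi1])
  obtain ⟨Q, rfl⟩ := hx.ex2 P hPe
  obtain ⟨H₁, hH₁⟩ := hx.ex1 (G₁ - t₀ • Q) (by rw [map_sub, hR.bi1, hP, sub_self])
  obtain ⟨H₀, hH₀⟩ := hx.ex1 (G₀ + t₁ • Q) (by rw [map_add, hR.bi1, hP0, neg_add_cancel])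
  refine ⟨H₀, H₁, sub_eq_zero.1 (hx.inj _ ?_)⟩
  rw [map_sub, map_add, hR.bi0, hR.bi0, hH₀, hH₁, hF, smul_add, smul_sub, smul_comm t₁ t₀]
  abel

end Chase

section Hom

variable {k : Type*} [Field k] {a b c : k} {A : Type*} [Ring A] [Algebra k A]

/-- Multiplication by a central element, as a `k`-linear map. -/
def ctrMul (z : Ctr k a b c) : End k (Sklyanin k a b c) := LinearMap.mulLeft k (z : Sklyanin k a b c)

@[simp] lemma ctrMul_apply (z : Ctr k a b c) (s : Sklyanin k a b c) : ctrMul z s = z • s := rfl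

lemma mul_ctr_smul (z : Ctr k a b c) (x y : Sklyanin k a b c) : x * (z • y) = z • (x * y) := by
  rw [ctr_smul, ctr_smul, ← mul_assoc, center_comm, mul_assoc]

variable {t₀ t₁ t₂ : Ctr k a b c}

lemma Reg1.hom (h : Reg1 (Sklyanin k a b c) t₀) : Reg1 (A →ₗ[k] Sklyanin k a b c) t₀ := fun s hs =>
  LinearMap.ext fun i => h (s i) (LinearMap.congr_fun hs i)

lemma Reg2.hom (h : Reg2 (Sklyanin k a b c) t₀ t₁) : Reg2 (A →ₗ[k] Sklyanin k a b c) t₀ t₁ :=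
    fun s u hs => by
  obtain ⟨q, hq⟩ := exists_comp_eq_of_range_le (ctrMul t₀) s fun x => by
    obtain ⟨v, hv⟩ := h (s x) (u x) (LinearMap.congr_fun hs x)
    exact ⟨v, hv.symm⟩
  exact ⟨q, LinearMap.ext fun x => (hq x).symm⟩

lemma Reg3.hom (h : Reg3 (Sklyanin k a b c) t₀ t₁ t₂) :
    Reg3 (A →ₗ[k] Sklyanin k a b c) t₀ t₁ t₂ := fun s u₀ u₁ hs => by
  obtain ⟨q, hq⟩ := exists_comp_eq_of_range_le ((ctrMul t₀).coprod (ctrMul t₁)) s fun x => by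
    obtain ⟨v₀, v₁, hv⟩ := h (s x) (u₀ x) (u₁ x) (LinearMap.congr_fun hs x)
    exact ⟨(v₀, v₁), hv.symm⟩
  exact ⟨LinearMap.fst k _ _ ∘ₗ q, LinearMap.snd k _ _ ∘ₗ q, LinearMap.ext fun x => (hq x).symm⟩

lemma sMulBi_hom (ρ : Sklyanin k a b c →ₐ[k] A) :
    SMulBi (Ctr k a b c) (homL A a b c) (homR ρ) where
  left z i m := LinearMap.ext fun x => mul_ctr_smul z (gen i) (m x)
  right _ _ _ := rfl

/-- A fibre of the center: a surjection onto an algebra whose kernel is generated by `m`. -/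
structure Fibre (m : Ideal (Ctr k a b c)) (ρ : Sklyanin k a b c →ₐ[k] A) : Prop where
  surj : Function.Surjective ρ
  ker : ∀ s, ρ s = 0 ↔ s ∈ (m • ⊤ : Submodule (Ctr k a b c) (Sklyanin k a b c))

variable {m : Ideal (Ctr k a b c)} {ρ : Sklyanin k a b c →ₐ[k] A}

lemma mul_mem_of_mem_smul {N : Submodule (Ctr k a b c) (Sklyanin k a b c)}
    {s u : Sklyanin k a b c} (hs : ∀ z ∈ m, ∀ x : Sklyanin k a b c, z • (x * s) ∈ N)
    (hu : u ∈ (m • ⊤ : Submodule (Ctr k a b c) (Sklyanin k a b c))) : u * s ∈ N := by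
  induction hu using Submodule.smul_induction_on' with
  | smul z hz x _ => rw [smul_mul_assoc]; exact hs z hz x
  | add x _ y _ hx hy => rw [add_mul]; exact N.add_mem hx hy

lemma mul_mem_smul_top (I : Ideal (Ctr k a b c)) (x : Sklyanin k a b c) {u : Sklyanin k a b c}
    (hu : u ∈ (I • ⊤ : Submodule (Ctr k a b c) (Sklyanin k a b c))) :
    x * u ∈ (I • ⊤ : Submodule (Ctr k a b c) (Sklyanin k a b c)) := by
  induction hu using Submodule.smul_induction_on' with
  | smul z hz y _ => rw [mul_ctr_smul]; exact Submodule.smul_mem_smul hz trivial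
  | add y _ z _ hy hz => rw [mul_add]; exact Submodule.add_mem _ hy hz

/-- Over a field, the lifts through a fibre can be chosen linearly. -/
lemma Fibre.exists_section (hρ : Fibre m ρ) : ∃ j : A →ₗ[k] Sklyanin k a b c, ∀ x, ρ (j x) = x := by
  obtain ⟨j, hj⟩ := exists_comp_eq_of_range_le ρ.toLinearMap LinearMap.id fun x => hρ.surj x
  exact ⟨j, hj⟩

/-- The part of `Koszul` acyclicity modulo central elements that controls depth. -/
def HomClosed (ρ : Sklyanin k a b c →ₐ[k] A) (I : Ideal (Ctr k a b c)) : Prop :=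
  ∀ F : A →ₗ[k] Sklyanin k a b c,
    (∀ i x, bi0 (homL A a b c) (homR ρ) F i x ∈ (I • ⊤ : Submodule (Ctr k a b c) _)) →
      ∀ x, F x ∈ (I • ⊤ : Submodule (Ctr k a b c) _)

lemma Fibre.mem_of_smul_mem (hρ : Fibre m ρ) {I : Ideal (Ctr k a b c)} (hI : HomClosed ρ I)
    {s : Sklyanin k a b c} (hs : ∀ z ∈ m, z • s ∈ (I • ⊤ : Submodule (Ctr k a b c) _)) :
    s ∈ (I • ⊤ : Submodule (Ctr k a b c) (Sklyanin k a b c)) := by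
  obtain ⟨j, hj⟩ := hρ.exists_section
  have key : ∀ u ∈ (m • ⊤ : Submodule (Ctr k a b c) (Sklyanin k a b c)),
      u * s ∈ (I • ⊤ : Submodule (Ctr k a b c) (Sklyanin k a b c)) := fun u hu =>
    mul_mem_of_mem_smul (fun z hz x => by
      rw [← mul_ctr_smul]; exact mul_mem_smul_top I x (hs z hz)) hu
  have h1 := hI (LinearMap.mulRight k s ∘ₗ j) (fun i x => by
    have : gen i * j x - j (ρ (gen i) * x) ∈ (m • ⊤ : Submodule (Ctr k a b c) _) :=
      (hρ.ker _).1 (by rw [map_sub, map_mul, hj, hj, sub_self])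
    have := key _ this
    rwa [sub_mul, mul_assoc] at this) 1
  have h2 : 1 - j 1 ∈ (m • ⊤ : Submodule (Ctr k a b c) (Sklyanin k a b c)) :=
    (hρ.ker _).1 (by rw [map_sub, map_one, hj, sub_self])
  have h3 := Submodule.add_mem _ (key _ h2) h1
  rw [LinearMap.comp_apply, LinearMap.mulRight_apply, ← add_mul, sub_add_cancel, one_mul] at h3
  exact h3

lemma mem_span_singleton_smul_top {s : Sklyanin k a b c} :
    s ∈ (Ideal.span {t₀} • ⊤ : Submodule (Ctr k a b c) (Sklyanin k a b c)) ↔ ∃ u, t₀ • u = s := by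
  rw [Submodule.ideal_span_singleton_smul, Submodule.mem_smul_pointwise_iff_exists]
  simp

lemma mem_span_pair_smul_top {s : Sklyanin k a b c} :
    s ∈ (Ideal.span {t₀, t₁} • ⊤ : Submodule (Ctr k a b c) (Sklyanin k a b c)) ↔
      ∃ u v, t₀ • u + t₁ • v = s := by
  rw [Ideal.span_insert, Submodule.sup_smul, Submodule.mem_sup]
  simp only [mem_span_singleton_smul_top]
  constructor
  · rintro ⟨_, ⟨u, rfl⟩, _, ⟨v, rfl⟩, h⟩
    exact ⟨u, v, h⟩
  · rintro ⟨u, v, h⟩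
    exact ⟨_, ⟨u, rfl⟩, _, ⟨v, rfl⟩, h⟩

variable [IsAlgClosed k] [FiniteDimensional k A]

lemma homClosed_bot (ρ : Sklyanin k a b c →ₐ[k] A) (hN : Nondeg a b c) : HomClosed ρ ⊥ := by
  intro F hF
  simp only [Submodule.bot_smul, Submodule.mem_bot] at hF ⊢
  exact LinearMap.congr_fun ((biExact_hom ρ hN).inj F (funext fun i => LinearMap.ext (hF i)))

lemma homClosed_singleton (ρ : Sklyanin k a b c →ₐ[k] A) (hN : Nondeg a b c)
    (h1 : Reg1 (Sklyanin k a b c) t₀) : HomClosed ρ (Ideal.span {t₀}) := by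
  intro F hF
  simp only [mem_span_singleton_smul_top] at hF ⊢
  choose G hG using fun i => exists_comp_eq_of_range_le (ctrMul t₀) _ (hF i)
  obtain ⟨H, hH⟩ := (biExact_hom ρ hN).eq_smul_of_bi0 (biSkl_hom ρ) (sMulBi_hom ρ) h1.hom F G
    (funext fun i => LinearMap.ext fun x => (hG i x).symm)
  exact fun x => ⟨H x, by rw [hH]; rfl⟩

lemma homClosed_pair (ρ : Sklyanin k a b c →ₐ[k] A) (hN : Nondeg a b c)
    (h1 : Reg1 (Sklyanin k a b c) t₀) (h2 : Reg2 (Sklyanin k a b c) t₀ t₁) :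
    HomClosed ρ (Ideal.span {t₀, t₁}) := by
  intro F hF
  simp only [mem_span_pair_smul_top] at hF ⊢
  choose G hG using fun i => exists_comp_eq_of_range_le ((ctrMul t₀).coprod (ctrMul t₁))
    (bi0 (homL A a b c) (homR ρ) F i) fun x => by
      obtain ⟨u, v, h⟩ := hF i x
      exact ⟨(u, v), h⟩
  obtain ⟨H₀, H₁, hH⟩ := (biExact_hom ρ hN).eq_smul_add_smul_of_bi0 (biSkl_hom ρ) (sMulBi_hom ρ)
    h1.hom h2.hom F (fun i => LinearMap.fst k _ _ ∘ₗ G i) (fun i => LinearMap.snd k _ _ ∘ₗ G i)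
    (funext fun i => LinearMap.ext fun x => (hG i x).symm)
  exact fun x => ⟨H₀ x, H₁ x, by rw [hH]; rfl⟩

end Hom

section Avoid

variable {k : Type*} [Field k] {a b c : k} {A : Type*} [Ring A] [Algebra k A] [Nontrivial A]
  {m : Ideal (Ctr k a b c)} {ρ : Sklyanin k a b c →ₐ[k] A}

lemma Fibre.notMem_of_smul_one_mem (hρ : Fibre m ρ) [hm : m.IsMaximal] {f : Ctr k a b c}
    (h : f • (1 : Sklyanin k a b c) ∈ (m • ⊤ : Submodule (Ctr k a b c) (Sklyanin k a b c))) :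
    f ∈ m := by
  by_contra hf
  obtain ⟨g, u, hu, hg⟩ := Ideal.IsMaximal.exists_inv hm hf
  have h1 : (1 : Sklyanin k a b c) ∈ (m • ⊤ : Submodule (Ctr k a b c) (Sklyanin k a b c)) := by
    have h2 := Submodule.add_mem _ (Submodule.smul_mem _ g h)
      (Submodule.smul_mem_smul hu (trivial : (1 : Sklyanin k a b c) ∈ ⊤))
    rwa [smul_smul, ← add_smul, hg, one_smul] at h2
  have := (hρ.ker 1).2 h1
  rw [map_one] at this
  exact one_ne_zero this

/-- Prime avoidance: a regular element of `m` modulo `I` which is new in the cotangent space. -/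
theorem Fibre.exists_regular (hρ : Fibre m ρ) [hm : m.IsMaximal]
    [IsNoetherianRing (Ctr k a b c)] [Module.Finite (Ctr k a b c) (Sklyanin k a b c)]
    {I : Ideal (Ctr k a b c)} (hIm : I ≤ m) (hI : HomClosed ρ I) :
    ∃ t ∈ m, t ∉ m ^ 2 ⊔ I ∧ ∀ s : Sklyanin k a b c,
      t • s ∈ (I • ⊤ : Submodule (Ctr k a b c) (Sklyanin k a b c)) →
        s ∈ (I • ⊤ : Submodule (Ctr k a b c) (Sklyanin k a b c)) := by
  set N : Submodule (Ctr k a b c) (Sklyanin k a b c) := I • ⊤ with hN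
  have hle : ¬ m ≤ m ^ 2 ⊔ I := by
    intro hle
    obtain ⟨f, hf, hfm⟩ := exists_smul_mem_of_sup (M := m) m (Submodule.comap m.subtype I)
      (fun x => by
        obtain ⟨y, hy, z, hz, hyz⟩ := Submodule.mem_sup.1 (hle x.2)
        refine ⟨⟨z, hIm hz⟩, hz, ?_⟩
        have : x - ⟨z, hIm hz⟩ = ⟨y, Ideal.pow_le_self two_ne_zero hy⟩ :=
          Subtype.ext (by simp [← hyz])
        rw [this, Submodule.mem_smul_top_iff]
        rwa [smul_eq_mul, ← pow_two])
    refine hf (hρ.notMem_of_smul_one_mem (Submodule.smul_mono_left hIm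
      (hρ.mem_of_smul_mem hI fun z hz => ?_)))
    have := hfm ⟨z, hz⟩
    rw [smul_smul, mul_comm]
    exact Submodule.smul_mem_smul this trivial
  by_contra! hcon
  have hfin := associatedPrimes.finite (Ctr k a b c) (Sklyanin k a b c ⧸ N)
  have hsub : (m : Set (Ctr k a b c)) ⊆ ⋃ i ∈ insert none (hfin.toFinset.image some),
      ((Option.elim i (m ^ 2 ⊔ I) id : Ideal (Ctr k a b c)) : Set (Ctr k a b c)) := by
    intro t ht
    simp only [Set.mem_iUnion]
    by_cases htJ : t ∈ m ^ 2 ⊔ I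
    · exact ⟨none, Finset.mem_insert_self _ _, htJ⟩
    obtain ⟨s, hs, hsN⟩ := hcon t ht htJ
    have h1 : t ∈ ⋃ p ∈ associatedPrimes (Ctr k a b c) (Sklyanin k a b c ⧸ N),
        (p : Set (Ctr k a b c)) := by
      rw [biUnion_associatedPrimes_eq_zero_divisors]
      refine ⟨N.mkQ s, fun h => hsN ((Submodule.Quotient.mk_eq_zero N).1 h), ?_⟩
      rw [← map_smul]
      exact (Submodule.Quotient.mk_eq_zero N).2 hs
    simp only [Set.mem_iUnion] at h1
    obtain ⟨p, hp, htp⟩ := h1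
    exact ⟨some p, by simp [hp], htp⟩
  rw [← Finset.set_biUnion_coe, Ideal.subset_union_prime none none (fun i hi h _ => by
    simp only [Finset.mem_insert, Finset.mem_image, Set.Finite.mem_toFinset] at hi
    obtain rfl | ⟨p, hp, rfl⟩ := hi
    · exact absurd rfl h
    · exact hp.isPrime)] at hsub
  obtain ⟨i, hi, him⟩ := hsub
  simp only [Finset.mem_insert, Finset.mem_image, Set.Finite.mem_toFinset] at hi
  obtain rfl | ⟨p, hp, rfl⟩ := hi
  · exact hle him
  · obtain ⟨_, x, hx⟩ := (isAssociatedPrime_iff).1 hp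
    obtain ⟨s, rfl⟩ := N.mkQ_surjective x
    have hsN : s ∈ N := hρ.mem_of_smul_mem hI fun z hz => by
      have := him hz
      simp only [Option.elim, id] at this
      rw [hx, Submodule.mem_colon_singleton, Submodule.mem_bot, ← map_smul] at this
      exact (Submodule.Quotient.mk_eq_zero N).1 this
    have h1 : (1 : Ctr k a b c) ∈ p := by
      rw [hx, Submodule.mem_colon_singleton, one_smul]
      exact (Submodule.Quotient.mk_eq_zero N).2 hsN
    exact hp.isPrime.ne_top ((Ideal.eq_top_iff_one p).2 h1)

/-- A regular sequence of length three inside `m`, independent modulo `m ^ 2`. -/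
theorem Fibre.exists_regular_sequence [IsAlgClosed k] [FiniteDimensional k A] (hρ : Fibre m ρ)
    [m.IsMaximal] (hN : Nondeg a b c) [IsNoetherianRing (Ctr k a b c)]
    [Module.Finite (Ctr k a b c) (Sklyanin k a b c)] :
    ∃ t₀ ∈ m, ∃ t₁ ∈ m, ∃ t₂ ∈ m, Reg1 (Sklyanin k a b c) t₀ ∧ Reg2 (Sklyanin k a b c) t₀ t₁ ∧
      Reg3 (Sklyanin k a b c) t₀ t₁ t₂ ∧ t₀ ∉ m ^ 2 ∧ t₁ ∉ m ^ 2 ⊔ Ideal.span {t₀} ∧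
        t₂ ∉ m ^ 2 ⊔ Ideal.span {t₀, t₁} := by
  obtain ⟨t₀, ht₀, hn₀, hr₀⟩ := hρ.exists_regular bot_le (homClosed_bot ρ hN)
  have h1 : Reg1 (Sklyanin k a b c) t₀ := fun s hs => by
    simpa using hr₀ s (by simp [hs])
  obtain ⟨t₁, ht₁, hn₁, hr₁⟩ := hρ.exists_regular (I := Ideal.span {t₀})
    ((Ideal.span_singleton_le_iff_mem _).2 ht₀) (homClosed_singleton ρ hN h1)
  have h2 : Reg2 (Sklyanin k a b c) t₀ t₁ := fun s u hs => by
    obtain ⟨v, hv⟩ := mem_span_singleton_smul_top.1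
      (hr₁ s (mem_span_singleton_smul_top.2 ⟨u, hs.symm⟩))
    exact ⟨v, hv.symm⟩
  obtain ⟨t₂, ht₂, hn₂, hr₂⟩ := hρ.exists_regular (I := Ideal.span {t₀, t₁})
    (Ideal.span_le.2 (by simp [Set.insert_subset_iff, ht₀, ht₁])) (homClosed_pair ρ hN h1 h2)
  refine ⟨t₀, ht₀, t₁, ht₁, t₂, ht₂, h1, h2, fun s u v hs => ?_, by simpa using hn₀, hn₁, hn₂⟩
  obtain ⟨u', v', hv⟩ := mem_span_pair_smul_top.1 (hr₂ s (mem_span_pair_smul_top.2 ⟨u, v, hs.symm⟩))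
  exact ⟨u', v', hv.symm⟩

end Avoid

end SklAz

namespace SklAz

open Module

section Cot

variable {Z : Type*} [CommRing Z] {m : Ideal Z}

lemma toCotangent_smul_mk (r : Z) (x : m) :
    (Ideal.Quotient.mk m r) • m.toCotangent x = m.toCotangent (r • x) := by
  rw [map_smul]
  rfl

lemma mem_sq_sup_singleton {t₀ s : m}
    (h : m.toCotangent s ∈ Submodule.span (Z ⧸ m) {m.toCotangent t₀}) :
    (s : Z) ∈ m ^ 2 ⊔ Ideal.span {(t₀ : Z)} := by
  obtain ⟨r, hr⟩ := Submodule.mem_span_singleton.1 h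
  obtain ⟨r, rfl⟩ := Ideal.Quotient.mk_surjective r
  rw [toCotangent_smul_mk, Ideal.toCotangent_eq] at hr
  rw [← sub_sub_self ((r • t₀ : m) : Z) s]
  refine Submodule.sub_mem _ (Submodule.mem_sup_right ?_) (Submodule.mem_sup_left hr)
  exact Ideal.mul_mem_left _ r (Ideal.subset_span rfl)

lemma mem_sq_sup_pair {t₀ t₁ s : m}
    (h : m.toCotangent s ∈ Submodule.span (Z ⧸ m) {m.toCotangent t₀, m.toCotangent t₁}) :
    (s : Z) ∈ m ^ 2 ⊔ Ideal.span {(t₀ : Z), (t₁ : Z)} := by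
  obtain ⟨r, r', hr⟩ := Submodule.mem_span_pair.1 h
  obtain ⟨r, rfl⟩ := Ideal.Quotient.mk_surjective r
  obtain ⟨r', rfl⟩ := Ideal.Quotient.mk_surjective r'
  rw [toCotangent_smul_mk, toCotangent_smul_mk, ← map_add, Ideal.toCotangent_eq] at hr
  rw [← sub_sub_self ((r • t₀ + r' • t₁ : m) : Z) s]
  refine Submodule.sub_mem _ (Submodule.mem_sup_right ?_) (Submodule.mem_sup_left hr)
  exact Ideal.add_mem _ (Ideal.mul_mem_left _ r (Ideal.subset_span (by simp)))
    (Ideal.mul_mem_left _ r' (Ideal.subset_span (by simp)))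

lemma linearIndependent_triple {K V : Type*} [Field K] [AddCommGroup V] [Module K V] {x y z : V}
    (h0 : x ≠ 0) (h1 : y ∉ Submodule.span K {x}) (h2 : z ∉ Submodule.span K {x, y}) :
    LinearIndependent K ![x, y, z] := by
  have hp : LinearIndependent K ![x, y] := (LinearIndependent.pair_iff' h0).2 fun r hr =>
    h1 (Submodule.mem_span_singleton.2 ⟨r, hr⟩)
  rw [linearIndependent_finSucc']
  have e : Fin.init ![x, y, z] = ![x, y] := by
    ext i; fin_cases i <;> rfl
  rw [e]
  rw [Set.pair_comm] at h2
  exact ⟨hp, by simpa using h2⟩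

/-- Three elements which are successively new modulo `m ^ 2` are independent in the cotangent
space. -/
lemma linearIndependent_toCotangent [m.IsMaximal] {t₀ t₁ t₂ : m} (h0 : (t₀ : Z) ∉ m ^ 2)
    (h1 : (t₁ : Z) ∉ m ^ 2 ⊔ Ideal.span {(t₀ : Z)})
    (h2 : (t₂ : Z) ∉ m ^ 2 ⊔ Ideal.span {(t₀ : Z), (t₁ : Z)}) :
    LinearIndependent (Z ⧸ m)
      ![m.toCotangent t₀, m.toCotangent t₁, m.toCotangent t₂] :=
  let _ : Field (Z ⧸ m) := Ideal.Quotient.field m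
  linearIndependent_triple (fun h => h0 ((m.toCotangent_eq_zero t₀).1 h))
    (fun h => h1 (mem_sq_sup_singleton h)) (fun h => h2 (mem_sq_sup_pair h))

lemma finite_cotangent [IsNoetherianRing Z] : Module.Finite (Z ⧸ m) m.Cotangent :=
  have : Module.Finite Z m.Cotangent :=
    Module.Finite.of_surjective m.toCotangent m.toCotangent_surjective
  Module.Finite.of_restrictScalars_finite Z _ _

lemma span_eq_top_of_finrank {K V : Type*} [Field K] [AddCommGroup V] [Module K V] {x : Fin 3 → V}
    (h : LinearIndependent K x) (hd : finrank K V = 3) :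
    Submodule.span K (Set.range x) = ⊤ :=
  have : FiniteDimensional K V := FiniteDimensional.of_finrank_pos (by omega)
  h.span_eq_top_of_card_eq_finrank' (by simp [hd])

theorem three_le_finrank_cotangent [m.IsMaximal] [IsNoetherianRing Z] {t₀ t₁ t₂ : m}
    (h : LinearIndependent (Z ⧸ m) ![m.toCotangent t₀, m.toCotangent t₁, m.toCotangent t₂]) :
    3 ≤ finrank (Z ⧸ m) m.Cotangent := by
  have := finite_cotangent (m := m)
  simpa using h.fintype_card_le_finrank

/-- If the cotangent space is three-dimensional, a basis generates `m` locally. -/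
theorem exists_smul_mem_span_of_finrank [hm : m.IsMaximal] [IsNoetherianRing Z] {t₀ t₁ t₂ : m}
    (h : LinearIndependent (Z ⧸ m) ![m.toCotangent t₀, m.toCotangent t₁, m.toCotangent t₂])
    (hd : finrank (Z ⧸ m) m.Cotangent = 3) :
    ∃ f ∉ m, ∀ z ∈ m, f * z ∈ Ideal.span {(t₀ : Z), (t₁ : Z), (t₂ : Z)} := by
  have hsp := let _ : Field (Z ⧸ m) := Ideal.Quotient.field m
    span_eq_top_of_finrank (K := Z ⧸ m) h hd
  obtain ⟨f, hf, hfm⟩ := exists_smul_mem_of_sup (M := m) m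
    (Submodule.comap m.subtype (Ideal.span {(t₀ : Z), (t₁ : Z), (t₂ : Z)})) (fun x => by
      have hx : m.toCotangent x ∈ Submodule.span (Z ⧸ m) (Set.range
        ![m.toCotangent t₀, m.toCotangent t₁, m.toCotangent t₂]) := hsp ▸ trivial
      obtain ⟨r, hr⟩ := (Submodule.mem_span_range_iff_exists_fun _).1 hx
      choose r' hr' using fun i => Ideal.Quotient.mk_surjective (r i)
      simp only [← hr', Fin.sum_univ_three, Matrix.cons_val_zero, Matrix.cons_val_one,
        Matrix.cons_val, toCotangent_smul_mk, ← map_add] at hr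
      refine ⟨r' 0 • t₀ + r' 1 • t₁ + r' 2 • t₂, ?_, ?_⟩
      · rw [Submodule.mem_comap, map_add, map_add]
        refine Ideal.add_mem _ (Ideal.add_mem _ ?_ ?_) ?_ <;>
          exact Ideal.mul_mem_left _ _ (Ideal.subset_span (by simp))
      · rw [Ideal.toCotangent_eq, pow_two, ← smul_eq_mul] at hr
        rw [Submodule.mem_smul_top_iff]
        rw [← neg_sub]
        exact neg_mem hr)
  exact ⟨f, hf, fun z hz => hfm ⟨z, hz⟩⟩

end Cot

end SklAz

namespace SklAz

open Module

section Kappa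

variable {R : Type*} [CommRing R] {M : Type*} [AddCommGroup M] [Module R M] {t : Fin 3 → R}

/-- Exactness of the Koszul complex of a regular sequence at its last but one spot. -/
lemma exists_of_sum_smul_eq_zero (h1 : Reg1 M (t 0)) (h2 : Reg2 M (t 0) (t 1))
    (h3 : Reg3 M (t 0) (t 1) (t 2)) (s : Fin 3 → M) (hs : ∑ l, t l • s l = 0) :
    ∃ w : Fin 3 → M, ∀ l, s l = t (l + 1) • w (l + 2) - t (l + 2) • w (l + 1) := by
  rw [Fin.sum_univ_three] at hs
  obtain ⟨v0, v1, hv⟩ := h3 (s 2) (-s 0) (-s 1) (by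
    rw [smul_neg, smul_neg, ← sub_eq_zero, ← hs]; abel)
  obtain ⟨v, hv'⟩ := h2 (s 1 + t 2 • v1) (-(s 0 + t 2 • v0)) (by
    rw [hv, smul_add, smul_comm (t 2) (t 0), smul_comm (t 2) (t 1)] at hs
    rw [smul_neg, ← sub_eq_zero, ← hs, smul_add, smul_add]; abel)
  have h0 : s 0 + t 2 • v0 + t 1 • v = 0 := h1 _ (by
    have e : s 1 = t 0 • v - t 2 • v1 := eq_sub_of_add_eq hv'
    rw [hv, e, smul_add, smul_sub, smul_comm (t 2) (t 0), smul_comm (t 2) (t 1)] at hs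
    rw [← hs, smul_add, smul_add, smul_comm (t 0) (t 1)]; abel)
  refine ⟨![-v1, v0, -v], ?_⟩
  refine forall_fin_three ?_ ?_ ?_
  · have : s 0 = -(t 2 • v0) - t 1 • v := by
      rw [← sub_eq_zero, ← h0]; abel
    simp [this]; abel
  · rw [eq_sub_of_add_eq hv']
    simp [fin3_add]; abel
  · simp [hv, fin3_add]

lemma exists_of_smul_eq_smul (h1 : Reg1 M (t 0)) (h2 : Reg2 M (t 0) (t 1))
    (w : Fin 3 → M) (hw : ∀ l, t (l + 1) • w (l + 2) - t (l + 2) • w (l + 1) = 0) :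
    ∃ u : M, ∀ l, w l = t l • u := by
  have e1 := sub_eq_zero.1 (hw 1)
  have e2 := sub_eq_zero.1 (hw 2)
  simp only [fin3_add] at e1 e2
  obtain ⟨u, hu⟩ := h2 (w 0) (w 1) e2.symm
  refine ⟨u, forall_fin_three hu ?_ ?_⟩
  · rw [← sub_eq_zero]
    exact h1 _ (by rw [smul_sub, e2, hu, smul_comm, sub_self])
  · rw [← sub_eq_zero]
    exact h1 _ (by rw [smul_sub, ← e1, hu, smul_comm, sub_self])

end Kappa

section Lifts

variable {k : Type*} [Field k] {a b c : k} {E : Type*} [AddCommGroup E] [Module k E]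
  {α β : Fin 3 → End k E} {R : Type*} [CommRing R] [Module R E] {t : Fin 3 → R}

/-- Lifting a cocycle through the Koszul cocomplex of a regular sequence. -/
lemma BiSkl.exists_cochain [SMulCommClass k R E] (hb : BiSkl a b c α β)
    (hR : SMulBi R α β) (h1 : Reg1 E (t 0)) (h2 : Reg2 E (t 0) (t 1))
    (h3 : Reg3 E (t 0) (t 1) (t 2)) (χ₀ : E) (χ₁ : Fin 3 → Fin 3 → E)
    (h : bi0 α β χ₀ = ∑ l, t l • χ₁ l) :
    ∃ (χ₂ : Fin 3 → Fin 3 → E) (χ₃ : E),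
      (∀ l, bi1 a b c α β (χ₁ l) = t (l + 1) • χ₂ (l + 2) - t (l + 2) • χ₂ (l + 1)) ∧
      ∀ l, bi2 α β (χ₂ l) = t l • χ₃ := by
  obtain ⟨χ₂, hχ₂⟩ := exists_of_sum_smul_eq_zero h1.pi h2.pi h3.pi
    (fun l => bi1 a b c α β (χ₁ l)) (by
      simp only [← hR.bi1, ← map_sum]
      rw [← h, hb.bi1_bi0])
  obtain ⟨χ₃, hχ₃⟩ := exists_of_smul_eq_smul h1 h2 (fun l => bi2 α β (χ₂ l)) (fun l => by
    rw [← hR.bi2, ← hR.bi2, ← map_sub, ← hχ₂, hb.bi2_bi1])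
  exact ⟨χ₂, χ₃, hχ₂, hχ₃⟩

/-- A chain map from the Koszul complex of `t` into the Koszul complex of a bimodule. -/
structure KosMap (a b c : k) (α β : Fin 3 → End k E) (t : Fin 3 → R) (φ₀ : E)
    (φ₁ φ₂ : Fin 3 → Fin 3 → E) (φ₃ : E) : Prop where
  eq1 : ∀ l, bi2 α β (φ₁ l) = t l • φ₀
  eq2 : ∀ l, bi1 a b c α β (φ₂ l) = t (l + 1) • φ₁ (l + 2) - t (l + 2) • φ₁ (l + 1)
  eq3 : bi0 α β φ₃ = ∑ l, t l • φ₂ l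

lemma sum_smul_cyclic {M : Type*} [AddCommGroup M] [Module R M] (t : Fin 3 → R) (w : Fin 3 → M) :
    ∑ l, t l • (t (l + 1) • w (l + 2) - t (l + 2) • w (l + 1)) = 0 := by
  simp only [Fin.sum_univ_three, fin3_add, smul_sub, zero_add]
  rw [smul_comm (t 1) (t 0), smul_comm (t 2) (t 0), smul_comm (t 2) (t 1)]
  abel

lemma BiExact.exists_kosMap [SMulCommClass k R E] (hx : BiExact a b c α β)
    (hR : SMulBi R α β) (φ₀ : E) (φ₁ : Fin 3 → Fin 3 → E)
    (h : ∀ l, bi2 α β (φ₁ l) = t l • φ₀) : ∃ φ₂ φ₃, KosMap a b c α β t φ₀ φ₁ φ₂ φ₃ := by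
  choose φ₂ h2 using fun l => hx.ex2 (t (l + 1) • φ₁ (l + 2) - t (l + 2) • φ₁ (l + 1)) (by
    rw [map_sub, hR.bi2, hR.bi2, h, h, smul_comm, sub_self])
  obtain ⟨φ₃, h3⟩ := hx.ex1 (∑ l, t l • φ₂ l) (by
    simp only [map_sum, hR.bi1, h2, sum_smul_cyclic])
  exact ⟨φ₂, φ₃, h, h2, h3⟩

/-- A chain map which is trivial on homology in degree zero is divisible in top degree. -/
lemma KosMap.exists_eq_sum [SMulCommClass k R E] (hx : BiExact a b c α β)
    (hR : SMulBi R α β) {φ₀ φ₃ : E} {φ₁ φ₂ : Fin 3 → Fin 3 → E}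
    (h : KosMap a b c α β t φ₀ φ₁ φ₂ φ₃) (h0 : ∃ ξ, bi2 α β ξ = φ₀) :
    ∃ ξ : Fin 3 → E, φ₃ = ∑ l, t l • ξ l := by
  obtain ⟨ξ₁, hξ₁⟩ := h0
  choose ξ₂ hξ₂ using fun l => hx.ex2 (φ₁ l - t l • ξ₁) (by
    rw [map_sub, hR.bi2, h.eq1, hξ₁, sub_self])
  choose ξ₃ hξ₃ using fun l => hx.ex1 (φ₂ l - (t (l + 1) • ξ₂ (l + 2) - t (l + 2) • ξ₂ (l + 1))) (by
    rw [map_sub, map_sub, hR.bi1, hR.bi1, h.eq2, hξ₂, hξ₂, smul_sub, smul_sub,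
      smul_comm (t (l + 1)) (t (l + 2))]
    abel)
  refine ⟨ξ₃, sub_eq_zero.1 (hx.inj _ ?_)⟩
  simp only [map_sub, h.eq3, map_sum, hR.bi0, hξ₃, smul_sub]
  have := sum_smul_cyclic t ξ₂
  simp only [smul_sub] at this
  rw [Finset.sum_sub_distrib, this, sub_zero, sub_self]

lemma KosMap.map {a b c : k} {E' : Type*} [AddCommGroup E'] [Module k E'] {α' β' : Fin 3 → End k E'}
    {R' : Type*} [CommRing R'] [Module R' E'] {t' : Fin 3 → R'} (T : E →ₗ[k] E')
    (hα : ∀ i u, T (α i u) = α' i (T u)) (hβ : ∀ i u, T (β i u) = β' i (T u))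
    (ht : ∀ l u, T (t l • u) = t' l • T u) {φ₀ φ₃ : E} {φ₁ φ₂ : Fin 3 → Fin 3 → E}
    (h : KosMap a b c α β t φ₀ φ₁ φ₂ φ₃) :
    KosMap a b c α' β' t' (T φ₀) (fun l i => T (φ₁ l i)) (fun l i => T (φ₂ l i)) (T φ₃) where
  eq1 l := by
    rw [← ht, ← h.eq1]
    simp only [bi2_apply, map_sum, map_sub, hα, hβ]
  eq2 l := by
    funext i
    have := congrArg T (congrFun (h.eq2 l) i)
    simpa [bi1_apply, hα, hβ, ht] using this
  eq3 := by
    funext i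
    have := congrArg T (congrFun h.eq3 i)
    simpa [bi0_apply, hα, hβ, ht] using this

end Lifts

section Homotopy

variable {k : Type*} [Field k] {a b c : k} {A : Type*} [AddCommGroup A] [Module k A]
  {X Y : Type*} [AddCommGroup X] [Module k X] [AddCommGroup Y] [Module k Y]

/-- Actions on values of linear maps. -/
def valAct (A : Type*) [AddCommGroup A] [Module k A] (lam : Fin 3 → End k X) (i : Fin 3) :
    End k (A →ₗ[k] X) := LinearMap.compRight k (lam i)

/-- Actions on arguments of linear maps. -/
def argAct (X : Type*) [AddCommGroup X] [Module k X] (r : Fin 3 → End k A) (i : Fin 3) :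
    End k (A →ₗ[k] X) := LinearMap.lcomp k X (r i)

@[simp] lemma valAct_apply (lam : Fin 3 → End k X) (i : Fin 3) (F : A →ₗ[k] X) (x : A) :
    valAct A lam i F x = lam i (F x) := rfl

@[simp] lemma argAct_apply (r : Fin 3 → End k A) (i : Fin 3) (F : A →ₗ[k] X) (x : A) :
    argAct X r i F x = F (r i x) := rfl

lemma biSkl_act {lam : Fin 3 → End k X} {r : Fin 3 → End k A} (hl : IsSkl a b c lam)
    (hr : IsSkl a b c r) : BiSkl a b c (valAct A lam) (argAct X r) where
  left l := LinearMap.ext fun F => LinearMap.ext fun x => LinearMap.congr_fun (hl l) (F x)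
  right l := LinearMap.ext fun F => LinearMap.ext fun x => by
    have := congrArg F (LinearMap.congr_fun (hr l) x)
    simp only [LinearMap.add_apply, LinearMap.smul_apply, Module.End.mul_apply, map_add, map_smul,
      LinearMap.zero_apply, map_zero] at this
    simp only [LinearMap.add_apply, LinearMap.smul_apply, Module.End.mul_apply, argAct_apply,
      LinearMap.zero_apply]
    rw [← this]; abel
  comm _ _ _ := rfl

section Comp

variable {lam : Fin 3 → End k X} {mu : Fin 3 → End k Y} (r : Fin 3 → End k A) (d : X →ₗ[k] Y)
  (hd : ∀ i u, d (lam i u) = mu i (d u))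

include hd

lemma bi0_act_comp (F : A →ₗ[k] X) (i : Fin 3) :
    bi0 (valAct A mu) (argAct Y r) (d ∘ₗ F) i = d ∘ₗ bi0 (valAct A lam) (argAct X r) F i :=
  LinearMap.ext fun x => by simp [bi0_apply, hd]

lemma bi1_act_comp (F : Fin 3 → A →ₗ[k] X) (i : Fin 3) :
    bi1 a b c (valAct A mu) (argAct Y r) (fun i => d ∘ₗ F i) i =
      d ∘ₗ bi1 a b c (valAct A lam) (argAct X r) F i :=
  LinearMap.ext fun x => by simp [bi1_apply, hd]

lemma bi2_act_comp (F : Fin 3 → A →ₗ[k] X) :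
    bi2 (valAct A mu) (argAct Y r) (fun i => d ∘ₗ F i) =
      d ∘ₗ bi2 (valAct A lam) (argAct X r) F :=
  LinearMap.ext fun x => by simp [bi2_apply, hd]

end Comp

/-- The coordinatewise extension of a family of endomorphisms. -/
def piAct (lam : Fin 3 → End k X) (i : Fin 3) : End k (Fin 3 → X) :=
  LinearMap.pi fun j => lam i ∘ₗ LinearMap.proj j

@[simp] lemma piAct_apply (lam : Fin 3 → End k X) (i : Fin 3) (g : Fin 3 → X) (j : Fin 3) :
    piAct lam i g j = lam i (g j) := rfl

lemma IsSkl.piAct {lam : Fin 3 → End k X} (h : IsSkl a b c lam) : IsSkl a b c (piAct lam) :=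
  fun l => LinearMap.ext fun g => funext fun j => LinearMap.congr_fun (h l) (g j)

variable {α β : Fin 3 → End k X}

/-- The top component of a null-homologous twisted cochain with values in a Koszul complex is a
coboundary. -/
lemma BiExact.exists_homotopy (hx : BiExact a b c α β) {lam : Fin 3 → End k X}
    {r : Fin 3 → End k A}
    (hlα : ∀ i j u, lam i (α j u) = α j (lam i u)) (hlβ : ∀ i j u, lam i (β j u) = β j (lam i u))
    (hlam : IsSkl a b c lam) (hr : IsSkl a b c r)
    (M₀ M₃ : A →ₗ[k] X) (M₁ M₂ : Fin 3 → A →ₗ[k] (Fin 3 → X))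
    (h0 : ∀ x, ∃ h, bi2 α β h = M₀ x)
    (h1 : ∀ i x, bi2 α β (M₁ i x) = -bi0 (valAct A lam) (argAct X r) M₀ i x)
    (h2 : ∀ l x, bi1 a b c α β (M₂ l x) =
      bi1 a b c (valAct A (piAct lam)) (argAct _ r) M₁ l x)
    (h3 : ∀ x, bi0 α β (M₃ x) = -bi2 (valAct A (piAct lam)) (argAct _ r) M₂ x) :
    ∃ H : Fin 3 → A →ₗ[k] X, M₃ = -bi2 (valAct A lam) (argAct X r) H := by
  have hl2 : ∀ i g, bi2 α β (piAct lam i g) = lam i (bi2 α β g) := fun i g => by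
    simp only [bi2_apply, map_sum, map_sub, hlα, hlβ, piAct_apply]
  have hl1 : ∀ i g, bi1 a b c α β (piAct lam i g) = piAct lam i (bi1 a b c α β g) :=
    fun i g => by
      funext j
      simp only [bi1_apply, map_add, map_smul, hlα, hlβ, piAct_apply]
  have hl0 : ∀ i g, bi0 α β (lam i g) = piAct lam i (bi0 α β g) := fun i g => by
    funext j
    simp only [bi0_apply, map_sub, hlα, hlβ, piAct_apply]
  obtain ⟨η₀, hη₀⟩ := exists_comp_eq_of_range_le (bi2 α β) M₀ h0
  have e0 : bi2 α β ∘ₗ η₀ = M₀ := LinearMap.ext hη₀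
  choose η₁ hη₁ using fun i => exists_comp_eq_of_range_le (bi1 a b c α β)
    (M₁ i + bi0 (valAct A (piAct lam)) (argAct _ r) η₀ i) fun x => hx.ex2 _ (by
      rw [LinearMap.add_apply, map_add, h1, ← LinearMap.comp_apply (bi2 α β),
        ← bi0_act_comp r _ hl2, e0, neg_add_cancel])
  have e1 : (fun i => bi1 a b c α β ∘ₗ η₁ i) =
      M₁ + bi0 (valAct A (piAct lam)) (argAct _ r) η₀ :=
    funext fun i => LinearMap.ext (hη₁ i)
  have hbi := biSkl_act hlam.piAct hr
  choose η₂ hη₂ using fun l => exists_comp_eq_of_range_le (bi0 α β)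
    (M₂ l - bi1 a b c (valAct A (piAct lam)) (argAct _ r) η₁ l) fun x => hx.ex1 _ (by
      rw [LinearMap.sub_apply, map_sub, h2, ← LinearMap.comp_apply (bi1 a b c α β),
        ← bi1_act_comp r _ hl1, e1, map_add, hbi.bi1_bi0, add_zero, sub_self])
  have e2 : (fun l => bi0 α β ∘ₗ η₂ l) =
      M₂ - bi1 a b c (valAct A (piAct lam)) (argAct _ r) η₁ :=
    funext fun i => LinearMap.ext (hη₂ i)
  refine ⟨η₂, LinearMap.ext fun x => sub_eq_zero.1 (hx.inj _ ?_)⟩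
  rw [map_sub, h3, LinearMap.neg_apply, map_neg, ← LinearMap.comp_apply (bi0 α β),
    ← bi2_act_comp r _ hl0, e2, map_sub, hbi.bi2_bi1, sub_zero, sub_self]

end Homotopy

end SklAz

namespace SklAz

open Module Matrix TensorProduct

section Diagonal

variable {k : Type*} [Field k] {a b c : k}

lemma left_mem_center_ten (z : Ctr k a b c) :
    (z : Sklyanin k a b c) ⊗ₜ[k] (1 : Sklyanin k a b c) ∈
      Subalgebra.center k (Sklyanin k a b c ⊗[k] Sklyanin k a b c) := by
  rw [Subalgebra.mem_center_iff]
  intro u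
  induction u with
  | zero => simp
  | tmul s x => simp [center_comm]
  | add u v hu hv => rw [add_mul, mul_add, hu, hv]

lemma right_mem_center_ten (z : Ctr k a b c) :
    (1 : Sklyanin k a b c) ⊗ₜ[k] (z : Sklyanin k a b c) ∈
      Subalgebra.center k (Sklyanin k a b c ⊗[k] Sklyanin k a b c) := by
  rw [Subalgebra.mem_center_iff]
  intro u
  induction u with
  | zero => simp
  | tmul s x => simp [center_comm]
  | add u v hu hv => rw [add_mul, mul_add, hu, hv]

/-- The difference of the two copies of a central element. -/
def diagDiff (z : Ctr k a b c) :
    Subalgebra.center k (Sklyanin k a b c ⊗[k] Sklyanin k a b c) :=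
  ⟨_, left_mem_center_ten z⟩ - ⟨_, right_mem_center_ten z⟩

lemma diagDiff_smul (z : Ctr k a b c) (u : Sklyanin k a b c ⊗[k] Sklyanin k a b c) :
    diagDiff z • u = ((z : Sklyanin k a b c) ⊗ₜ[k] (1 : Sklyanin k a b c) -
      (1 : Sklyanin k a b c) ⊗ₜ[k] (z : Sklyanin k a b c)) * u := rfl

lemma sMulBi_ten : SMulBi (Subalgebra.center k (Sklyanin k a b c ⊗[k] Sklyanin k a b c))
    (tenL (AlgHom.id k (Sklyanin k a b c))) (tenR (Sklyanin k a b c) a b c) where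
  left z i u := by
    simp only [Subalgebra.smul_def, smul_eq_mul, tenL_apply, ← mul_assoc,
      Subalgebra.mem_center_iff.1 z.2]
  right z i u := by
    simp only [Subalgebra.smul_def, smul_eq_mul, tenR_apply, ← mul_assoc]

variable {A : Type*} [Ring A] [Algebra k A]

/-- The augmentation of the Koszul complex of a fibre. -/
lemma exists_bi2_eq_sub (ρ : Sklyanin k a b c →ₐ[k] A) (s : Sklyanin k a b c) (x : A) :
    ∃ g, bi2 (tenL ρ) (tenR A a b c) g = s ⊗ₜ x - 1 ⊗ₜ (ρ s * x) := by
  suffices h : ∀ (u : Sklyanin k a b c) (x : A), u ⊗ₜ[k] (ρ s * x) - (u * s) ⊗ₜ x ∈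
      LinearMap.range (bi2 (tenL ρ) (tenR A a b c)) by
    obtain ⟨g, hg⟩ := neg_mem (h 1 x)
    exact ⟨g, by rw [hg, neg_sub, one_mul]⟩
  induction s using gen_induction with
  | halg r =>
    intro u x
    have : u ⊗ₜ[k] (ρ (algebraMap k _ r) * x) - (u * algebraMap k _ r) ⊗ₜ x = 0 := by
      rw [AlgHom.commutes, ← Algebra.smul_def, ← Algebra.commutes, ← Algebra.smul_def, tmul_smul,
        smul_tmul', sub_self]
    rw [this]
    exact zero_mem _
  | hgen i =>
    intro u x
    refine ⟨Pi.single i (u ⊗ₜ x), ?_⟩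
    rw [bi2_apply, Finset.sum_eq_single i]
    · simp
    · intro l _ hl
      simp [hl]
    · simp
  | hadd s s' hs hs' =>
    intro u x
    have := add_mem (hs u x) (hs' u x)
    rwa [sub_add_sub_comm, ← tmul_add, ← add_tmul, ← add_mul, ← mul_add, ← map_add] at this
  | hmul s s' hs hs' =>
    intro u x
    have := add_mem (hs u (ρ s' * x)) (hs' (u * s) x)
    rwa [sub_add_sub_cancel, ← mul_assoc, ← map_mul, mul_assoc] at this

/-- The diagonal class attached to a triple of central elements. -/
theorem exists_diagonal [IsAlgClosed k] (hN : Nondeg a b c) (t : Fin 3 → Ctr k a b c) :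
    ∃ φ₁ φ₂ Θ, KosMap a b c (tenL (AlgHom.id k (Sklyanin k a b c))) (tenR (Sklyanin k a b c) a b c)
      (fun l => diagDiff (t l)) 1 φ₁ φ₂ Θ ∧
      ∀ x : Sklyanin k a b c, ∃ ξ : Fin 3 → Sklyanin k a b c ⊗[k] Sklyanin k a b c,
        (x ⊗ₜ 1) * Θ - Θ * (1 ⊗ₜ x) = ∑ l, diagDiff (t l) • ξ l := by
  have hx := biExact_ten (AlgHom.id k (Sklyanin k a b c)) hN
  choose φ₁ h₁ using fun l => exists_bi2_eq_sub (AlgHom.id k (Sklyanin k a b c))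
    (t l : Sklyanin k a b c) 1
  obtain ⟨φ₂, Θ, h⟩ := hx.exists_kosMap sMulBi_ten (t := fun l => diagDiff (t l)) 1 φ₁ (fun l => by
    rw [h₁, diagDiff_smul, mul_one, mul_one]; rfl)
  refine ⟨φ₁, φ₂, Θ, h, fun x => ?_⟩
  refine (h.map (LinearMap.mulLeft k (x ⊗ₜ 1) - LinearMap.mulRight k (1 ⊗ₜ x))
    (fun i u => ?_) (fun i u => ?_) (fun l u => ?_)).exists_eq_sum hx sMulBi_ten ?_
  · simp only [LinearMap.sub_apply, LinearMap.mulLeft_apply, LinearMap.mulRight_apply, tenL_apply,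
      mul_sub, ← mul_assoc, Algebra.TensorProduct.tmul_mul_tmul, mul_one, one_mul]
  · simp only [LinearMap.sub_apply, LinearMap.mulLeft_apply, LinearMap.mulRight_apply, tenR_apply,
      sub_mul, mul_assoc, Algebra.TensorProduct.tmul_mul_tmul, mul_one, one_mul]
  · simp only [LinearMap.sub_apply, LinearMap.mulLeft_apply, LinearMap.mulRight_apply,
      Subalgebra.smul_def, smul_eq_mul, mul_sub, ← mul_assoc,
      Subalgebra.mem_center_iff.1 (diagDiff (t l)).2]
  · obtain ⟨g, hg⟩ := exists_bi2_eq_sub (AlgHom.id k (Sklyanin k a b c)) x 1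
    refine ⟨g, ?_⟩
    rw [hg]
    simp

end Diagonal

end SklAz

namespace SklAz

open Module Matrix TensorProduct

section Insert

variable {k : Type*} [Field k] {a b c : k} {A : Type*} [Ring A] [Algebra k A]

/-- Left multiplication of a tensor by elements of the first factor. -/
def ins (u : Sklyanin k a b c ⊗[k] A) : Sklyanin k a b c →ₗ[k] Sklyanin k a b c ⊗[k] A :=
  LinearMap.mulRight k u ∘ₗ (Algebra.TensorProduct.includeLeft (R := k) (S := k)).toLinearMap

lemma ins_apply (u : Sklyanin k a b c ⊗[k] A) (s : Sklyanin k a b c) :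
    ins u s = (s ⊗ₜ 1) * u := rfl

/-- The coordinatewise version of `ins`. -/
def insP (g : Fin 3 → Sklyanin k a b c ⊗[k] A) :
    Sklyanin k a b c →ₗ[k] Fin 3 → Sklyanin k a b c ⊗[k] A :=
  LinearMap.pi fun i => ins (g i)

@[simp] lemma insP_apply (g : Fin 3 → Sklyanin k a b c ⊗[k] A) (s : Sklyanin k a b c) (i : Fin 3) :
    insP g s i = ins (g i) s := rfl

lemma ins_add (u v : Sklyanin k a b c ⊗[k] A) (s : Sklyanin k a b c) :
    ins (u + v) s = ins u s + ins v s := mul_add _ _ _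

lemma ins_sub (u v : Sklyanin k a b c ⊗[k] A) (s : Sklyanin k a b c) :
    ins (u - v) s = ins u s - ins v s := mul_sub _ _ _

lemma ins_sum {ι : Type*} (I : Finset ι) (u : ι → Sklyanin k a b c ⊗[k] A) (s : Sklyanin k a b c) :
    ins (∑ i ∈ I, u i) s = ∑ i ∈ I, ins (u i) s := Finset.mul_sum _ _ _

lemma ins_ksmul (r : k) (u : Sklyanin k a b c ⊗[k] A) (s : Sklyanin k a b c) :
    ins (r • u) s = r • ins u s := mul_smul_comm _ _ _

lemma ctr_smul_ten (z : Ctr k a b c) (u : Sklyanin k a b c ⊗[k] A) :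
    z • u = ((z : Sklyanin k a b c) ⊗ₜ 1) * u := by
  induction u with
  | zero => simp
  | tmul s x =>
    rw [Subalgebra.smul_def, smul_tmul', smul_eq_mul, Algebra.TensorProduct.tmul_mul_tmul, one_mul]
  | add u v hu hv => rw [smul_add, mul_add, hu, hv]

lemma ins_smul (z : Ctr k a b c) (u : Sklyanin k a b c ⊗[k] A) (s : Sklyanin k a b c) :
    ins (z • u) s = ins u (z • s) := by
  rw [ctr_smul_ten, ins_apply, ins_apply, ← mul_assoc, Algebra.TensorProduct.tmul_mul_tmul,
    center_comm, ctr_smul, one_mul]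

/-- Left multiplication by a generator in the first factor. -/
def insL (A : Type*) [Ring A] [Algebra k A] (a b c : k) (i : Fin 3) :
    End k (Sklyanin k a b c ⊗[k] A) :=
  LinearMap.mulLeft k (gen i ⊗ₜ 1)

lemma insL_apply (i : Fin 3) (u : Sklyanin k a b c ⊗[k] A) :
    insL A a b c i u = (gen i ⊗ₜ 1) * u := rfl

lemma insL_ins (i : Fin 3) (u : Sklyanin k a b c ⊗[k] A) (s : Sklyanin k a b c) :
    insL A a b c i (ins u s) = ins u (gen i * s) := by
  rw [insL_apply, ins_apply, ins_apply, ← mul_assoc, Algebra.TensorProduct.tmul_mul_tmul, one_mul]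

lemma isSkl_insL : IsSkl a b c (insL A a b c) := by
  have e : insL A a b c = fun i => LinearMap.rTensor A (lgen a b c i) := by
    funext i
    refine TensorProduct.ext' fun s x => ?_
    simp [insL_apply, lgen]
  rw [e]
  intro l
  have := congrArg (LinearMap.rTensor A) (isSkl_lgen (k := k) (a := a) (b := b) (c := c) l)
  simpa [LinearMap.rTensor_add, LinearMap.rTensor_smul, LinearMap.rTensor_mul] using this

variable (ρ : Sklyanin k a b c →ₐ[k] A)

lemma insL_tenL (i j : Fin 3) (u : Sklyanin k a b c ⊗[k] A) :
    insL A a b c i (tenL ρ j u) = tenL ρ j (insL A a b c i u) := by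
  simp only [insL_apply, tenL_apply, ← mul_assoc, Algebra.TensorProduct.tmul_mul_tmul, one_mul,
    mul_one]

lemma insL_tenR (i j : Fin 3) (u : Sklyanin k a b c ⊗[k] A) :
    insL A a b c i (tenR A a b c j u) = tenR A a b c j (insL A a b c i u) := by
  simp only [insL_apply, tenR_apply, mul_assoc]

lemma tenL_ins (i : Fin 3) (u : Sklyanin k a b c ⊗[k] A) (s : Sklyanin k a b c) :
    tenL ρ i (ins u s) = ins (tenL ρ i u) s := by
  simp only [ins_apply, tenL_apply, ← mul_assoc, Algebra.TensorProduct.tmul_mul_tmul, one_mul,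
    mul_one]

lemma tenR_ins (i : Fin 3) (u : Sklyanin k a b c ⊗[k] A) (s : Sklyanin k a b c) :
    tenR A a b c i (ins u s) = ins (tenR A a b c i u) s := by
  simp only [ins_apply, tenR_apply, mul_assoc]

lemma bi0_ins (u : Sklyanin k a b c ⊗[k] A) (s : Sklyanin k a b c) :
    bi0 (tenL ρ) (tenR A a b c) (ins u s) = insP (bi0 (tenL ρ) (tenR A a b c) u) s := by
  funext i
  simp only [bi0_apply, insP_apply, ins_sub, tenL_ins, tenR_ins]

lemma bi1_insP (g : Fin 3 → Sklyanin k a b c ⊗[k] A) (s : Sklyanin k a b c) :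
    bi1 a b c (tenL ρ) (tenR A a b c) (insP g s) =
      insP (bi1 a b c (tenL ρ) (tenR A a b c) g) s := by
  funext i
  simp only [bi1_apply, insP_apply, ins_add, ins_ksmul, tenL_ins, tenR_ins]

lemma bi2_insP (g : Fin 3 → Sklyanin k a b c ⊗[k] A) (s : Sklyanin k a b c) :
    bi2 (tenL ρ) (tenR A a b c) (insP g s) = ins (bi2 (tenL ρ) (tenR A a b c) g) s := by
  simp only [bi2_apply, insP_apply, ins_sum, ins_sub, tenL_ins, tenR_ins]

/-- The inclusion of the second tensor factor. -/
def inr (A : Type*) [Ring A] [Algebra k A] (a b c : k) : A →ₗ[k] Sklyanin k a b c ⊗[k] A :=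
  (Algebra.TensorProduct.includeRight (R := k)).toLinearMap

lemma inr_apply (x : A) : inr A a b c x = 1 ⊗ₜ x := rfl

/-- The inclusion of the second tensor factor in a given coordinate. -/
def inrP (A : Type*) [Ring A] [Algebra k A] (a b c : k) (i : Fin 3) :
    A →ₗ[k] Fin 3 → Sklyanin k a b c ⊗[k] A :=
  LinearMap.single k _ i ∘ₗ inr A a b c

lemma inrP_apply (i : Fin 3) (x : A) : inrP A a b c i x = Pi.single i (1 ⊗ₜ x) := rfl

/-- Left multiplication by the generators. -/
def rAct (i : Fin 3) : End k A := LinearMap.mulLeft k (ρ (gen i))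

lemma rAct_apply (i : Fin 3) (x : A) : rAct ρ i x = ρ (gen i) * x := rfl

lemma isSkl_rAct : IsSkl a b c (rAct ρ) := by
  intro l
  have := congrArg (fun s => LinearMap.mulLeft k (ρ s))
    (isSkl_gen (k := k) (a := a) (b := b) (c := c) l)
  refine LinearMap.ext fun x => ?_
  have := LinearMap.congr_fun this x
  simpa [rAct_apply, add_mul, mul_assoc] using this

lemma bi2_inrP (i : Fin 3) (x : A) :
    bi2 (tenL ρ) (tenR A a b c) (inrP A a b c i x) =
      -bi0 (valAct A (insL A a b c)) (argAct _ (rAct ρ)) (inr A a b c) i x := by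
  rw [bi2_apply, Finset.sum_eq_single i]
  · simp [inrP_apply, inr_apply, bi0_apply, insL_apply, rAct_apply]
  · intro l _ hl
    simp [inrP_apply, hl]
  · simp

lemma bi1_inrP (l : Fin 3) (x : A) :
    bi1 a b c (tenL ρ) (tenR A a b c) (inrP A a b c l x) =
      bi1 a b c (valAct A (piAct (insL A a b c))) (argAct _ (rAct ρ)) (inrP A a b c) l x := by
  funext i
  fin_cases l <;> fin_cases i <;>
    simp [bi1_apply, inrP_apply, insL_apply, rAct_apply, fin3_add] <;> abel

lemma bi0_inr (x : A) :
    bi0 (tenL ρ) (tenR A a b c) (inr A a b c x) =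
      -bi2 (valAct A (piAct (insL A a b c))) (argAct _ (rAct ρ)) (inrP A a b c) x := by
  funext i
  fin_cases i <;>
    simp [bi2_apply, bi0_apply, Fin.sum_univ_three, inrP_apply, inr_apply, insL_apply, rAct_apply]

end Insert

end SklAz

namespace SklAz

open Module Matrix TensorProduct

section TraceIdentity

variable {k : Type*} [Field k] {a b c : k} {A : Type*} [Ring A] [Algebra k A]
  (ρ : Sklyanin k a b c →ₐ[k] A)

lemma insP_lgen (g : Fin 3 → Sklyanin k a b c ⊗[k] A) (i : Fin 3) (u : Sklyanin k a b c) :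
    insP g (lgen a b c i u) = piAct (insL A a b c) i (insP g u) := by
  funext j
  exact (insL_ins i (g j) u).symm

lemma bi1_insP_comp (g : Fin 3 → Sklyanin k a b c ⊗[k] A)
    (F : Fin 3 → A →ₗ[k] Sklyanin k a b c) (l : Fin 3) :
    bi1 a b c (valAct A (piAct (insL A a b c))) (argAct _ (rAct ρ)) (fun i => insP g ∘ₗ F i) l =
      insP g ∘ₗ bi1 a b c (homL A a b c) (homR ρ) F l :=
  bi1_act_comp (rAct ρ) (insP g) (insP_lgen g) F l

lemma bi2_insP_comp (g : Fin 3 → Sklyanin k a b c ⊗[k] A)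
    (F : Fin 3 → A →ₗ[k] Sklyanin k a b c) :
    bi2 (valAct A (piAct (insL A a b c))) (argAct _ (rAct ρ)) (fun i => insP g ∘ₗ F i) =
      insP g ∘ₗ bi2 (homL A a b c) (homR ρ) F :=
  bi2_act_comp (rAct ρ) (insP g) (insP_lgen g) F

/-- The two ways of dividing the Koszul complex by a regular sequence agree up to homotopy. -/
theorem exists_ins_homotopy [IsAlgClosed k] [FiniteDimensional k A] (hN : Nondeg a b c)
    (t : Fin 3 → Ctr k a b c)
    {φ₁ φ₂ : Fin 3 → Fin 3 → Sklyanin k a b c ⊗[k] A} {Ω : Sklyanin k a b c ⊗[k] A}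
    (hφ : KosMap a b c (tenL ρ) (tenR A a b c) t 1 φ₁ φ₂ Ω) (e : k)
    (χ₀ χ₃ : A →ₗ[k] Sklyanin k a b c) (χ₁ χ₂ : Fin 3 → Fin 3 → A →ₗ[k] Sklyanin k a b c)
    (hχ₀ : ∀ x, ρ (χ₀ x) = e • x)
    (hχ₁ : bi0 (homL A a b c) (homR ρ) χ₀ = ∑ l, t l • χ₁ l)
    (hχ₂ : ∀ l, bi1 a b c (homL A a b c) (homR ρ) (χ₁ l) =
      t (l + 1) • χ₂ (l + 2) - t (l + 2) • χ₂ (l + 1))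
    (hχ₃ : ∀ l, bi2 (homL A a b c) (homR ρ) (χ₂ l) = t l • χ₃) :
    ∃ H : Fin 3 → A →ₗ[k] Sklyanin k a b c ⊗[k] A, ∀ x,
      ins Ω (χ₃ x) + e • (1 : Sklyanin k a b c) ⊗ₜ[k] x =
        ∑ i, ((gen i ⊗ₜ 1) * H i x - H i (ρ (gen i) * x)) := by
  obtain ⟨H, hH⟩ := (biExact_ten ρ hN).exists_homotopy (lam := insL A a b c) (r := rAct ρ)
    (insL_tenL ρ) (insL_tenR) isSkl_insL (isSkl_rAct ρ)
    (ins 1 ∘ₗ χ₀ - e • inr A a b c) (-(ins Ω ∘ₗ χ₃) - e • inr A a b c)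
    (fun i => -(∑ l, insP (φ₁ l) ∘ₗ χ₁ l i) - e • inrP A a b c i)
    (fun i => (∑ l, insP (φ₂ l) ∘ₗ χ₂ l i) - e • inrP A a b c i)
    (fun x => by
      obtain ⟨g, hg⟩ := exists_bi2_eq_sub ρ (χ₀ x) (1 : A)
      refine ⟨g, ?_⟩
      rw [hg, hχ₀]
      simp [ins_apply, inr_apply, Algebra.TensorProduct.one_def])
    (fun i x => by
      have h1 := LinearMap.congr_fun (congrFun hχ₁ i) x
      simp only [bi0_apply, LinearMap.sub_apply, homL_apply, homR_apply, Finset.sum_apply,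
        LinearMap.sum_apply, Pi.smul_apply, LinearMap.smul_apply] at h1
      have h2 := bi2_inrP (a := a) (b := b) (c := c) ρ i x
      simp only [bi0_apply, LinearMap.sub_apply, valAct_apply, argAct_apply] at h2 ⊢
      simp only [LinearMap.neg_apply, LinearMap.sum_apply,
        LinearMap.comp_apply, LinearMap.smul_apply, map_sub, map_neg, map_sum, map_smul, bi2_insP,
        hφ.eq1, ins_smul, h2, insL_ins, rAct_apply]
      rw [← map_sum, ← h1, map_sub, smul_neg, smul_sub]
      abel)
    (fun l x => by
      have e1 : (fun i => -(∑ l, insP (φ₁ l) ∘ₗ χ₁ l i) - e • inrP A a b c i) =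
          -(∑ l, fun i => insP (φ₁ l) ∘ₗ χ₁ l i) - e • inrP A a b c := by
        funext i
        simp
      rw [e1, map_sub, map_neg, map_sum, map_smul]
      simp only [Pi.sub_apply, Pi.neg_apply, Pi.smul_apply, Finset.sum_apply, bi1_insP_comp, hχ₂,
        LinearMap.sub_apply, LinearMap.neg_apply, LinearMap.sum_apply, LinearMap.comp_apply,
        LinearMap.smul_apply, map_sub, map_sum, map_smul, bi1_insP, hφ.eq2, bi1_inrP ρ l x]
      congr 1
      funext j
      simp only [Fin.sum_univ_three, fin3_add, Pi.add_apply, Pi.sub_apply, Pi.neg_apply, insP_apply,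
        Pi.smul_apply, ins_sub, ins_smul]
      abel)
    (fun x => by
      have e1 : (fun i => (∑ l, insP (φ₂ l) ∘ₗ χ₂ l i) - e • inrP A a b c i) =
          (∑ l, fun i => insP (φ₂ l) ∘ₗ χ₂ l i) - e • inrP A a b c := by
        funext i
        simp
      rw [e1, map_sub, map_sum, map_smul]
      simp only [bi2_insP_comp, hχ₃,
        LinearMap.sub_apply, LinearMap.neg_apply, LinearMap.sum_apply, LinearMap.comp_apply,
        LinearMap.smul_apply, map_sub, map_neg, map_smul, bi0_ins, hφ.eq3, bi0_inr ρ x]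
      funext j
      simp only [Fin.sum_univ_three, Pi.add_apply, Pi.sub_apply, Pi.neg_apply, insP_apply,
        Pi.smul_apply, ins_add, ins_smul]
      simp only [smul_neg, neg_sub, sub_neg_eq_add]
      abel)
  refine ⟨H, fun x => ?_⟩
  have := LinearMap.congr_fun hH x
  simp only [LinearMap.sub_apply, LinearMap.neg_apply, LinearMap.comp_apply, LinearMap.smul_apply,
    bi2_apply, LinearMap.sum_apply, valAct_apply, argAct_apply] at this
  rw [← neg_inj, neg_add, ← sub_eq_add_neg]
  exact this

end TraceIdentity

end SklAz

namespace SklAz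

open Module Matrix TensorProduct

section Simple

variable {k : Type*} [Field k] {a b c : k} {A : Type*} [Ring A] [Algebra k A]
  (ρ : Sklyanin k a b c →ₐ[k] A)

/-- Contraction of the second tensor factor with a linear form. -/
def contr (g : A →ₗ[k] k) : Sklyanin k a b c ⊗[k] A →ₗ[k] A :=
  (TensorProduct.rid k A).toLinearMap ∘ₗ TensorProduct.map ρ.toLinearMap g

@[simp] lemma contr_tmul (g : A →ₗ[k] k) (s : Sklyanin k a b c) (x : A) :
    contr ρ g (s ⊗ₜ x) = g x • ρ s := by
  simp [contr]

lemma contr_tmul_mul (g : A →ₗ[k] k) (s : Sklyanin k a b c) (u : Sklyanin k a b c ⊗[k] A) :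
    contr ρ g ((s ⊗ₜ 1) * u) = ρ s * contr ρ g u := by
  induction u with
  | zero => simp
  | tmul s x => simp
  | add u v hu hv => rw [mul_add, map_add, hu, hv, map_add, mul_add]

/-- A linear form whose contraction with the diagonal class vanishes is zero at `1`. -/
lemma apply_one_eq_zero [FiniteDimensional k A] (Ω : Sklyanin k a b c ⊗[k] A) {e : k} (he : e ≠ 0)
    (χ : A →ₗ[k] Sklyanin k a b c) (H : Fin 3 → A →ₗ[k] Sklyanin k a b c ⊗[k] A)
    (hH : ∀ x, ins Ω (χ x) + e • (1 : Sklyanin k a b c) ⊗ₜ[k] x =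
      ∑ i, ((gen i ⊗ₜ 1) * H i x - H i (ρ (gen i) * x)))
    (g : A →ₗ[k] k) (hg : contr ρ g Ω = 0) : g 1 = 0 := by
  have key : e • g.smulRight (1 : A) =
      ∑ i, (LinearMap.mulLeft k (ρ (gen i)) * (contr ρ g ∘ₗ H i) -
        (contr ρ g ∘ₗ H i) * LinearMap.mulLeft k (ρ (gen i)) : End k A) := by
    refine LinearMap.ext fun x => ?_
    have := congrArg (contr ρ g) (hH x)
    rw [ins_apply, map_add, contr_tmul_mul, hg, mul_zero, zero_add, map_smul, contr_tmul,
      map_one, map_sum] at this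
    simp only [map_sub, contr_tmul_mul] at this
    simpa using this
  have := congrArg (LinearMap.trace k A) key
  rw [map_smul, LinearMap.trace_smulRight, map_sum] at this
  simp only [map_sub, LinearMap.trace_mul_comm k (LinearMap.mulLeft k (ρ (gen _))), sub_self,
    Finset.sum_const_zero, smul_eq_mul] at this
  exact (mul_eq_zero.1 this).resolve_left he

/-- A finite-dimensional algebra in characteristic zero with a suitable separability-like tensor is
simple. -/
theorem isSimpleRing_of_tensor [CharZero k] [Nontrivial A] [FiniteDimensional k A] {ι : Type*}
    [Fintype ι] (p q : ι → A)
    (hin : ∀ x, ∑ i, p i ⊗ₜ[k] (x * q i) = ∑ i, (p i * x) ⊗ₜ[k] q i)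
    (hout : ∀ x, ∑ i, (x * p i) ⊗ₜ[k] q i = ∑ i, p i ⊗ₜ[k] (q i * x))
    (h1 : ∀ g : A →ₗ[k] k, ∑ i, g (q i) • p i = 0 → g 1 = 0)
    (hc : ∀ s, ∃ r : k, ∑ i, p i * s * q i = algebraMap k A r) : IsSimpleRing A := by
  let ω : (A →ₗ[k] k) →ₗ[k] A := ∑ i, (LinearMap.applyₗ (q i)).smulRight (p i)
  have hω : ∀ g, ω g = ∑ i, g (q i) • p i := fun g => by simp [ω]
  have hD : ∀ (g : A →ₗ[k] k) (u v : ι → A),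
      (TensorProduct.rid k A).toLinearMap (LinearMap.lTensor A g (∑ i, u i ⊗ₜ v i)) =
        ∑ i, g (v i) • u i := fun g u v => by simp [map_sum]
  have hR : ∀ g x, ω (g ∘ₗ LinearMap.mulLeft k x) = ω g * x := fun g x => by
    have := congrArg (fun w => (TensorProduct.rid k A).toLinearMap (LinearMap.lTensor A g w))
      (hin x)
    simp only [hD] at this
    simp only [hω, LinearMap.comp_apply, LinearMap.mulLeft_apply, this, Finset.sum_mul,
      smul_mul_assoc]
  have hL : ∀ g x, ω (g ∘ₗ LinearMap.mulRight k x) = x * ω g := fun g x => by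
    have := congrArg (fun w => (TensorProduct.rid k A).toLinearMap (LinearMap.lTensor A g w))
      (hout x)
    simp only [hD] at this
    simp only [hω, LinearMap.comp_apply, LinearMap.mulRight_apply, ← this, Finset.mul_sum,
      mul_smul_comm]
  have hinj : Function.Injective ω := by
    refine (injective_iff_map_eq_zero ω).2 fun g hg => LinearMap.ext fun x => ?_
    have := h1 (g ∘ₗ LinearMap.mulLeft k x) (by rw [← hω, hR, hg, zero_mul])
    simpa using this
  obtain ⟨t, ht⟩ := (LinearMap.injective_iff_surjective_of_finrank_eq_finrank
    (Subspace.dual_finrank_eq (K := k) (V := A))).1 hinj 1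
  have hLR : ∀ x, t ∘ₗ LinearMap.mulRight k x = t ∘ₗ LinearMap.mulLeft k x := fun x =>
    hinj (by rw [hL, hR, ht, one_mul, mul_one])
  have htr : ∀ x y, t (x * y) = t (y * x) := fun x y => LinearMap.congr_fun (hLR y) x
  refine isSimpleRing_of_casimir q p t htr (fun x => ?_) hc
  have := hL t x
  rw [ht, mul_one, hω] at this
  exact this

variable {ρ}

/-- The diagonal class of a fibre makes the fibre simple. -/
theorem isSimpleRing_of_diagonal [CharZero k] [Nontrivial A] [FiniteDimensional k A]
    (hsurj : Function.Surjective ρ) (hz : ∀ z : Ctr k a b c, ∃ r : k, ρ z = algebraMap k A r)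
    (t : Fin 3 → Ctr k a b c) (ht : ∀ l, ρ (t l) = 0)
    (Θ : Sklyanin k a b c ⊗[k] Sklyanin k a b c)
    (hin : ∀ i, ∃ ξ : Fin 3 → Sklyanin k a b c ⊗[k] Sklyanin k a b c,
      (1 ⊗ₜ gen i) * Θ - Θ * (gen i ⊗ₜ 1) = ∑ l, diagDiff (t l) • ξ l)
    (hout : ∀ x : Sklyanin k a b c, ∃ ξ : Fin 3 → Sklyanin k a b c ⊗[k] Sklyanin k a b c,
      (x ⊗ₜ 1) * Θ - Θ * (1 ⊗ₜ x) = ∑ l, diagDiff (t l) • ξ l)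
    (h1 : ∀ g : A →ₗ[k] k,
      contr ρ g (Algebra.TensorProduct.map (AlgHom.id k _) ρ Θ) = 0 → g 1 = 0) :
    IsSimpleRing A := by
  let T := Algebra.TensorProduct.map ρ ρ
  have hT : ∀ ξ : Fin 3 → Sklyanin k a b c ⊗[k] Sklyanin k a b c,
      T (∑ l, diagDiff (t l) • ξ l) = 0 := fun ξ => by
    rw [map_sum]
    refine Finset.sum_eq_zero fun l _ => ?_
    rw [diagDiff_smul, map_mul, map_sub, Algebra.TensorProduct.map_tmul,
      Algebra.TensorProduct.map_tmul, ht, zero_tmul, tmul_zero, sub_zero, zero_mul]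
  have hTin : ∀ s : Sklyanin k a b c, (1 ⊗ₜ ρ s) * T Θ = T Θ * (ρ s ⊗ₜ 1) := by
    intro s
    induction s using gen_induction with
    | halg r =>
      rw [AlgHom.commutes, Algebra.algebraMap_eq_smul_one, tmul_smul, ← smul_tmul', smul_mul_assoc,
        mul_smul_comm, ← Algebra.TensorProduct.one_def, one_mul, mul_one]
    | hgen i =>
      obtain ⟨ξ, hξ⟩ := hin i
      have := congrArg T hξ
      rw [hT, map_sub, map_mul, map_mul, sub_eq_zero] at this
      simpa [T] using this
    | hadd s s' hs hs' => rw [map_add, tmul_add, add_tmul, add_mul, mul_add, hs, hs']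
    | hmul s s' hs hs' =>
      have e1 : (1 : A) ⊗ₜ[k] ρ (s * s') = (1 ⊗ₜ ρ s) * (1 ⊗ₜ ρ s') := by simp
      have e2 : ρ (s * s') ⊗ₜ[k] (1 : A) = (ρ s ⊗ₜ 1) * (ρ s' ⊗ₜ 1) := by simp
      rw [e1, e2, mul_assoc, hs', ← mul_assoc, hs, mul_assoc]
  have hTout : ∀ s : Sklyanin k a b c, (ρ s ⊗ₜ 1) * T Θ = T Θ * (1 ⊗ₜ ρ s) := by
    intro s
    obtain ⟨ξ, hξ⟩ := hout s
    have := congrArg T hξ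
    rw [hT, map_sub, map_mul, map_mul, sub_eq_zero] at this
    simpa [T] using this
  obtain ⟨I, hI⟩ := TensorProduct.exists_finset Θ
  rw [← Finset.sum_coe_sort] at hI
  have hTΘ : T Θ = ∑ i : I, ρ i.1.1 ⊗ₜ ρ i.1.2 := by
    rw [hI, map_sum]
    simp [T]
  refine isSimpleRing_of_tensor (fun i : I => ρ i.1.1) (fun i : I => ρ i.1.2) (fun x => ?_)
    (fun x => ?_) (fun g hg => h1 g ?_) (fun x => ?_)
  · obtain ⟨s, rfl⟩ := hsurj x
    have := hTin s
    rw [hTΘ, Finset.mul_sum, Finset.sum_mul] at this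
    simpa using this
  · obtain ⟨s, rfl⟩ := hsurj x
    have := hTout s
    rw [hTΘ, Finset.mul_sum, Finset.sum_mul] at this
    simpa using this
  · rw [hI, map_sum, map_sum]
    simpa using hg
  · obtain ⟨s, rfl⟩ := hsurj x
    let C : Sklyanin k a b c ⊗[k] Sklyanin k a b c →ₗ[k] Sklyanin k a b c :=
      LinearMap.mul' k _ ∘ₗ LinearMap.rTensor _ (LinearMap.mulRight k s)
    have hC : ∀ p q, C (p ⊗ₜ q) = p * s * q := fun p q => by simp [C]
    have hCl : ∀ x u, C ((x ⊗ₜ 1) * u) = x * C u := fun x u => by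
      induction u with
      | zero => simp
      | tmul p q => simp [hC, mul_assoc]
      | add u v hu hv => rw [mul_add, map_add, hu, hv, map_add, mul_add]
    have hCr : ∀ x u, C (u * (1 ⊗ₜ x)) = C u * x := fun x u => by
      induction u with
      | zero => simp
      | tmul p q => simp [hC, mul_assoc]
      | add u v hu hv => rw [add_mul, map_add, hu, hv, map_add, add_mul]
    have hCz : ∀ (z : Ctr k a b c) u, C (diagDiff z • u) = 0 := fun z u => by
      rw [diagDiff_smul]
      induction u with
      | zero => simp
      | tmul p q =>
        rw [sub_mul, map_sub, Algebra.TensorProduct.tmul_mul_tmul,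
          Algebra.TensorProduct.tmul_mul_tmul, hC, hC, one_mul, one_mul, ← center_comm z p,
          mul_assoc p, ← center_comm z s, ← mul_assoc p s, mul_assoc (p * s), sub_self]
      | add u v hu hv => rw [mul_add, map_add, hu, hv, add_zero]
    have hcen : C Θ ∈ Ctr k a b c := by
      rw [Subalgebra.mem_center_iff]
      intro x
      obtain ⟨ξ, hξ⟩ := hout x
      have := congrArg C hξ
      rwa [map_sub, hCl, hCr, map_sum, Finset.sum_eq_zero fun l _ => hCz (t l) (ξ l),
        sub_eq_zero] at this
    obtain ⟨r, hr⟩ := hz ⟨_, hcen⟩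
    refine ⟨r, ?_⟩
    have e : ρ (C Θ) = ∑ i : I, ρ i.1.1 * ρ s * ρ i.1.2 := by
      rw [hI, map_sum, map_sum]
      simp [hC]
    rw [← hr, ← e]

end Simple

end SklAz

namespace SklAz

open Module Matrix TensorProduct

section FibreSimple

variable {k : Type*} [Field k] {a b c : k} {A : Type*} [Ring A] [Algebra k A]
  {m : Ideal (Ctr k a b c)} {ρ : Sklyanin k a b c →ₐ[k] A}

lemma Fibre.map_eq_zero (hρ : Fibre m ρ) {z : Ctr k a b c} (hz : z ∈ m) : ρ z = 0 := by
  rw [hρ.ker]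
  have := Submodule.smul_mem_smul hz (trivial : (1 : Sklyanin k a b c) ∈ ⊤) (R := Ctr k a b c)
  rwa [ctr_smul, mul_one] at this

lemma Fibre.map_ctr (hρ : Fibre m ρ) {ε : Ctr k a b c →ₐ[k] k} (hε : ∀ z, ε z = 0 ↔ z ∈ m)
    (z : Ctr k a b c) : ρ z = algebraMap k A (ε z) := by
  have := hρ.map_eq_zero (z := z - algebraMap k _ (ε z)) ((hε _).1 (by simp))
  rw [AddSubgroupClass.coe_sub, map_sub, sub_eq_zero] at this
  rw [this]
  exact ρ.commutes _

lemma Fibre.map_smul (hρ : Fibre m ρ) {ε : Ctr k a b c →ₐ[k] k} (hε : ∀ z, ε z = 0 ↔ z ∈ m)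
    (z : Ctr k a b c) (s : Sklyanin k a b c) : ρ (z • s) = ε z • ρ s := by
  rw [ctr_smul, map_mul, hρ.map_ctr hε, Algebra.smul_def]

lemma exists_sum_smul_of_mem_smul_top (t : Fin 3 → Ctr k a b c) {f : Ctr k a b c}
    (hf : ∀ z ∈ m, f * z ∈ Ideal.span (Set.range t)) {w : Sklyanin k a b c}
    (hw : w ∈ (m • ⊤ : Submodule (Ctr k a b c) (Sklyanin k a b c))) :
    ∃ u : Fin 3 → Sklyanin k a b c, ∑ l, t l • u l = f • w := by
  induction hw using Submodule.smul_induction_on' with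
  | smul z hz s _ =>
    obtain ⟨v, hv⟩ := (Ideal.mem_span_range_iff_exists_fun).1 (hf z hz)
    refine ⟨fun l => v l • s, ?_⟩
    rw [smul_smul, ← hv, Finset.sum_smul]
    exact Finset.sum_congr rfl fun l _ => by rw [smul_smul, mul_comm]
  | add x _ y _ hx hy =>
    obtain ⟨u, hu⟩ := hx
    obtain ⟨v, hv⟩ := hy
    exact ⟨u + v, by simp only [Pi.add_apply, smul_add, Finset.sum_add_distrib, hu, hv]⟩

/-- A fibre over a point where the center is cut out by a regular sequence is simple. -/
theorem Fibre.isSimpleRing_of_span [IsAlgClosed k] [CharZero k] [Nontrivial A]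
    [FiniteDimensional k A] (hρ : Fibre m ρ) (hN : Nondeg a b c)
    {ε : Ctr k a b c →ₐ[k] k} (hε : ∀ z, ε z = 0 ↔ z ∈ m) (t : Fin 3 → Ctr k a b c)
    (ht : ∀ l, t l ∈ m) (h1 : Reg1 (Sklyanin k a b c) (t 0))
    (h2 : Reg2 (Sklyanin k a b c) (t 0) (t 1)) (h3 : Reg3 (Sklyanin k a b c) (t 0) (t 1) (t 2))
    {f : Ctr k a b c} (hfm : f ∉ m) (hf : ∀ z ∈ m, f * z ∈ Ideal.span (Set.range t)) :
    IsSimpleRing A := by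
  obtain ⟨φ₁, φ₂, Θ, hK, hout⟩ := exists_diagonal hN t
  have hin : ∀ i, (1 ⊗ₜ gen i) * Θ - Θ * (gen i ⊗ₜ 1) = ∑ l, diagDiff (t l) • φ₂ l i := fun i => by
    have := congrFun hK.eq3 i
    simpa [bi0_apply] using this
  let T := Algebra.TensorProduct.map (AlgHom.id k (Sklyanin k a b c)) ρ
  have hKT := hK.map (α' := tenL ρ) (β' := tenR A a b c) (t' := t) T.toLinearMap
    (fun i u => by
      rw [AlgHom.toLinearMap_apply, tenL_apply, map_mul, Algebra.TensorProduct.map_tmul, map_one]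
      rfl)
    (fun i u => by
      rw [AlgHom.toLinearMap_apply, tenR_apply, map_mul, Algebra.TensorProduct.map_tmul, map_one]
      rfl) (fun l u => by
      rw [diagDiff_smul, ctr_smul_ten, AlgHom.toLinearMap_apply, map_mul, map_sub,
        Algebra.TensorProduct.map_tmul, Algebra.TensorProduct.map_tmul, hρ.map_eq_zero (ht l),
        tmul_zero, sub_zero, AlgHom.id_apply, map_one]
      rfl)
  obtain ⟨j, hj⟩ := hρ.exists_section
  obtain ⟨u, hu⟩ : ∃ u : Fin 3 → A →ₗ[k] (Fin 3 → Sklyanin k a b c), ∀ i x,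
      ∑ l, t l • u i x l = bi0 (homL A a b c) (homR ρ) (f • j) i x := by
    choose u hu using fun i => exists_comp_eq_of_range_le
      (∑ l, ctrMul (t l) ∘ₗ LinearMap.proj l) (bi0 (homL A a b c) (homR ρ) (f • j) i) (fun x => by
        obtain ⟨u, hu⟩ := exists_sum_smul_of_mem_smul_top t hf
          (w := gen i * j x - j (ρ (gen i) * x))
          ((hρ.ker _).1 (by rw [map_sub, map_mul, hj, hj, sub_self]))
        refine ⟨u, ?_⟩
        simp only [LinearMap.sum_apply, LinearMap.comp_apply, LinearMap.proj_apply, ctrMul_apply,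
          hu, bi0_apply, LinearMap.sub_apply, homL_apply, homR_apply, LinearMap.smul_apply,
          mul_ctr_smul, smul_sub])
    exact ⟨u, fun i x => by
      rw [← hu]
      simp⟩
  have hχ₁ : bi0 (homL A a b c) (homR ρ) (f • j) =
      ∑ l, t l • fun i => LinearMap.proj l ∘ₗ u i := by
    funext i
    refine LinearMap.ext fun x => ?_
    rw [← hu]
    simp
  obtain ⟨χ₂, χ₃, hχ₂, hχ₃⟩ := (biSkl_hom ρ).exists_cochain (sMulBi_hom ρ) h1.hom h2.hom h3.hom _ _
    hχ₁
  have hKT' : KosMap a b c (tenL ρ) (tenR A a b c) t 1 (fun l i => T (φ₁ l i))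
      (fun l i => T (φ₂ l i)) (T Θ) := by
    rw [← map_one T]
    exact hKT
  obtain ⟨H, hH⟩ := exists_ins_homotopy ρ hN t hKT' (ε f) (f • j) χ₃ _ χ₂ (fun x => by
    rw [LinearMap.smul_apply, hρ.map_smul hε, hj]) hχ₁ hχ₂ hχ₃
  exact isSimpleRing_of_diagonal hρ.surj (fun z => ⟨ε z, hρ.map_ctr hε z⟩) t
    (fun l => hρ.map_eq_zero (ht l)) Θ (fun i => ⟨_, hin i⟩) hout
    (fun g hg => apply_one_eq_zero ρ (T Θ) (fun h => hfm ((hε f).1 h)) χ₃ H hH g hg)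

end FibreSimple

end SklAz

namespace SklAz

open Module Matrix

section Size

variable {k : Type*} [Field k] {a b c : k} {A : Type*} [Ring A] [Algebra k A]
  {m : Ideal (Ctr k a b c)} {ρ : Sklyanin k a b c →ₐ[k] A}

/-- Lifts of a spanning set of a fibre generate the algebra locally over the center. -/
theorem Fibre.exists_generators [Module.Finite (Ctr k a b c) (Sklyanin k a b c)]
    (hρ : Fibre m ρ) [m.IsMaximal] {ι : Type*} [Fintype ι] (v : ι → Sklyanin k a b c)
    (hv : ∀ x, ∃ r : ι → k, ∑ j, r j • ρ (v j) = x) :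
    ∃ f ∉ m, ∀ s, ∃ z : ι → Ctr k a b c, f • s = ∑ j, z j • v j := by
  obtain ⟨f, hf, hfs⟩ := exists_smul_mem_of_sup m (Submodule.span (Ctr k a b c) (Set.range v))
    (fun s => by
      obtain ⟨r, hr⟩ := hv (ρ s)
      refine ⟨∑ j, r j • v j, Submodule.sum_mem _ fun j _ => ?_, ?_⟩
      · have := Submodule.smul_mem _ (algebraMap k (Ctr k a b c) (r j))
          (Submodule.subset_span (R := Ctr k a b c) (Set.mem_range_self (f := v) j))
        rwa [algebraMap_smul] at this
      · rw [← hρ.ker, map_sub, map_sum, ← hr]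
        simp)
  refine ⟨f, hf, fun s => ?_⟩
  obtain ⟨z, hz⟩ := (Submodule.mem_span_range_iff_exists_fun _).1 (hfs s)
  exact ⟨z, hz.symm⟩

lemma coe_ne_zero_of_notMem {f : Ctr k a b c} (hf : f ∉ m) :
    (f : Sklyanin k a b c) ≠ 0 := fun h => hf (by
  have : f = 0 := Subtype.ext h
  rw [this]
  exact m.zero_mem)

/-- A simple fibre has the maximal possible size. -/
theorem Fibre.nonempty_algEquiv [IsAlgClosed k] [Module.Finite (Ctr k a b c) (Sklyanin k a b c)]
    [NoZeroDivisors (Sklyanin k a b c)] [FiniteDimensional k A]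
    (hρ : Fibre m ρ) [m.IsMaximal] [IsSimpleRing A] {n : ℕ} (hn : 0 < n)
    (hmax : ∃ (M : Type) (_ : AddCommGroup M) (_ : Module k M) (_ : Module (Sklyanin k a b c) M)
      (_ : IsScalarTower k (Sklyanin k a b c) M),
      IsSimpleModule (Sklyanin k a b c) M ∧ Module.rank k M = n)
    (hbound : ∀ (M : Type) (_ : AddCommGroup M) (_ : Module k M)
      (_ : Module (Sklyanin k a b c) M) (_ : IsScalarTower k (Sklyanin k a b c) M),
      IsSimpleModule (Sklyanin k a b c) M → Module.rank k M ≤ n) :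
    Nonempty (A ≃ₐ[k] Matrix (Fin n) (Fin n) k) := by
  obtain ⟨e, he, ⟨φ⟩⟩ := IsSimpleRing.exists_algEquiv_matrix_of_isAlgClosed k A
  obtain ⟨M, _, _, _, _, hM, hrank⟩ := hmax
  have := small_of_rank_pos hn hrank
  have h1 : e ≤ n := size_le_of_bound (NeZero.pos e) (φ.toAlgHom.comp ρ)
    (φ.surjective.comp hρ.surj) hbound
  obtain ⟨ψ, hψ⟩ := exists_matrix_surjection (S := Sklyanin k a b c) hn hrank
  let bas := (Matrix.stdBasis k (Fin e) (Fin e)).map φ.symm.toLinearEquiv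
  let bas' := bas.reindex finProdFinEquiv
  choose v hv using fun i => hρ.surj (bas' i)
  obtain ⟨f, hf, hfs⟩ := hρ.exists_generators v (fun x => ⟨bas'.repr x, by
    simp only [hv]
    exact bas'.sum_repr x⟩)
  let _ := centerAlgebra k (Sklyanin k a b c)
  have hfa : algebraMap (Ctr k a b c) (Sklyanin k a b c) f ≠ 0 := by
    rw [Algebra.algebraMap_eq_smul_one]
    change (f : Sklyanin k a b c) * 1 ≠ 0
    rw [mul_one]
    exact coe_ne_zero_of_notMem hf
  have h2 : n * n ≤ e * e := sq_le_of_generators hn ψ hψ f hfa v hfs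
  have h3 : e = n := le_antisymm h1 (Nat.mul_self_le_mul_self_iff.1 h2)
  subst h3
  exact ⟨φ⟩

/-- A fibre over a smooth point of the center is a matrix algebra. -/
theorem Fibre.isSimpleRing [IsAlgClosed k] [CharZero k] [Nontrivial A] [FiniteDimensional k A]
    [IsNoetherianRing (Ctr k a b c)] [Module.Finite (Ctr k a b c) (Sklyanin k a b c)]
    (hρ : Fibre m ρ) [m.IsMaximal] (hN : Nondeg a b c)
    {ε : Ctr k a b c →ₐ[k] k} (hε : ∀ z, ε z = 0 ↔ z ∈ m)
    (hd : finrank (Ctr k a b c ⧸ m) m.Cotangent = 3) : IsSimpleRing A := by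
  obtain ⟨t₀, ht₀, t₁, ht₁, t₂, ht₂, h1, h2, h3, hn₀, hn₁, hn₂⟩ := hρ.exists_regular_sequence hN
  obtain ⟨f, hf, hfs⟩ := exists_smul_mem_span_of_finrank (t₀ := ⟨t₀, ht₀⟩) (t₁ := ⟨t₁, ht₁⟩)
    (t₂ := ⟨t₂, ht₂⟩) (linearIndependent_toCotangent hn₀ hn₁ hn₂) hd
  refine hρ.isSimpleRing_of_span hN hε ![t₀, t₁, t₂] (forall_fin_three ht₀ ht₁ ht₂) h1 h2 h3 hf ?_
  intro z hz
  have e : Set.range ![t₀, t₁, t₂] = {t₀, t₁, t₂} := by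
    rw [Matrix.range_cons, Matrix.range_cons, Matrix.range_cons, Matrix.range_empty,
      Set.union_empty]
    rfl
  rw [e]
  exact hfs z hz

/-- The cotangent space at a point with a nonzero fibre is at least three-dimensional. -/
theorem Fibre.three_le_finrank [IsAlgClosed k] [Nontrivial A] [FiniteDimensional k A]
    [IsNoetherianRing (Ctr k a b c)] [Module.Finite (Ctr k a b c) (Sklyanin k a b c)]
    (hρ : Fibre m ρ) [m.IsMaximal] (hN : Nondeg a b c) :
    3 ≤ finrank (Ctr k a b c ⧸ m) m.Cotangent := by
  obtain ⟨t₀, ht₀, t₁, ht₁, t₂, ht₂, h1, h2, h3, hn₀, hn₁, hn₂⟩ := hρ.exists_regular_sequence hN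
  exact three_le_finrank_cotangent (t₀ := ⟨t₀, ht₀⟩) (t₁ := ⟨t₁, ht₁⟩) (t₂ := ⟨t₂, ht₂⟩)
    (linearIndependent_toCotangent hn₀ hn₁ hn₂)

end Size

end SklAz

namespace SklAz

open Module Matrix

section Block

variable {k : Type*} [Field k] {B ι : Type*} [Ring B] [Algebra k B] [DecidableEq ι]

/-- Upper triangular block matrices with constant diagonal. -/
def blk (r : B) (u v : ι → B) (h : B) : Matrix (ι ⊕ Bool) (ι ⊕ Bool) B :=
  fromBlocks (diagonal fun _ => r) (of fun p x => cond x (v p) 0) (of fun x q => cond x 0 (u q))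
    (of fun x y => cond x (cond y r 0) (cond y h r))

lemma blk_mul [Fintype ι] (r r' h h' : B) (u v u' v' : ι → B) :
    blk r u v h * blk r' u' v' h' =
      blk (r * r') (fun p => r * u' p + u p * r') (fun p => r * v' p + v p * r')
        (r * h' + ∑ p, u p * v' p + h * r') := by
  rw [blk, blk, fromBlocks_multiply, blk]
  congr 1
  · ext p q
    simp [mul_apply, diagonal_apply]
  · ext p x
    cases x <;> simp [mul_apply, diagonal_apply]
  · ext x p
    cases x <;> simp [mul_apply, diagonal_apply, add_comm]
  · ext x y
    cases x <;> cases y <;> simp [mul_apply]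
    abel

lemma blk_add (r r' h h' : B) (u v u' v' : ι → B) :
    blk r u v h + blk r' u' v' h' = blk (r + r') (u + u') (v + v') (h + h') := by
  rw [blk, blk, fromBlocks_add, blk]
  congr 1
  · ext p q
    by_cases h : p = q <;> simp [h]
  · ext p x
    cases x <;> simp
  · ext x p
    cases x <;> simp
  · ext x y
    cases x <;> cases y <;> simp

lemma blk_smul (s : k) (r h : B) (u v : ι → B) :
    s • blk r u v h = blk (s • r) (s • u) (s • v) (s • h) := by
  rw [blk, fromBlocks_smul, blk]
  congr 1
  · ext p q
    by_cases h : p = q <;> simp [h]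
  · ext p x
    cases x <;> simp
  · ext x p
    cases x <;> simp
  · ext x y
    cases x <;> cases y <;> simp

lemma blk_one : (blk 1 0 0 0 : Matrix (ι ⊕ Bool) (ι ⊕ Bool) B) = 1 := by
  rw [← fromBlocks_one, blk]
  congr 1
  · ext p x
    cases x <;> simp
  · ext x p
    cases x <;> simp
  · ext x y
    cases x <;> cases y <;> simp

lemma blk_zero : (blk 0 0 0 0 : Matrix (ι ⊕ Bool) (ι ⊕ Bool) B) = 0 := by
  rw [← fromBlocks_zero, blk]
  congr 1
  · simp
  · ext p x
    cases x <;> simp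
  · ext x p
    cases x <;> simp
  · ext x y
    cases x <;> cases y <;> simp

lemma blk_corner (r h : B) (u v : ι → B) : blk r u v h (Sum.inr false) (Sum.inr true) = h := rfl

end Block

section Twisted

variable {k : Type*} [Field k] {a b c : k} {B : Type*} [Ring B] [Algebra k B]
  (ρ : Sklyanin k a b c →ₐ[k] B)

/-- Derivations along an algebra homomorphism. -/
def IsDer (ψ : Sklyanin k a b c →ₗ[k] B) : Prop := ∀ s t, ψ (s * t) = ρ s * ψ t + ψ s * ρ t

/-- Left multiplication by the images of the generators. -/
def adL (i : Fin 3) : End k B := LinearMap.mulLeft k (ρ (gen i))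

/-- Right multiplication by the images of the generators. -/
def adR (i : Fin 3) : End k B := LinearMap.mulRight k (ρ (gen i))

@[simp] lemma adL_apply (i : Fin 3) (x : B) : adL ρ i x = ρ (gen i) * x := rfl

@[simp] lemma adR_apply (i : Fin 3) (x : B) : adR ρ i x = x * ρ (gen i) := rfl

/-- The cup product of cochains of degree one. -/
def cup (a b c : k) (P Q : Fin 3 → B) (l : Fin 3) : B :=
  a • (P (l + 1) * Q (l + 2)) + b • (P (l + 2) * Q (l + 1)) + c • (P l * Q l)

variable {ρ}

lemma IsDer.apply_one {ψ : Sklyanin k a b c →ₗ[k] B} (hψ : IsDer ρ ψ) : ψ 1 = 0 := by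
  have := hψ 1 1
  rw [mul_one, map_one ρ, one_mul, mul_one] at this
  exact left_eq_add.1 this

lemma IsDer.bi1 {ψ : Sklyanin k a b c →ₗ[k] B} (hψ : IsDer ρ ψ) :
    bi1 a b c (adL ρ) (adR ρ) (fun i => ψ (gen i)) = 0 := by
  funext l
  have := congrArg ψ (isSkl_gen (k := k) (a := a) (b := b) (c := c) l)
  simp only [map_add, map_smul, hψ _ _, map_zero, smul_add] at this
  simp only [bi1_apply, adL_apply, adR_apply, Pi.zero_apply]
  rw [← this]
  abel

/-- Cochains with prescribed coboundary exist as soon as the defining relations allow it. -/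
theorem exists_twisted {ι : Type*} [Fintype ι] {ψ ψ' : ι → Sklyanin k a b c →ₗ[k] B}
    (hψ : ∀ p, IsDer ρ (ψ p)) (hψ' : ∀ p, IsDer ρ (ψ' p)) (g : Fin 3 → B)
    (hg : ∀ l, bi1 a b c (adL ρ) (adR ρ) g l +
      ∑ p, cup a b c (fun i => ψ p (gen i)) (fun i => ψ' p (gen i)) l = 0) :
    ∃ h : Sklyanin k a b c →ₗ[k] B, (∀ i, h (gen i) = g i) ∧
      ∀ s t, h (s * t) = ρ s * h t + ∑ p, ψ p s * ψ' p t + h s * ρ t := by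
  classical
  let y : Fin 3 → Matrix (ι ⊕ Bool) (ι ⊕ Bool) B := fun i =>
    blk (ρ (gen i)) (fun p => ψ p (gen i)) (fun p => ψ' p (gen i)) (g i)
  have hy : IsSkl a b c y := fun l => by
    have h1 : ∀ {φ : Sklyanin k a b c →ₗ[k] B}, IsDer ρ φ →
        c • (ρ (gen l) * φ (gen l) + φ (gen l) * ρ (gen l)) +
          a • (ρ (gen (l + 1)) * φ (gen (l + 2)) + φ (gen (l + 1)) * ρ (gen (l + 2))) +
          b • (ρ (gen (l + 2)) * φ (gen (l + 1)) + φ (gen (l + 2)) * ρ (gen (l + 1))) = 0 :=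
      fun {φ} hφ => by
        have := congrArg φ (isSkl_gen (k := k) (a := a) (b := b) (c := c) l)
        simpa only [map_add, map_smul, hφ _ _, map_zero] using this
    simp only [y, blk_mul, blk_smul, blk_add]
    rw [← blk_zero]
    congr 1
    · exact isSkl_gen.map ρ l
    · funext p
      exact h1 (hψ p)
    · funext p
      exact h1 (hψ' p)
    · rw [← hg l]
      simp only [bi1_apply, adL_apply, adR_apply, cup, smul_add, Finset.sum_add_distrib,
        Finset.smul_sum]
      abel
  let M := lift y hy
  have hM : ∀ s, ∃ r, M s = blk (ρ s) (fun p => ψ p s) (fun p => ψ' p s) r := by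
    intro s
    induction s using gen_induction with
    | halg r =>
      refine ⟨0, ?_⟩
      rw [AlgHom.commutes, Algebra.algebraMap_eq_smul_one, ← blk_one, blk_smul, AlgHom.commutes]
      congr 1
      · exact Algebra.algebraMap_eq_smul_one r |>.symm
      · funext p
        simp [Algebra.algebraMap_eq_smul_one, (hψ p).apply_one]
      · funext p
        simp [Algebra.algebraMap_eq_smul_one, (hψ' p).apply_one]
      · simp
    | hgen i => exact ⟨g i, lift_gen ..⟩
    | hadd s s' hs hs' =>
      obtain ⟨r, hr⟩ := hs
      obtain ⟨r', hr'⟩ := hs'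
      refine ⟨r + r', ?_⟩
      rw [map_add, hr, hr', blk_add]
      simp only [map_add]
      rfl
    | hmul s s' hs hs' =>
      obtain ⟨r, hr⟩ := hs
      obtain ⟨r', hr'⟩ := hs'
      refine ⟨ρ s * r' + ∑ p, ψ p s * ψ' p s' + r * ρ s', ?_⟩
      rw [map_mul, hr, hr', blk_mul]
      simp only [hψ _ _ _, hψ' _ _ _, map_mul]
  let h : Sklyanin k a b c →ₗ[k] B :=
    { toFun := fun s => M s (Sum.inr false) (Sum.inr true)
      map_add' := fun s t => by rw [map_add, Matrix.add_apply]
      map_smul' := fun r s => by rw [map_smul, Matrix.smul_apply, RingHom.id_apply] }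
  have hh : ∀ s, M s = blk (ρ s) (fun p => ψ p s) (fun p => ψ' p s) (h s) := fun s => by
    obtain ⟨r, hr⟩ := hM s
    have : h s = r := by
      change M s (Sum.inr false) (Sum.inr true) = r
      rw [hr, blk_corner]
    rw [this, hr]
  refine ⟨h, fun i => ?_, fun s t => ?_⟩
  · change M (gen i) (Sum.inr false) (Sum.inr true) = g i
    rw [lift_gen]
    rfl
  · change M (s * t) (Sum.inr false) (Sum.inr true) = _
    rw [map_mul, hh, hh, blk_mul, blk_corner]

end Twisted

end SklAz

namespace SklAz

open Module Matrix

section Deriv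

variable {k : Type*} [Field k] {a b c : k} {B : Type*} [Ring B] [Algebra k B]
  {ρ : Sklyanin k a b c →ₐ[k] B}

lemma biSkl_ad : BiSkl a b c (adL ρ) (adR ρ) where
  left l := LinearMap.ext fun x => by
    have := congrArg (· * x) (isSkl_gen.map ρ l)
    simpa [add_mul, mul_assoc] using this
  right l := LinearMap.ext fun x => by
    have := congrArg (x * ·) (isSkl_gen.map ρ l)
    simp only [mul_add, mul_smul_comm, ← mul_assoc, mul_zero] at this
    simp only [LinearMap.add_apply, LinearMap.smul_apply, Module.End.mul_apply, adR_apply,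
      LinearMap.zero_apply]
    rw [← this]
    abel
  comm i j m := (mul_assoc _ _ _).symm

/-- The cup product of two cocycles is a cocycle. -/
lemma bi2_cup {P Q : Fin 3 → B} (hP : bi1 a b c (adL ρ) (adR ρ) P = 0)
    (hQ : bi1 a b c (adL ρ) (adR ρ) Q = 0) : bi2 (adL ρ) (adR ρ) (cup a b c P Q) = 0 := by
  have h : bi2 (adL ρ) (adR ρ) (cup a b c P Q) =
      ∑ l, bi1 a b c (adL ρ) (adR ρ) P l * Q l - ∑ l, P l * bi1 a b c (adL ρ) (adR ρ) Q l := by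
    simp [bi2_apply, bi1_apply, cup, Fin.sum_univ_three, fin3_add, mul_add, add_mul, mul_assoc]
    abel
  simp [h, hP, hQ]

/-- Cocycles extend to derivations. -/
theorem exists_isDer {g : Fin 3 → B} (hg : bi1 a b c (adL ρ) (adR ρ) g = 0) :
    ∃ ψ : Sklyanin k a b c →ₗ[k] B, IsDer ρ ψ ∧ ∀ i, ψ (gen i) = g i := by
  obtain ⟨h, h1, h2⟩ := exists_twisted (ρ := ρ) (ι := Fin 0) (ψ := fun _ => 0) (ψ' := fun _ => 0)
    (fun p => p.elim0) (fun p => p.elim0) g (fun l => by simp [hg])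
  exact ⟨h, fun s t => by simpa using h2 s t, h1⟩

lemma IsDer.eq_zero {ψ : Sklyanin k a b c →ₗ[k] B} (hψ : IsDer ρ ψ) (h : ∀ i, ψ (gen i) = 0) :
    ψ = 0 := by
  refine LinearMap.ext fun s => ?_
  induction s using gen_induction with
  | halg r => simp [Algebra.algebraMap_eq_smul_one, hψ.apply_one]
  | hgen i => exact h i
  | hadd s t hs ht => rw [map_add, hs, ht]; simp
  | hmul s t hs ht => rw [hψ, hs, ht]; simp

variable (ρ) in
/-- The space of derivations along `ρ`. -/
def derSubmodule : Submodule k (Sklyanin k a b c →ₗ[k] B) where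
  carrier := {ψ | IsDer ρ ψ}
  zero_mem' s t := by simp
  add_mem' {ψ φ} hψ hφ s t := by
    simp only [LinearMap.add_apply, hψ s t, hφ s t, mul_add, add_mul]
    abel
  smul_mem' r ψ hψ s t := by simp [hψ s t]

variable (ρ) in
/-- Inner derivations. -/
def inner : B →ₗ[k] (Sklyanin k a b c →ₗ[k] B) :=
  LinearMap.mk₂ k (fun x s => x * ρ s - ρ s * x)
    (fun x y s => by simp only [add_mul, mul_add]; abel)
    (fun r x s => by simp [smul_sub])
    (fun x s t => by simp only [map_add, add_mul, mul_add]; abel)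
    (fun r x s => by simp [smul_sub])

lemma inner_apply (x : B) (s : Sklyanin k a b c) : inner ρ x s = x * ρ s - ρ s * x := rfl

lemma sub_mem_range_bi2 (x : B) (s : Sklyanin k a b c) :
    ρ s * x - x * ρ s ∈ LinearMap.range (bi2 (adL ρ) (adR ρ)) := by
  classical
  induction s using gen_induction generalizing x with
  | halg r => simp [Algebra.commutes]
  | hgen i => exact ⟨Pi.single i x, by
      rw [bi2_apply, Finset.sum_eq_single i (fun j _ hj => by simp [hj]) (by simp)]
      simp⟩
  | hadd s t hs ht =>
    have := Submodule.add_mem _ (hs x) (ht x)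
    convert this using 1
    rw [map_add, add_mul, mul_add]
    abel
  | hmul s t hs ht =>
    have := Submodule.add_mem _ (hs (ρ t * x)) (ht (x * ρ s))
    convert this using 1
    rw [map_mul]
    noncomm_ring

end Deriv

section Inner

variable {k : Type*} [Field k] {n : ℕ}

lemma mul_single_one (x : Matrix (Fin n) (Fin n) k) (i o : Fin n) :
    x * single i o (1 : k) = ∑ j, x j i • single j o 1 := by
  ext p q
  simp only [Matrix.sum_apply, Matrix.smul_apply, single_apply, mul_apply, smul_eq_mul]
  by_cases h : o = q
  · simp [h]
  · simp [h]

lemma single_one_mul (x : Matrix (Fin n) (Fin n) k) (o j : Fin n) :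
    single o j (1 : k) * x = ∑ i, x j i • single o i 1 := by
  ext p q
  simp only [Matrix.sum_apply, Matrix.smul_apply, single_apply, mul_apply, smul_eq_mul]
  by_cases h : o = p
  · simp [h]
  · simp [h]

lemma sum_single_mul_single (o : Fin n) :
    ∑ i : Fin n, single i o (1 : k) * single o i 1 = 1 := by
  simp [sum_single_one]

/-- Derivations of a matrix algebra are inner. -/
theorem exists_inner (hn : 0 < n) {D : Matrix (Fin n) (Fin n) k →ₗ[k] Matrix (Fin n) (Fin n) k}
    (hD : ∀ x y, D (x * y) = x * D y + D x * y) : ∃ C, ∀ x, D x = C * x - x * C := by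
  let o : Fin n := ⟨0, hn⟩
  refine ⟨∑ i, D (single i o 1) * single o i 1, fun x => ?_⟩
  have h1 : ∀ i, D (x * single i o 1) = ∑ j, x j i • D (single j o 1) := fun i => by
    rw [mul_single_one, map_sum]
    simp only [map_smul]
  have h2 : (∑ i, D (single i o 1) * single o i 1) * x =
      ∑ i, D (x * single i o 1) * single o i 1 := by
    simp only [h1, Finset.sum_mul, mul_assoc, single_one_mul, Finset.mul_sum, smul_mul_assoc, mul_smul_comm]
    exact Finset.sum_comm
  rw [h2]
  simp only [hD, add_mul, Finset.sum_add_distrib, mul_assoc, ← Finset.mul_sum, sum_single_mul_single]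
  simp

variable {a b c : k} {m : Ideal (Ctr k a b c)} {ρ : Sklyanin k a b c →ₐ[k] Matrix (Fin n) (Fin n) k}
  {ψ : Sklyanin k a b c →ₗ[k] Matrix (Fin n) (Fin n) k}

/-- Derivations vanishing on `m` are inner. -/
theorem Fibre.exists_inner (hρ : Fibre m ρ) (hn : 0 < n) (hψ : IsDer ρ ψ)
    (h0 : ∀ z ∈ m, ψ (z : Sklyanin k a b c) = 0) : ∃ C, inner ρ C = ψ := by
  have hker : ∀ s, ρ s = 0 → ψ s = 0 := fun s hs => by
    rw [hρ.ker] at hs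
    induction hs using Submodule.smul_induction_on' with
    | smul z hz t ht => rw [ctr_smul, hψ, hρ.map_eq_zero hz, h0 z hz, zero_mul, zero_mul, add_zero]
    | add s _ t _ hs ht => rw [map_add, hs, ht, add_zero]
  obtain ⟨D, hD⟩ := exists_comp_eq_of_ker_le ρ.toLinearMap ψ hker
  have hD' : ∀ s, D (ρ s) = ψ s := LinearMap.congr_fun hD
  obtain ⟨C, hC⟩ := SklAz.exists_inner hn (D := D) (fun x y => by
    obtain ⟨s, rfl⟩ := hρ.surj x
    obtain ⟨t, rfl⟩ := hρ.surj y
    rw [← map_mul, hD', hD', hD', hψ])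
  exact ⟨C, LinearMap.ext fun s => by rw [← hD', hC, inner_apply]⟩

/-- Derivations take scalar values on `m`. -/
lemma Fibre.exists_eq_smul_one (hρ : Fibre m ρ) (hψ : IsDer ρ ψ) {z : Ctr k a b c} (hz : z ∈ m) :
    ∃ r : k, ψ (z : Sklyanin k a b c) = r • 1 := by
  have h : ψ (z : Sklyanin k a b c) ∈ Subalgebra.center k (Matrix (Fin n) (Fin n) k) :=
    Subalgebra.mem_center_iff.2 fun x => by
      obtain ⟨s, rfl⟩ := hρ.surj x
      have := congrArg ψ (center_comm z s)
      rw [hψ, hψ, hρ.map_eq_zero hz, mul_zero, zero_mul, add_zero, zero_add] at this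
      exact this
  rw [Algebra.IsCentral.center_eq_bot] at h
  obtain ⟨r, hr⟩ := Algebra.mem_bot.1 h
  exact ⟨r, by rw [← hr, Algebra.algebraMap_eq_smul_one]⟩

lemma Fibre.eq_zero_of_mem_sq (hρ : Fibre m ρ) (hψ : IsDer ρ ψ) {z : Ctr k a b c}
    (hz : z ∈ m ^ 2) : ψ (z : Sklyanin k a b c) = 0 := by
  rw [pow_two] at hz
  induction hz using Submodule.mul_induction_on' with
  | mem_mul_mem x hx y hy =>
    rw [MulMemClass.coe_mul, hψ, hρ.map_eq_zero hx, hρ.map_eq_zero hy, zero_mul, mul_zero,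
      add_zero]
  | add x _ y _ hx hy => rw [AddMemClass.coe_add, map_add, hx, hy, add_zero]

end Inner

end SklAz

namespace SklAz

open Module Matrix

section Coords

variable {k Z : Type*} [Field k] [CommRing Z] [Algebra k Z] {m : Ideal Z} {ε : Z →ₐ[k] k}

/-- Dual bases of the cotangent space, given by point derivations. -/
theorem exists_point_derivations [hm : m.IsMaximal] [Module.Finite (Z ⧸ m) m.Cotangent]
    (hε : ∀ z, ε z = 0 ↔ z ∈ m) :
    ∃ (w : Fin (finrank (Z ⧸ m) m.Cotangent) → Z)
      (l : Fin (finrank (Z ⧸ m) m.Cotangent) → Z →ₗ[k] k),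
      (∀ p, w p ∈ m) ∧ (∀ p z z', l p (z * z') = ε z * l p z' + ε z' * l p z) ∧
      (∀ p q, l p (w q) = if p = q then 1 else 0) ∧
      ∀ z ∈ m, ∃ r : Fin (finrank (Z ⧸ m) m.Cotangent) → k, z - ∑ p, r p • w p ∈ m ^ 2 := by
  let _ : Field (Z ⧸ m) := Ideal.Quotient.field m
  let b := finBasis (Z ⧸ m) m.Cotangent
  let e : Z ⧸ m →ₐ[k] k := Ideal.Quotient.liftₐ m ε fun z hz => (hε z).2 hz
  have he : ∀ z, e (Ideal.Quotient.mk m z) = ε z := fun z => rfl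
  let π : Z → m := fun z => ⟨z - algebraMap k Z (ε z), (hε _).1 (by simp)⟩
  have hπ : ∀ z (hz : z ∈ m), π z = ⟨z, hz⟩ := fun z hz => Subtype.ext (by
    simp [π, (hε z).2 hz])
  have hadd : ∀ z z', π (z + z') = π z + π z' := fun z z' => Subtype.ext (by
    simp only [π, map_add, Submodule.coe_add]
    ring)
  have hsmul : ∀ (r : k) z, m.toCotangent (π (r • z)) =
      Ideal.Quotient.mk m (algebraMap k Z r) • m.toCotangent (π z) := fun r z => by
    rw [toCotangent_smul_mk]
    congr 1
    refine Subtype.ext ?_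
    simp only [π, Algebra.smul_def, map_mul, SetLike.val_smul]
    simp [mul_sub]
  have hmul : ∀ z z', m.toCotangent (π (z * z')) = Ideal.Quotient.mk m z • m.toCotangent (π z') +
      Ideal.Quotient.mk m (algebraMap k Z (ε z')) • m.toCotangent (π z) := fun z z' => by
    rw [toCotangent_smul_mk, toCotangent_smul_mk, ← map_add]
    congr 1
    refine Subtype.ext ?_
    simp only [π, map_mul, smul_eq_mul, SetLike.val_smul, Submodule.coe_add]
    ring
  choose w hw using fun p => m.toCotangent_surjective (b p)
  refine ⟨fun p => w p, fun p =>
    { toFun := fun z => e (b.coord p (m.toCotangent (π z)))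
      map_add' := fun z z' => by rw [hadd, map_add, map_add, map_add]
      map_smul' := fun r z => by
        rw [hsmul, map_smul, smul_eq_mul, map_mul, he, AlgHom.commutes, RingHom.id_apply]
        rfl }, fun p => (w p).2, fun p z z' => ?_, fun p q => ?_, fun z hz => ?_⟩
  · change e (b.coord p (m.toCotangent (π (z * z')))) = _
    rw [hmul, map_add, map_smul, map_smul, smul_eq_mul, smul_eq_mul, map_add, map_mul, map_mul,
      he, he, AlgHom.commutes]
    rfl
  · change e (b.coord p (m.toCotangent (π (w q)))) = _
    rw [hπ _ (w q).2]
    change e (b.coord p (m.toCotangent (w q))) = _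
    rw [hw, b.coord_apply, b.repr_self, Finsupp.single_apply]
    by_cases h : p = q
    · simp [h]
    · rw [if_neg (Ne.symm h), if_neg h, map_zero]
  · choose r hr using fun p => Ideal.Quotient.mk_surjective (b.repr (m.toCotangent ⟨z, hz⟩) p)
    refine ⟨fun p => ε (r p), ?_⟩
    have h := b.sum_repr (m.toCotangent ⟨z, hz⟩)
    have hr' : ∀ p, b.repr (m.toCotangent ⟨z, hz⟩) p =
        Ideal.Quotient.mk m (algebraMap k Z (ε (r p))) := fun p => by
      rw [← hr, Ideal.Quotient.eq]
      exact (hε _).1 (by simp)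
    simp only [hr', ← hw, toCotangent_smul_mk] at h
    rw [← map_sum, eq_comm, Ideal.toCotangent_eq] at h
    simpa [Algebra.smul_def] using h

/-- Generators of minimal size are linearly independent. -/
theorem eq_zero_of_generators {R S : Type*} [CommRing R] [Ring S] [Algebra R S]
    [NoZeroDivisors S] {n N : ℕ} (hn : 0 < n) (hN : N ≤ n * n) (ρ : S →+* Matrix (Fin n) (Fin n) k)
    (hρ : Function.Surjective ρ) {f : R} (hf : algebraMap R S f ≠ 0) {v : Fin N → S}
    (hv : ∀ s, ∃ z : Fin N → R, f • s = ∑ j, z j • v j)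
    (hR : Function.Injective (algebraMap R S))
    {w : Fin N → R} (hw : ∑ j, w j • v j = 0) : w = 0 := by
  by_contra hne
  obtain ⟨j, hj⟩ := Function.ne_iff.1 hne
  obtain ⟨r, rfl⟩ : ∃ r, N = r + 1 := Nat.exists_eq_succ_of_ne_zero j.pos.ne'
  have h := sq_le_of_generators hn ρ hρ (w j * f)
    (by
      rw [map_mul]
      exact mul_ne_zero (fun h => hj (hR (h.trans (map_zero _).symm))) hf)
    (fun i => v (j.succAbove i)) (fun s => by
      obtain ⟨z, hz⟩ := hv s
      refine ⟨fun i => w j * z (j.succAbove i) - z j * w (j.succAbove i), ?_⟩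
      rw [mul_smul, hz, ← sub_zero (w j • _), ← smul_zero (z j), ← hw, Finset.smul_sum,
        Finset.smul_sum, ← Finset.sum_sub_distrib, Fin.sum_univ_succAbove _ j]
      simp only [smul_smul, ← sub_smul]
      rw [mul_comm (w j) (z j), sub_self, zero_smul, zero_add])
  omega

end Coords

section Lift

variable {k : Type*} [Field k] {a b c : k} {n : ℕ} {m : Ideal (Ctr k a b c)}
  {ρ : Sklyanin k a b c →ₐ[k] Matrix (Fin n) (Fin n) k}

/-- A point derivation of the center lifts to a map which is a derivation over the center. -/
theorem Fibre.exists_lift [Module.Finite (Ctr k a b c) (Sklyanin k a b c)]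
    [NoZeroDivisors (Sklyanin k a b c)] (hρ : Fibre m ρ) [m.IsMaximal] (hn : 0 < n)
    {ε : Ctr k a b c →ₐ[k] k} (hε : ∀ z, ε z = 0 ↔ z ∈ m) {l : Ctr k a b c →ₗ[k] k}
    (hl : ∀ z z', l (z * z') = ε z * l z' + ε z' * l z) :
    ∃ L : Sklyanin k a b c →ₗ[k] Matrix (Fin n) (Fin n) k,
      ∀ (z : Ctr k a b c) s, L (z • s) = ε z • L s + l z • ρ s := by
  let bas := (Matrix.stdBasis k (Fin n) (Fin n)).reindex finProdFinEquiv
  choose v hv using fun i => hρ.surj (bas i)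
  obtain ⟨f, hf, hfs⟩ := hρ.exists_generators v (fun x => ⟨bas.repr x, by
    simp only [hv]
    exact bas.sum_repr x⟩)
  choose ζ hζ using hfs
  let _ := centerAlgebra k (Sklyanin k a b c)
  have hmap : ∀ z : Ctr k a b c, algebraMap (Ctr k a b c) (Sklyanin k a b c) z = z := fun z => by
    rw [Algebra.algebraMap_eq_smul_one]
    exact mul_one _
  have huniq : ∀ {w w' : Fin (n * n) → Ctr k a b c}, ∑ j, w j • v j = ∑ j, w' j • v j → w = w' :=
    fun {w w'} h => sub_eq_zero.1 (eq_zero_of_generators (f := f) hn le_rfl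
      (ρ : Sklyanin k a b c →+* Matrix (Fin n) (Fin n) k) hρ.surj
      (by rw [hmap]; exact coe_ne_zero_of_notMem hf) (fun s => ⟨ζ s, hζ s⟩)
      (fun z z' h => Subtype.ext (by rwa [hmap, hmap] at h))
      (by simp only [Pi.sub_apply, sub_smul, Finset.sum_sub_distrib, h, sub_self]))
  have hadd : ∀ s t, ζ (s + t) = ζ s + ζ t := fun s t => huniq (by
    simp only [← hζ, smul_add, Pi.add_apply, add_smul, Finset.sum_add_distrib])
  have hsmul : ∀ (z : Ctr k a b c) s, ζ (z • s) = z • ζ s := fun z s => huniq (by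
    simp only [← hζ, Pi.smul_apply, smul_assoc, ← Finset.smul_sum]
    exact smul_comm _ _ _)
  have hf0 : ε f ≠ 0 := fun h => hf ((hε f).1 h)
  have hρs : ∀ s, ∑ j, ε (ζ s j) • ρ (v j) = ε f • ρ s := fun s => by
    rw [← hρ.map_smul hε, hζ, map_sum]
    simp only [hρ.map_smul hε]
  have hL : ∀ (z : Ctr k a b c) s, (ε f)⁻¹ • ∑ j, l (ζ (z • s) j) • ρ (v j) =
      ε z • ((ε f)⁻¹ • ∑ j, l (ζ s j) • ρ (v j)) + l z • ρ s := fun z s => by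
    have h1 : ρ s = (ε f)⁻¹ • ∑ j, ε (ζ s j) • ρ (v j) := by
      rw [hρs, inv_smul_smul₀ hf0]
    rw [h1, smul_comm (ε z), smul_comm (l z), ← smul_add]
    congr 1
    rw [Finset.smul_sum, Finset.smul_sum, ← Finset.sum_add_distrib]
    refine Finset.sum_congr rfl fun j _ => ?_
    rw [hsmul, Pi.smul_apply, smul_eq_mul, hl, add_smul, smul_smul, smul_smul, mul_comm (l z)]
  have h1 : l 1 = 0 := by
    have := hl 1 1
    rw [mul_one, map_one ε, one_mul] at this
    exact left_eq_add.1 this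
  exact ⟨{
    toFun := fun s => (ε f)⁻¹ • ∑ j, l (ζ s j) • ρ (v j)
    map_add' := fun s t => by
      rw [hadd, ← smul_add, ← Finset.sum_add_distrib]
      simp only [Pi.add_apply, map_add, add_smul]
    map_smul' := fun r s => by
      have := hL (algebraMap k _ r) s
      rw [AlgHom.commutes, algebraMap_smul, Algebra.algebraMap_eq_smul_one, Algebra.algebraMap_eq_smul_one,
        _root_.map_smul l, h1, smul_zero, zero_smul, add_zero, smul_assoc, one_smul] at this
      exact this }, hL⟩

/-- A point derivation of the center lifts to a derivation. -/
theorem Fibre.exists_isDer [Module.Finite (Ctr k a b c) (Sklyanin k a b c)]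
    [NoZeroDivisors (Sklyanin k a b c)] (hρ : Fibre m ρ) [m.IsMaximal] (hn : 0 < n)
    {ε : Ctr k a b c →ₐ[k] k} (hε : ∀ z, ε z = 0 ↔ z ∈ m) {l : Ctr k a b c →ₗ[k] k}
    (hl : ∀ z z', l (z * z') = ε z * l z' + ε z' * l z) :
    ∃ ψ : Sklyanin k a b c →ₗ[k] Matrix (Fin n) (Fin n) k, IsDer ρ ψ ∧
      ∀ z : Ctr k a b c, ψ z = l z • 1 := by
  obtain ⟨L, hL⟩ := hρ.exists_lift hn hε hl
  have hker : ∀ s t, ρ s = 0 → L (s * t) = L s * ρ t := fun s t hs => by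
    rw [hρ.ker] at hs
    induction hs using Submodule.smul_induction_on' with
    | smul z hz u hu =>
      rw [ctr_smul, mul_assoc, ← ctr_smul, ← ctr_smul, hL, hL, (hε z).2 hz, map_mul ρ]
      simp
    | add s _ t _ hs ht => rw [add_mul, map_add, map_add, hs, ht, add_mul]
  let o : Fin n := ⟨0, hn⟩
  choose e he using fun i => hρ.surj (single o i 1)
  let M : Sklyanin k a b c →ₗ[k] Matrix (Fin n) (Fin n) k :=
    ∑ i, LinearMap.mulLeft k (single i o 1) ∘ₗ L ∘ₗ LinearMap.mulLeft k (e i)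
  have hMa : ∀ s, M s = ∑ i, single i o 1 * L (e i * s) := fun s => by
    simp [M]
  have hM : ∀ s t, M (s * t) = ρ s * M t + M s * ρ t - ρ s * M 1 * ρ t := fun s t => by
    obtain ⟨r, hr⟩ : ∃ r : Fin n → Fin n → k, ∀ i j, r i j = ρ s i j := ⟨_, fun _ _ => rfl⟩
    have hr1 : ∀ i, single o i 1 * ρ s = ∑ j, r i j • single o j 1 := fun i => by
      simp only [hr, single_one_mul]
    have hr2 : ∀ j, ρ s * single j o 1 = ∑ i, r i j • single i o 1 := fun i => by
      simp only [hr, mul_single_one]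
    have h1 : ∀ i, L (e i * (s * t)) = ∑ j, r i j • L (e j * t) + L (e i * s) * ρ t -
        ∑ j, r i j • (L (e j) * ρ t) := fun i => by
      have := hker (e i * s - ∑ j, r i j • e j) t (by
        rw [map_sub, map_mul, he, hr1, map_sum]
        simp only [_root_.map_smul ρ, he, sub_self])
      rw [sub_mul, map_sub, Finset.sum_mul, map_sum, map_sub, map_sum, sub_mul, Finset.sum_mul,
        sub_eq_iff_eq_add] at this
      simp only [smul_mul_assoc, _root_.map_smul L] at this
      rw [← mul_assoc, this]
      abel
    have h2 : ∀ y : Fin n → Matrix (Fin n) (Fin n) k, ∑ i, single i o 1 * ∑ j, r i j • y j =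
        ρ s * ∑ j, single j o 1 * y j := fun y => by
      simp only [Finset.mul_sum, ← mul_assoc, hr2, Finset.sum_mul, mul_smul_comm,
        smul_mul_assoc]
      exact Finset.sum_comm
    simp only [hMa, h1, mul_add, mul_sub, Finset.sum_add_distrib, Finset.sum_sub_distrib, h2,
      mul_one]
    simp only [Finset.sum_mul, Finset.mul_sum, mul_assoc]
  refine ⟨M - LinearMap.mulLeft k (M 1) ∘ₗ ρ.toLinearMap, fun s t => ?_, fun z => ?_⟩
  · simp only [LinearMap.sub_apply, LinearMap.comp_apply, LinearMap.mulLeft_apply,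
      AlgHom.toLinearMap_apply, hM, map_mul]
    noncomm_ring
  · have h1 : ∀ i, L (e i * z) = ε z • L (e i * 1) + l z • single o i 1 := fun i => by
      rw [center_comm, ← ctr_smul, mul_one, hL, he]
    have h2 : M z = ε z • M 1 + l z • 1 := by
      simp only [hMa, h1, mul_add, Finset.sum_add_distrib, mul_smul_comm, ← Finset.smul_sum,
        sum_single_mul_single]
    rw [LinearMap.sub_apply, LinearMap.comp_apply, LinearMap.mulLeft_apply,
      AlgHom.toLinearMap_apply, hρ.map_ctr hε, h2, Algebra.algebraMap_eq_smul_one, mul_smul_comm,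
      mul_one, add_sub_cancel_left]

end Lift

end SklAz

namespace SklAz

open Module Matrix

section Count

variable {k : Type*} [Field k] {a b c : k} {n : ℕ} {m : Ideal (Ctr k a b c)}
  {ρ : Sklyanin k a b c →ₐ[k] Matrix (Fin n) (Fin n) k}

lemma finrank_range_inner_add_one_le (hn : 0 < n) :
    finrank k (LinearMap.range (inner ρ)) + 1 ≤ n * n := by
  have h := (inner ρ).finrank_range_add_finrank_ker
  rw [finrank_matrix, finrank_self, Fintype.card_fin, mul_one] at h
  have : Nonempty (Fin n) := ⟨⟨0, hn⟩⟩
  have h1 : 0 < finrank k (LinearMap.ker (inner ρ)) :=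
    finrank_pos_iff_exists_ne_zero.2 ⟨⟨1, LinearMap.ext fun s => by simp [inner_apply]⟩,
      fun h => one_ne_zero (congrArg Subtype.val h)⟩
  omega

/-- Cocycles are bounded by the tangent space. -/
theorem Fibre.finrank_ker_bi1_add_one_le (hρ : Fibre m ρ) (hn : 0 < n) {d : ℕ}
    {w : Fin d → Ctr k a b c} (hw : ∀ p, w p ∈ m)
    (hm : ∀ z ∈ m, ∃ r : Fin d → k, z - ∑ p, r p • w p ∈ m ^ 2) :
    finrank k (LinearMap.ker (bi1 a b c (adL ρ) (adR ρ))) + 1 ≤ n * n + d := by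
  let o : Fin n := ⟨0, hn⟩
  let ev : derSubmodule ρ →ₗ[k] (Fin 3 → Matrix (Fin n) (Fin n) k) :=
    LinearMap.pi (fun i => LinearMap.applyₗ (gen i)) ∘ₗ (derSubmodule ρ).subtype
  have hev : Function.Injective ev := by
    intro ψ φ h
    rw [← sub_eq_zero]
    refine Subtype.ext (IsDer.eq_zero (ψ - φ).2 fun i => ?_)
    exact sub_eq_zero.2 (congrFun h i)
  have : FiniteDimensional k (derSubmodule ρ) := FiniteDimensional.of_injective ev hev
  have h1 : finrank k (LinearMap.ker (bi1 a b c (adL ρ) (adR ρ))) ≤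
      finrank k (derSubmodule ρ) := by
    refine (Submodule.finrank_mono fun g hg => ?_).trans (LinearMap.finrank_range_le ev)
    obtain ⟨ψ, hψ, hg⟩ := SklAz.exists_isDer (LinearMap.mem_ker.1 hg)
    exact ⟨⟨ψ, hψ⟩, funext hg⟩
  let θ : derSubmodule ρ →ₗ[k] (Fin d → k) :=
    LinearMap.pi (fun p => entryLinearMap k k o o ∘ₗ
      LinearMap.applyₗ (M₂ := Matrix (Fin n) (Fin n) k) (w p : Sklyanin k a b c)) ∘ₗ (derSubmodule ρ).subtype
  have hθ : ∀ ψ ∈ LinearMap.ker θ, ψ.1 ∈ LinearMap.range (inner ρ) := by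
    intro ψ hψ
    have h2 : ∀ p, ψ.1 (w p : Sklyanin k a b c) = 0 := fun p => by
      obtain ⟨r, hr⟩ := hρ.exists_eq_smul_one ψ.2 (hw p)
      have h3 : ψ.1 (w p : Sklyanin k a b c) o o = 0 :=
        congrFun (LinearMap.mem_ker.1 hψ) p
      rw [hr, Matrix.smul_apply, one_apply_eq, smul_eq_mul, mul_one] at h3
      rw [hr, h3, zero_smul]
    refine hρ.exists_inner hn ψ.2 fun z hz => ?_
    obtain ⟨r, hr⟩ := hm z hz
    have h3 := hρ.eq_zero_of_mem_sq ψ.2 hr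
    rw [AddSubgroupClass.coe_sub, map_sub, sub_eq_zero] at h3
    rw [h3, AddSubmonoidClass.coe_finsetSum, map_sum]
    refine Finset.sum_eq_zero fun p _ => ?_
    rw [Subalgebra.coe_smul, _root_.map_smul ψ.1, h2, smul_zero]
  have h4 : finrank k (LinearMap.ker θ) ≤ finrank k (LinearMap.range (inner ρ)) :=
    LinearMap.finrank_le_finrank_of_injective
      (f := ((derSubmodule ρ).subtype ∘ₗ (LinearMap.ker θ).subtype).codRestrict _
        fun ψ => hθ ψ ψ.2) (fun ψ φ h => by
        have h : ψ.1.1 = φ.1.1 := (Subtype.ext_iff.1 h :)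
        exact Subtype.ext (Subtype.ext h))
  have h5 := LinearMap.finrank_range_add_finrank_ker (V := derSubmodule ρ) (V₂ := Fin d → k) θ
  have h6 : finrank k (LinearMap.range θ) ≤ d := by
    simpa using Submodule.finrank_le (LinearMap.range θ)
  have h7 := finrank_range_inner_add_one_le (ρ := ρ) hn
  omega

/-- The second cocycles form a space of small dimension. -/
theorem finrank_ker_bi2_le (hn : 0 < n) (hρ : Function.Surjective ρ) :
    finrank k (LinearMap.ker (bi2 (adL ρ) (adR ρ))) ≤ 2 * (n * n) + 1 := by
  let o : Fin n := ⟨0, hn⟩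
  have h1 : ∀ x y, y * x - x * y ∈ LinearMap.range (bi2 (adL ρ) (adR ρ)) := fun x y => by
    obtain ⟨s, rfl⟩ := hρ y
    exact sub_mem_range_bi2 x s
  have h2 : LinearMap.range (bi2 (adL ρ) (adR ρ)) ⊔ Submodule.span k {single o o (1 : k)} = ⊤ := by
    rw [eq_top_iff]
    intro x _
    rw [matrix_eq_sum_single x]
    refine Submodule.sum_mem _ fun i _ => Submodule.sum_mem _ fun j _ => ?_
    rw [← mul_one (x i j), ← smul_eq_mul, ← smul_single]
    refine Submodule.smul_mem _ _ ?_
    by_cases h : i = j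
    · subst h
      have h3 := h1 (single o i (1 : k)) (single i o 1)
      rw [single_mul_single_same, single_mul_single_same, mul_one] at h3
      rw [← sub_add_cancel (single i i (1 : k)) (single o o 1)]
      exact Submodule.add_mem _ (Submodule.mem_sup_left h3)
        (Submodule.mem_sup_right (Submodule.subset_span rfl))
    · have h3 := h1 (single i j (1 : k)) (single i i 1)
      rw [single_mul_single_same, single_mul_single_of_ne _ _ _ _ (Ne.symm h), mul_one,
        sub_zero] at h3
      exact Submodule.mem_sup_left h3
  have h3 := Submodule.finrank_add_le_finrank_add_finrank
    (LinearMap.range (bi2 (adL ρ) (adR ρ))) (Submodule.span k {single o o (1 : k)})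
  rw [h2, finrank_top, finrank_matrix, finrank_self, Fintype.card_fin, mul_one] at h3
  have h4 : finrank k (Submodule.span k {single o o (1 : k)}) ≤ 1 := by
    simpa using finrank_span_le_card ({single o o 1} : Set (Matrix (Fin n) (Fin n) k))
  have h5 := (bi2 (adL ρ) (adR ρ)).finrank_range_add_finrank_ker
  rw [finrank_pi_fintype] at h5
  simp [finrank_matrix] at h5
  omega

/-- The cotangent space at a point whose fibre is a matrix algebra is at most
three-dimensional. -/
theorem Fibre.finrank_le_three [IsNoetherianRing (Ctr k a b c)]
    [Module.Finite (Ctr k a b c) (Sklyanin k a b c)] [NoZeroDivisors (Sklyanin k a b c)]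
    (hρ : Fibre m ρ) [m.IsMaximal] (hn : 0 < n)
    {ε : Ctr k a b c →ₐ[k] k} (hε : ∀ z, ε z = 0 ↔ z ∈ m) :
    finrank (Ctr k a b c ⧸ m) m.Cotangent ≤ 3 := by
  have := finite_cotangent (m := m)
  obtain ⟨w, l, hw, hl, hlw, hm⟩ := exists_point_derivations hε
  generalize finrank (Ctr k a b c ⧸ m) m.Cotangent = d at w l hw hl hlw hm ⊢
  have h1 := hρ.finrank_ker_bi1_add_one_le hn hw hm
  have h2 := finrank_ker_bi2_le hn hρ.surj
  choose ψ hψ hψz using fun p => hρ.exists_isDer hn hε (hl p)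
  let ι := Σ p : Fin d, Fin p
  let q : ι → Fin d := fun x => ⟨x.2, x.2.2.trans x.1.2⟩
  have hq : ∀ x, q x < x.1 := fun x => x.2.2
  let Φ : (ι → k) × (Fin 3 → Matrix (Fin n) (Fin n) k) →ₗ[k] (Fin 3 → Matrix (Fin n) (Fin n) k) :=
    LinearMap.coprod (Fintype.linearCombination k fun x =>
      cup a b c (fun i => ψ x.1 (gen i)) (fun i => ψ (q x) (gen i)))
      (bi1 a b c (adL ρ) (adR ρ))
  have hΦ : ∀ r g, Φ (r, g) = ∑ x, r x • cup a b c (fun i => ψ x.1 (gen i))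
      (fun i => ψ (q x) (gen i)) + bi1 a b c (adL ρ) (adR ρ) g := fun r g => by
    simp [Φ, Fintype.linearCombination_apply]
  have hrange : LinearMap.range Φ ≤ LinearMap.ker (bi2 (adL ρ) (adR ρ)) := by
    rintro _ ⟨⟨r, g⟩, rfl⟩
    rw [hΦ, LinearMap.mem_ker, map_add, biSkl_ad.bi2_bi1, map_sum]
    simp only [_root_.map_smul (bi2 (adL ρ) (adR ρ)), bi2_cup (hψ _).bi1 (hψ _).bi1, smul_zero, Finset.sum_const_zero, add_zero]
  have hker : ∀ r g, Φ (r, g) = 0 → r = 0 := fun r g h => by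
    obtain ⟨χ, -, hχ⟩ := exists_twisted (ρ := ρ) (ψ := fun x : ι => ψ x.1)
      (ψ' := fun x => r x • ψ (q x)) (fun x => hψ _) (fun x => (derSubmodule ρ).smul_mem _ (hψ _)) g
      (fun l => by
        have := congrFun h l
        rw [hΦ, add_comm, Pi.add_apply, Finset.sum_apply] at this
        simpa [cup, smul_comm _ (r _)] using this)
    have hχw : ∀ i j, χ (w i * w j : Sklyanin k a b c) =
        ∑ x : ι, (if x.1 = i ∧ q x = j then r x else 0) • (1 : Matrix (Fin n) (Fin n) k) :=
      fun i j => by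
        rw [hχ, hρ.map_eq_zero (hw i), hρ.map_eq_zero (hw j), zero_mul, mul_zero, zero_add,
          add_zero]
        refine Finset.sum_congr rfl fun x _ => ?_
        rw [LinearMap.smul_apply, hψz, hψz, hlw, hlw]
        by_cases h1 : x.1 = i <;> by_cases h2 : q x = j <;> simp [h1, h2]
    funext y
    have h3 := hχw y.1 (q y)
    rw [center_comm, hχw, ← Finset.sum_smul, ← Finset.sum_smul] at h3
    have h4 : ∑ x : ι, (if x.1 = y.1 ∧ q x = q y then r x else 0) = r y := by
      rw [Finset.sum_eq_single y (fun x _ hx => if_neg fun h => hx ?_) (by simp),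
        if_pos ⟨rfl, rfl⟩]
      obtain ⟨i, j⟩ := x
      obtain ⟨i', j'⟩ := y
      obtain ⟨rfl : i = i', h2⟩ := h
      exact congrArg (Sigma.mk i) (Fin.ext (Fin.val_eq_of_eq h2 :))
    have h5 : ∑ x : ι, (if x.1 = q y ∧ q x = y.1 then r x else 0) = 0 :=
      Finset.sum_eq_zero fun x _ => if_neg fun h =>
        lt_asymm (hq y) (by rw [← h.1, ← h.2]; exact hq x)
    rw [h4, h5, zero_smul] at h3
    simpa using (congrFun (congrFun h3 ⟨0, hn⟩) ⟨0, hn⟩).symm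
  have h3 := Φ.finrank_range_add_finrank_ker
  have h4 := Submodule.finrank_mono hrange
  have h5 : finrank k (LinearMap.ker Φ) ≤
      finrank k (LinearMap.ker (bi1 a b c (adL ρ) (adR ρ))) :=
    LinearMap.finrank_le_finrank_of_injective
      (f := (LinearMap.snd k _ _ ∘ₗ (LinearMap.ker Φ).subtype).codRestrict _ fun y => by
        have h := hΦ y.1.1 y.1.2
        rw [LinearMap.mem_ker.1 y.2, hker y.1.1 y.1.2 y.2] at h
        simpa using h.symm) (fun y y' h => by
        have h : y.1.2 = y'.1.2 := congrArg Subtype.val h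
        exact Subtype.ext (Prod.ext ((hker _ _ y.2).trans (hker _ _ y'.2).symm) h))
  have h6 : Fintype.card ι * 2 = d * (d - 1) := by
    rw [← Finset.sum_range_id_mul_two, ← Fin.sum_univ_eq_sum_range]
    simp [ι, Fintype.card_sigma]
  have h7 : finrank k ((ι → k) × (Fin 3 → Matrix (Fin n) (Fin n) k)) =
      Fintype.card ι + 3 * (n * n) := by
    rw [finrank_prod, finrank_pi, finrank_pi_fintype]
    simp [finrank_matrix]
  have h8 : d * (d - 1) ≤ 2 * d := by omega
  by_contra! h9
  have h10 : d * 3 ≤ d * (d - 1) := Nat.mul_le_mul_left _ (by omega)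
  omega

end Count

end SklAz

namespace SklAz

open Module Matrix

section Main

variable {k : Type*} [Field k] {a b c : k} {m : Ideal (Ctr k a b c)}

lemma mem_span_iff_mem_smul_top (s : Sklyanin k a b c) :
    s ∈ TwoSidedIdeal.span ((fun z : Ctr k a b c => (z : Sklyanin k a b c)) '' m) ↔
      s ∈ (m • ⊤ : Submodule (Ctr k a b c) (Sklyanin k a b c)) := by
  constructor
  · intro h
    let I : TwoSidedIdeal (Sklyanin k a b c) := .mk'
      (m • ⊤ : Submodule (Ctr k a b c) (Sklyanin k a b c)) (Submodule.zero_mem _)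
      (Submodule.add_mem _) (Submodule.neg_mem _)
      (fun hy => mul_mem_smul_top m _ hy)
      (fun hx => mul_mem_of_mem_smul (fun z hz _ => Submodule.smul_mem_smul hz trivial) hx)
    refine (TwoSidedIdeal.mem_mk' _ _ _ _ _ _ _).1 (TwoSidedIdeal.mem_span_iff.1 h I ?_)
    rintro _ ⟨z, hz, rfl⟩
    refine (TwoSidedIdeal.mem_mk' _ _ _ _ _ _ _).2 ?_
    have := Submodule.smul_mem_smul hz (trivial : (1 : Sklyanin k a b c) ∈ ⊤) (R := Ctr k a b c)
    rwa [ctr_smul, mul_one] at this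
  · intro h
    induction h using Submodule.smul_induction_on' with
    | smul z hz s _ =>
      exact TwoSidedIdeal.mul_mem_right _ _ _ (TwoSidedIdeal.subset_span ⟨z, hz, rfl⟩)
    | add s _ t _ hs ht => exact TwoSidedIdeal.add_mem _ hs ht

variable (m) in
/-- The projection onto the central quotient. -/
def toCentralQuot : Sklyanin k a b c →ₐ[k] Sklyanin.centralQuot k a b c m :=
  (TwoSidedIdeal.span ((fun z : Ctr k a b c => (z : Sklyanin k a b c)) '' m)).ringCon.mkₐ k

lemma fibre_toCentralQuot : Fibre m (toCentralQuot m) where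
  surj := RingCon.mkₐ_surjective _
  ker s := by
    rw [← mem_span_iff_mem_smul_top, TwoSidedIdeal.mem_iff, ← RingCon.eq]
    rfl

variable {A : Type*} [Ring A] [Algebra k A] {ρ : Sklyanin k a b c →ₐ[k] A}

lemma Fibre.comp_equiv {B : Type*} [Ring B] [Algebra k B] (hρ : Fibre m ρ) (e : A ≃ₐ[k] B) :
    Fibre m ((e : A →ₐ[k] B).comp ρ) where
  surj := e.surjective.comp hρ.surj
  ker s := by simp [hρ.ker]

lemma Fibre.finiteDimensional [Module.Finite (Ctr k a b c) (Sklyanin k a b c)] (hρ : Fibre m ρ)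
    {ε : Ctr k a b c →ₐ[k] k} (hε : ∀ z, ε z = 0 ↔ z ∈ m) : FiniteDimensional k A := by
  obtain ⟨G, hG⟩ := Module.Finite.fg_top (R := Ctr k a b c) (M := Sklyanin k a b c)
  classical
  refine ⟨G.image ρ, eq_top_iff.2 fun x _ => ?_⟩
  obtain ⟨s, rfl⟩ := hρ.surj x
  have hs : s ∈ Submodule.span (Ctr k a b c) (G : Set (Sklyanin k a b c)) := hG ▸ trivial
  induction hs using Submodule.span_induction with
  | mem s hs => exact Submodule.subset_span (by simpa using ⟨s, hs, rfl⟩)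
  | zero => rw [map_zero]; exact Submodule.zero_mem _
  | add s t _ _ hs ht => rw [map_add]; exact Submodule.add_mem _ (hs trivial) (ht trivial)
  | smul z s _ hs => rw [hρ.map_smul hε]; exact Submodule.smul_mem _ _ (hs trivial)

lemma Fibre.nontrivial [Module.Finite (Ctr k a b c) (Sklyanin k a b c)] (hρ : Fibre m ρ)
    [hm : m.IsMaximal] : Nontrivial A := by
  by_contra! h
  have h1 : (⊤ : Submodule (Ctr k a b c) (Sklyanin k a b c)) ≤ m • ⊤ := fun s _ =>
    (hρ.ker s).1 (Subsingleton.elim _ _)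
  obtain ⟨r, hr, h2⟩ := Submodule.exists_sub_one_mem_and_smul_eq_zero_of_fg_of_le_smul m _
    Module.Finite.fg_top h1
  have h3 := h2 1 trivial
  rw [ctr_smul, mul_one] at h3
  have h4 : r = 0 := Subtype.ext h3
  refine hm.ne_top ((Ideal.eq_top_iff_one m).2 ?_)
  rw [← sub_sub_cancel r 1]
  exact m.sub_mem (h4 ▸ m.zero_mem) hr

end Main

end SklAz

set_option synthInstance.maxHeartbeats 1000000 in
set_option maxHeartbeats 1000000 in
/-- **The Azumaya locus of a PI 3-dimensional Sklyanin algebra equals the smooth locus of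
its center**: assume `S = S(a,b,c)` is module-finite over its center `Z`, let `n` be the
maximal `k`-dimension of a simple left `S`-module (attained by some simple module), and let
`m` be a maximal ideal of `Z`.  Then `S/(mS) ≅ M_n(k)` as `k`-algebras if and only if
`dim_{Z/m} (m/m²) = 3`. -/
theorem sklyanin_azumaya_locus_eq_smooth_locus
    (k : Type*) [Field k] [IsAlgClosed k] [CharZero k]
    (a b c : k) (habc : a * b * c ≠ 0)
    (hdeg : (3 * a * b * c) ^ 3 ≠ (a ^ 3 + b ^ 3 + c ^ 3) ^ 3)
    (hfin : Module.Finite ↥(Subalgebra.center k (Sklyanin k a b c)) (Sklyanin k a b c))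
    (n : ℕ) (hn : 0 < n)
    (hmax : ∃ (M : Type) (_ : AddCommGroup M) (_ : Module k M) (_ : Module (Sklyanin k a b c) M)
      (_ : IsScalarTower k (Sklyanin k a b c) M),
      IsSimpleModule (Sklyanin k a b c) M ∧ Module.rank k M = n)
    (hbound : ∀ (M : Type) (_ : AddCommGroup M) (_ : Module k M)
      (_ : Module (Sklyanin k a b c) M) (_ : IsScalarTower k (Sklyanin k a b c) M),
      IsSimpleModule (Sklyanin k a b c) M → Module.rank k M ≤ n)
    (m : Ideal ↥(Subalgebra.center k (Sklyanin k a b c))) (hm : m.IsMaximal) :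
    Nonempty (Sklyanin.centralQuot k a b c m ≃ₐ[k] Matrix (Fin n) (Fin n) k) ↔
      Module.finrank (↥(Subalgebra.center k (Sklyanin k a b c)) ⧸ m) m.Cotangent = 3 := by
  have hN : SklAz.Nondeg a b c :=
    { ha := left_ne_zero_of_mul (left_ne_zero_of_mul habc)
      hb := right_ne_zero_of_mul (left_ne_zero_of_mul habc)
      hc := right_ne_zero_of_mul habc
      hdeg := hdeg }
  have := SklAz.ctr_noetherian hfin
  have : IsNoetherian ↥(Subalgebra.center k (Sklyanin k a b c)) (Sklyanin k a b c) :=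
    isNoetherian_of_isNoetherianRing_of_finite _ _
  have := SklAz.noZeroDivisors hN
  have := SklAz.center_finiteType SklAz.sklyanin_top_fg hfin
  obtain ⟨ε, hε⟩ := SklAz.exists_character (k := k) m
  have hρ := SklAz.fibre_toCentralQuot (m := m)
  have := hρ.finiteDimensional hε
  have := hρ.nontrivial
  refine ⟨fun ⟨e⟩ => ?_, fun hd => ?_⟩
  · exact le_antisymm ((hρ.comp_equiv e).finrank_le_three hn hε) (hρ.three_le_finrank hN)
  · have := hρ.isSimpleRing hN hε hd
    exact hρ.nonempty_algEquiv hn hmax hbound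

end
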